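/- Let ℚ̄ be an algebraic closure of ℚ and N ≥ 1. Let Ω be a finitely generated subgroup of the group (ℚ̄ˣ)^N and let Σ ⊆ Ω be a subset. Then there exist finitely many elements s₁, …, s_b ∈ (ℚ̄ˣ)^N and subgroups T₁, …, T_b of (ℚ̄ˣ)^N, where each T_j is of the form T_j = { t = (t₁,…,t_N) ∈ (ℚ̄ˣ)^N : ∏_{i=1}^N t_i^{c_i} = 1 for all c = (c₁,…,c_N) ∈ C_j } for some subset C_j ⊆ ℤ^N, such that: (i) Σ ⊆ ⋃_{j=1}^b s_j·T_j, and (ii) every polynomial f ∈ ℚ̄[X₁,…,X_N] that vanishes at every point of Σ also vanishes at every point of each coset s_j·T_j. (Equivalently, the Zariski closure of Σ in the torus (𝔾_m)^N is the finite union of the translates s_j·T_j of algebraic subgroups.) -/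

import Mathlib

section
open Filter Finset
noncomputable section
namespace Lau
structure SD (K : Type) [Field K] where
  σ : Type
  [fin : Fintype σ]
  s0 : σ
  v : σ → AbsoluteValue K ℝ
  O : Subring K
  R : Subring K
  le : O ≤ R
  frac : ∀ a : K, ∃ c ∈ O, c ≠ 0 ∧ c * a ∈ O
  prod_ge : ∀ a ∈ R, a ≠ 0 → 1 ≤ ∏ s, v s a
  ht : K → ℝ
  ht_nonneg : ∀ a, 0 ≤ ht a
  ht_add : ∀ a b, ht (a + b) ≤ ht a + ht b + Real.log 2
  ht_mul : ∀ a b, ht (a * b) ≤ ht a + ht b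
  ht_abs : ∀ s a, a ≠ 0 → |Real.log (v s a)| ≤ ht a
  roth1 : ∀ g : Polynomial K, g ≠ 0 → (∀ i, g.coeff i ∈ R) → ∀ (ξ : K) (e : ℕ),
    (Polynomial.X - Polynomial.C ξ) ^ e ∣ g → e * ht ξ ≤ ∑ s, Real.log (∑ i ∈ g.support, v s (g.coeff i))
  fm : ∀ (n : ℕ), 0 < n → ∀ (L : σ → (Fin n → K) ≃ₗ[K] (Fin n → K)), ∃ C : ℝ, ∀ w : σ → Fin n → ℝ,
    ∃ z : Fin n → K, z ≠ 0 ∧ (∀ i, z i ∈ R) ∧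
      ∏ s, ∑ i, Real.exp (w s i) * v s (L s z i) ≤ C * Real.exp ((∑ s, ∑ i, w s i) / n)
  sl : ∃ C : ℝ, 1 ≤ C ∧ ∀ (α β : Type) [Fintype α] [Fintype β] (A : α → β → K) (B : ℝ), 1 ≤ B →
    (∀ a b, A a b ∈ O) → (∀ s a b, v s (A a b) ≤ B) → 0 < Fintype.card β →
    2 * Fintype.card α ≤ Fintype.card β → ∃ p : β → K, p ≠ 0 ∧ (∀ b, p b ∈ R) ∧
      (∀ a, ∑ b, A a b * p b = 0) ∧ ∀ s b, v s (p b) ≤ C * Fintype.card β * B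
attribute [instance] SD.fin
variable {K : Type} [Field K] (D : SD K)
abbrev SD.GL (n : ℕ) := D.σ → (Fin n → K) ≃ₗ[K] (Fin n → K)
def SD.Nv {n : ℕ} (L : D.GL n) (c : D.σ → Fin n → ℝ) (x : ℝ) (s : D.σ) (z : Fin n → K) : ℝ :=
  ∑ i, Real.exp (c s i * x) * D.v s (L s z i)
def SD.H {n : ℕ} (L : D.GL n) (c : D.σ → Fin n → ℝ) (x : ℝ) (z : Fin n → K) : ℝ :=
  ∏ s, D.Nv L c x s z
variable {D} {n : ℕ} {L : D.GL n} {c : D.σ → Fin n → ℝ} {x : ℝ}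
lemma Nv_nonneg (s : D.σ) (z : Fin n → K) : 0 ≤ D.Nv L c x s z :=
  sum_nonneg fun _ _ => mul_nonneg (Real.exp_pos _).le ((D.v s).nonneg _)
lemma Nv_pos (s : D.σ) {z : Fin n → K} (hz : z ≠ 0) : 0 < D.Nv L c x s z := by
  obtain ⟨i, hi⟩ : ∃ i, L s z i ≠ 0 := by
    by_contra! h
    exact hz ((L s).map_eq_zero_iff.1 (funext h))
  exact sum_pos' (fun _ _ => mul_nonneg (Real.exp_pos _).le ((D.v s).nonneg _))
    ⟨i, mem_univ _, mul_pos (Real.exp_pos _) ((D.v s).pos hi)⟩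
lemma H_nonneg (z : Fin n → K) : 0 ≤ D.H L c x z := prod_nonneg fun s _ => Nv_nonneg s z
lemma av_sum {α : Type*} (w : AbsoluteValue K ℝ) (S : Finset α) (f : α → K) :
    w (∑ i ∈ S, f i) ≤ ∑ i ∈ S, w (f i) := w.sum_le S f
lemma det_le_wt (w : AbsoluteValue K ℝ) (M : Matrix (Fin n) (Fin n) K) (a : Fin n → ℝ) (ha : ∀ i, 0 < a i) :
    (∏ i, a i) * w M.det ≤ ∏ j, ∑ i, a i * w (M j i) := by
  rw [← Matrix.det_transpose, Matrix.det_apply']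
  refine (mul_le_mul_of_nonneg_left (av_sum _ _ _) (prod_nonneg fun i _ => (ha i).le)).trans ?_
  rw [prod_univ_sum, Finset.mul_sum]
  have : ∀ p : Equiv.Perm (Fin n), (∏ i, a i) * w ((Equiv.Perm.sign p : ℤ) * ∏ i, M.transpose (p i) i) = ∏ j, a (p j) * w (M j (p j)) := by
    intro p
    rw [map_mul, map_prod]
    have : w ((Equiv.Perm.sign p : ℤ) : K) = 1 := by
      rcases Int.units_eq_one_or (Equiv.Perm.sign p) with h | h <;> simp [h]
    rw [this, one_mul, prod_mul_distrib, Equiv.prod_comp p a]; rfl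
  simp_rw [this]
  rw [← sum_image (f := fun q : Fin n → Fin n => ∏ j, a (q j) * w (M j (q j))) (s := univ)
    (g := fun p : Equiv.Perm (Fin n) => (p : Fin n → Fin n)) (by
      intro a _ b _ h; exact DFunLike.coe_injective h)]
  apply sum_le_sum_of_subset_of_nonneg
  · intro q _; simp
  · intros; exact prod_nonneg fun _ _ => mul_nonneg (ha _).le (w.nonneg _)
lemma det_mem {R : Subring K} {m : Type*} [Fintype m] [DecidableEq m] (M : Matrix m m K) (h : ∀ i j, M i j ∈ R) : M.det ∈ R := by
  rw [Matrix.det_apply']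
  refine R.sum_mem fun p _ => R.mul_mem (intCast_mem R _) (R.prod_mem fun i _ => h _ _)
lemma hadamard (L : D.GL n) (c : D.σ → Fin n → ℝ) : ∃ C > 0, ∀ (x : ℝ) (b : Fin n → Fin n → K), LinearIndependent K b →
    (∀ j i, b j i ∈ D.R) → Real.exp ((∑ s, ∑ i, c s i) * x) ≤ C * ∏ j, D.H L c x (b j) := by
  set δ : D.σ → K := fun s => LinearMap.det (L s : (Fin n → K) →ₗ[K] (Fin n → K)) with hδ
  have hδ0 : ∀ s, δ s ≠ 0 := fun s => by
    simpa [hδ] using (LinearEquiv.isUnit_det' (L s)).ne_zero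
  have hp : 0 < ∏ s, D.v s (δ s) := prod_pos fun s _ => (D.v s).pos (hδ0 s)
  refine ⟨(∏ s, D.v s (δ s))⁻¹, inv_pos.2 hp, fun x b hb hR => ?_⟩
  rw [inv_mul_eq_div, le_div_iff₀ hp]
  have hdet : (Matrix.of b).det ≠ 0 := by
    have := (Matrix.linearIndependent_rows_iff_isUnit (A := Matrix.of b)).1 hb
    exact ((Matrix.isUnit_iff_isUnit_det _).1 this).ne_zero
  have h1 := D.prod_ge _ (det_mem (Matrix.of b) (fun i j => hR i j)) hdet
  have key : ∀ s, Real.exp ((∑ i, c s i) * x) * (D.v s (δ s) * D.v s (Matrix.of b).det) ≤ ∏ j, D.Nv L c x s (b j) := by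
    intro s
    have := det_le_wt (D.v s) (Matrix.of fun j => L s (b j)) (fun i => Real.exp (c s i * x)) (fun i => Real.exp_pos _)
    rw [← Real.exp_sum, ← sum_mul] at this
    have e : (Matrix.of fun j => L s (b j)) = Matrix.of b * (LinearMap.toMatrix' (L s : (Fin n → K) →ₗ[K] (Fin n → K))).transpose := by
      ext j i
      have : L s (b j) = (LinearMap.toMatrix' (L s : (Fin n → K) →ₗ[K] (Fin n → K))).mulVec (b j) := by
        rw [LinearMap.toMatrix'_mulVec]; rfl
      simp only [Matrix.of_apply, this, Matrix.mulVec, Matrix.mul_apply, dotProduct, Matrix.transpose_apply]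
      exact sum_congr rfl fun _ _ => mul_comm _ _
    rw [e, Matrix.det_mul, Matrix.det_transpose, LinearMap.det_toMatrix', map_mul, mul_comm (D.v s _) (D.v s _), ← e] at this
    exact this
  calc _ = ∏ s, (Real.exp ((∑ i, c s i) * x) * D.v s (δ s)) := by
        rw [prod_mul_distrib, ← Real.exp_sum, sum_mul]
    _ ≤ (∏ s, (Real.exp ((∑ i, c s i) * x) * D.v s (δ s))) * ∏ s, D.v s (Matrix.of b).det := by
        refine le_mul_of_one_le_right ?_ h1
        exact prod_nonneg fun s _ => mul_nonneg (Real.exp_pos _).le ((D.v s).nonneg _)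
    _ = ∏ s, (Real.exp ((∑ i, c s i) * x) * (D.v s (δ s) * D.v s (Matrix.of b).det)) := by
        rw [← prod_mul_distrib]; simp_rw [mul_assoc]
    _ ≤ ∏ s, ∏ j, D.Nv L c x s (b j) := prod_le_prod (fun s _ => mul_nonneg (Real.exp_pos _).le (mul_nonneg ((D.v s).nonneg _) ((D.v s).nonneg _))) fun s _ => key s
    _ = ∏ j, D.H L c x (b j) := Finset.prod_comm
lemma davenport {ι V : Type*} [DecidableEq ι] [Nonempty ι] [AddCommGroup V] [Module K V] [FiniteDimensional K V] (w : AbsoluteValue K ℝ)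
    (ℓ : ι → V →ₗ[K] K) (a : ι → ℝ) (ha : ∀ i, 0 < a i) (W : ℕ → Submodule K V) (hW : Monotone W)
    (hd : ∀ j, Module.finrank K (W j) ≤ j) (n : ℕ) : ∀ (I : Finset ι), #I = n →
    ∃ π : ℕ → ι, Set.InjOn π (Finset.range n) ∧ (Finset.range n).image π = I ∧ ∀ j ≤ n, ∀ z ∈ W j,
      ∑ i ∈ I, a i * w (ℓ i z) ≤ 2 ^ (n - j) * ∑ k ∈ Finset.range j, a (π k) * w (ℓ (π k) z) := by
  induction n with
  | zero =>
    intro I hI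
    rw [card_eq_zero] at hI
    subst hI
    exact ⟨fun _ => Classical.arbitrary ι, by simp, by simp, by intro j hj z hz; simp [Nat.le_zero.1 hj]⟩
  | succ n ih =>
    intro I hI
    obtain ⟨β, hβ, hβ0⟩ : ∃ β : ι → K, (∀ z ∈ W n, ∑ i ∈ I, β i * ℓ i z = 0) ∧ ∃ i ∈ I, β i ≠ 0 := by
      have hnot : ¬ LinearIndependent K (fun i : I => (ℓ i).domRestrict (W n)) := by
        intro h
        have := h.fintype_card_le_finrank
        rw [Subspace.dual_finrank_eq] at this
        have := hd n
        simp at *; omega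
      rw [Fintype.not_linearIndependent_iff] at hnot
      obtain ⟨g, hg, i, hi⟩ := hnot
      refine ⟨fun i => if h : i ∈ I then g ⟨i, h⟩ else 0, fun z hz => ?_, i, i.2, by simpa using hi⟩
      have := congrArg (fun f => f ⟨z, hz⟩) hg
      rw [← sum_coe_sort]
      simpa using this
    obtain ⟨i0, hi0, hmax⟩ := exists_max_image I (fun i => w (β i) / a i) (by rw [← card_pos]; omega)
    have hb0 : 0 < w (β i0) := by
      obtain ⟨i, hi, hne⟩ := hβ0
      have := hmax i hi
      have h2 : 0 < w (β i) / a i := div_pos (w.pos hne) (ha i)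
      have h3 : 0 < w (β i0) / a i0 := lt_of_lt_of_le h2 this
      by_contra hcon
      have h0 : w (β i0) = 0 := le_antisymm (not_lt.1 hcon) (w.nonneg _)
      simp [h0] at h3
    obtain ⟨π', hinj, him, hle⟩ := ih (I.erase i0) (by rw [card_erase_of_mem hi0]; omega)
    have hne : ∀ k < n, π' k ≠ i0 := by
      intro k hk h
      have : π' k ∈ I.erase i0 := by rw [← him]; exact mem_image_of_mem _ (by simpa using hk)
      simp [h] at this
    have hsum : ∀ f : ι → ℝ, ∑ i ∈ I, f i = ∑ i ∈ I.erase i0, f i + f i0 := fun f =>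
      (sum_erase_add _ _ hi0).symm
    have hz : ∀ z ∈ W n, a i0 * w (ℓ i0 z) ≤ ∑ i ∈ I.erase i0, a i * w (ℓ i z) := by
      intro z hz
      have h1 : β i0 * ℓ i0 z = -∑ i ∈ I.erase i0, β i * ℓ i z := by
        have := hβ z hz
        rw [← sum_erase_add _ _ hi0] at this
        linear_combination this
      have h2 : w (β i0) * w (ℓ i0 z) ≤ ∑ i ∈ I.erase i0, w (β i) * w (ℓ i z) := by
        rw [← map_mul, h1, map_neg_eq_map]
        refine (av_sum _ _ _).trans (le_of_eq ?_)
        simp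
      have h3 : ∑ i ∈ I.erase i0, w (β i) * w (ℓ i z) ≤ (w (β i0) / a i0) * ∑ i ∈ I.erase i0, a i * w (ℓ i z) := by
        rw [Finset.mul_sum]
        refine sum_le_sum fun i hi => ?_
        have := hmax i (mem_of_mem_erase hi)
        rw [div_le_iff₀ (ha i)] at this
        rw [← mul_assoc]
        exact mul_le_mul_of_nonneg_right this (w.nonneg _)
      have h4 := h2.trans h3
      rw [div_mul_eq_mul_div, le_div_iff₀ (ha i0)] at h4
      have : w (β i0) * (a i0 * w (ℓ i0 z)) ≤ w (β i0) * ∑ i ∈ I.erase i0, a i * w (ℓ i z) := by linarith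
      exact le_of_mul_le_mul_left this hb0
    refine ⟨fun k => if k < n then π' k else i0, ?_, ?_, ?_⟩
    · intro k hk l hl h
      simp only [Finset.coe_range, Set.mem_Iio] at hk hl
      by_cases h1 : k < n <;> by_cases h2 : l < n <;> simp [h1, h2] at h
      · exact hinj (by simpa using h1) (by simpa using h2) h
      · exact absurd h (hne k h1)
      · exact absurd h.symm (hne l h2)
      · omega
    · rw [Finset.range_add_one, image_insert]
      simp only [lt_irrefl, if_false]
      have : (Finset.range n).image (fun k => if k < n then π' k else i0) = I.erase i0 := by
        rw [← him]
        exact image_congr fun k hk => by simp at hk; simp [hk]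
      rw [this, Finset.insert_erase hi0]
    · intro j hj z hzj
      rcases Nat.lt_or_ge n j with h | h
      · have : j = n + 1 := by omega
        subst this
        have himg : ∑ i ∈ I.erase i0, a i * w (ℓ i z) = ∑ k ∈ Finset.range n, a (π' k) * w (ℓ (π' k) z) := by
          rw [← him, sum_image hinj]
        rw [hsum, himg, sum_range_succ]
        simp only [lt_irrefl, if_false, Nat.sub_self, pow_zero, one_mul]
        refine le_of_eq (congrArg₂ _ (sum_congr rfl fun k hk => ?_) rfl)
        simp at hk; simp [hk]
      · rw [hsum]
        have h1 := hz z (hW h hzj)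
        have h2 := hle j h z hzj
        have h3 : ∑ k ∈ Finset.range j, a (if k < n then π' k else i0) * w (ℓ (if k < n then π' k else i0) z) = ∑ k ∈ Finset.range j, a (π' k) * w (ℓ (π' k) z) := by
          refine sum_congr rfl fun k hk => ?_
          have : k < n := lt_of_lt_of_le (mem_range.1 hk) h
          simp [this]
        rw [h3, show n + 1 - j = (n - j) + 1 by omega, pow_succ]
        linarith
end Lau
end
end
section
open Filter Finset
noncomputable section
namespace Lau
section EL
variable {T : Type} (𝒰 : Ultrafilter T) (h : T → ℝ)
def EL (a : T → ℝ) (μ : ℝ) : Prop := ∀ ε > 0, ∀ᶠ t in 𝒰, a t ≤ Real.exp ((μ + ε) * h t)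
variable {𝒰 h} {a b : T → ℝ} {μ ν : ℝ}
lemma EL.mono (ha : EL 𝒰 h a μ) (hh : Tendsto h 𝒰 atTop) (hμ : μ ≤ ν) (hb : ∀ᶠ t in 𝒰, b t ≤ a t) : EL 𝒰 h b ν := by
  intro ε hε
  filter_upwards [ha ε hε, hb, hh.eventually_ge_atTop 0] with t h1 h2 h3
  exact h2.trans (h1.trans (Real.exp_le_exp.2 (mul_le_mul_of_nonneg_right (by linarith) h3)))
lemma EL.mul (ha : EL 𝒰 h a μ) (hb : EL 𝒰 h b ν) (h0 : ∀ t, 0 ≤ b t) :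
    EL 𝒰 h (fun t => a t * b t) (μ + ν) := by
  intro ε hε
  filter_upwards [ha (ε/2) (by linarith), hb (ε/2) (by linarith)] with t h1 h2
  refine (mul_le_mul h1 h2 (h0 t) (Real.exp_pos _).le).trans ?_
  rw [← Real.exp_add]
  exact Real.exp_le_exp.2 (le_of_eq (by ring))
lemma EL.const (hh : Tendsto h 𝒰 atTop) (C : ℝ) : EL 𝒰 h (fun _ => C) 0 := by
  intro ε hε
  filter_upwards [hh.eventually_ge_atTop (|C| / ε)] with t ht
  rw [div_le_iff₀ hε] at ht
  have := Real.add_one_le_exp ((0 + ε) * h t)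
  have := le_abs_self C
  nlinarith
lemma EL.exp (hh : Tendsto h 𝒰 atTop) (μ : ℝ) : EL 𝒰 h (fun t => Real.exp (μ * h t)) μ := by
  intro ε hε
  filter_upwards [hh.eventually_ge_atTop 0] with t ht
  exact Real.exp_le_exp.2 (by nlinarith)
lemma EL.cmul (ha : EL 𝒰 h a μ) (hh : Tendsto h 𝒰 atTop) (h0 : ∀ t, 0 ≤ a t) (C : ℝ) :
    EL 𝒰 h (fun t => C * a t) μ := by
  simpa using (EL.const hh C).mul ha h0
lemma EL.prod (hh : Tendsto h 𝒰 atTop) {ι : Type*} (s : Finset ι) {f : ι → T → ℝ} {m : ι → ℝ} (h0 : ∀ i t, 0 ≤ f i t)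
    (hf : ∀ i ∈ s, EL 𝒰 h (f i) (m i)) : EL 𝒰 h (fun t => ∏ i ∈ s, f i t) (∑ i ∈ s, m i) := by
  classical
  induction s using Finset.induction_on with
  | empty => simpa using EL.const hh 1
  | insert i s hi ih =>
    simp only [prod_insert hi, sum_insert hi]
    exact (hf i (by simp)).mul (ih fun j hj => hf j (by simp [hj])) fun t => prod_nonneg fun j _ => h0 j t
lemma EL.le (ha : EL 𝒰 h a μ) (hh : Tendsto h 𝒰 atTop) (hν : ∀ᶠ t in 𝒰, Real.exp (ν * h t) ≤ a t) : ν ≤ μ := by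
  refine le_of_forall_pos_le_add fun ε hε => ?_
  obtain ⟨t, h1, h2, h3⟩ := ((ha ε hε).and (hν.and (hh.eventually_gt_atTop 0))).exists
  have := Real.exp_le_exp.1 (h2.trans h1)
  exact le_of_mul_le_mul_right this h3
lemma exists_exponent (hh : Tendsto h 𝒰 atTop) {A B M : ℝ} (hA : 0 < A) (h1 : ∀ᶠ t in 𝒰, A * Real.exp (-M * h t) ≤ a t)
    (h2 : ∀ᶠ t in 𝒰, a t ≤ B * Real.exp (M * h t)) :
    ∃ μ, EL 𝒰 h a μ ∧ ∀ ε > 0, ∀ᶠ t in 𝒰, Real.exp ((μ - ε) * h t) ≤ a t := by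
  have h2' : ∀ᶠ t in 𝒰, a t ≤ Real.exp ((M+1) * h t) := by
    have := ((EL.exp hh M).cmul hh (fun t => (Real.exp_pos _).le) B) 1 one_pos
    filter_upwards [h2, this] with t h3 h4 using h3.trans h4
  have h1' : ∀ᶠ t in 𝒰, Real.exp (-(M+1) * h t) ≤ a t := by
    have := ((EL.exp hh (-M-1)).cmul hh (fun t => (Real.exp_pos _).le) A⁻¹) 1 one_pos
    have := EL.const hh A⁻¹ 1 one_pos
    filter_upwards [h1, this] with t h3 h4
    refine le_trans ?_ h3
    rw [inv_le_comm₀ hA (Real.exp_pos _), ← Real.exp_neg] at h4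
    refine le_trans (le_of_eq ?_) (mul_le_mul_of_nonneg_right h4 (Real.exp_pos _).le)
    rw [← Real.exp_add]; congr 1; ring
  have hb : ∀ᶠ t in 𝒰, Real.log (a t) / h t ∈ Set.Icc (-(M+1)) (M+1) := by
    filter_upwards [h1', h2', hh.eventually_gt_atTop 0] with t h3 h4 h5
    have hp : 0 < a t := lt_of_lt_of_le (Real.exp_pos _) h3
    rw [← Real.le_log_iff_exp_le hp] at h3
    rw [← Real.log_le_iff_le_exp hp] at h4
    constructor
    · rwa [le_div_iff₀ h5]
    · rwa [div_le_iff₀ h5]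
  obtain ⟨μ, -, hμ⟩ := (isCompact_Icc (a := -(M+1)) (b := M+1)).ultrafilter_le_nhds (𝒰.map fun t => Real.log (a t) / h t) (by rw [le_principal_iff]; exact hb)
  have hμ : Tendsto (fun t => Real.log (a t) / h t) 𝒰 (nhds μ) := hμ
  refine ⟨μ, fun ε hε => ?_, fun ε hε => ?_⟩
  · filter_upwards [hμ.eventually (gt_mem_nhds (show μ < μ + ε by linarith)), h1', hh.eventually_gt_atTop 0] with t h3 h4 h5
    have hp : 0 < a t := lt_of_lt_of_le (Real.exp_pos _) h4
    rw [div_lt_iff₀ h5, Real.log_lt_iff_lt_exp hp] at h3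
    exact h3.le
  · filter_upwards [hμ.eventually (lt_mem_nhds (show μ - ε < μ by linarith)), h1', hh.eventually_gt_atTop 0] with t h3 h4 h5
    have hp : 0 < a t := lt_of_lt_of_le (Real.exp_pos _) h4
    rw [lt_div_iff₀ h5, Real.lt_log_iff_exp_lt hp] at h3
    exact h3.le
end EL
variable {K : Type} [Field K] {D : SD K} {n : ℕ} {T : Type} {𝒰 : Ultrafilter T} {h : T → ℝ}
def flag {n : ℕ} (b : Fin n → Fin n → K) (j : ℕ) : Submodule K (Fin n → K) :=
  Submodule.span K (b '' {i | (i : ℕ) < j})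
lemma flag_mono (b : Fin n → Fin n → K) : Monotone (flag b) := fun _ _ hij =>
  Submodule.span_mono (Set.image_mono fun _ hk => lt_of_lt_of_le hk hij)
lemma flag_rank (b : Fin n → Fin n → K) (j : ℕ) : Module.finrank K (flag b j) ≤ j := by
  classical
  unfold flag
  have : b '' {i | (i : ℕ) < j} = ((univ.filter fun i : Fin n => (i : ℕ) < j).image b : Finset _) := by ext; simp
  rw [this]
  refine (finrank_span_finset_le_card _).trans (card_image_le.trans ?_)
  have : #(univ.filter fun i : Fin n => (i : ℕ) < j) ≤ #(Finset.range j) := by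
    apply card_le_card_of_injOn (fun i : Fin n => (i : ℕ))
    · intro i hi; simpa using hi
    · exact Fin.val_injective.injOn
  simpa using this
lemma flatten [NeZero n] (L : D.GL n) (c : D.σ → Fin n → ℝ) (hh : Tendsto h 𝒰 atTop) (b : T → Fin n → Fin n → K) (τ : Fin n → ℝ)
    (hτ : Antitone τ) : ∃ c' : D.σ → Fin n → ℝ, ∑ s, ∑ i, c' s i = ∑ s, ∑ i, c s i + ∑ i, τ i ∧
    ∀ᶠ t in 𝒰, ∀ (j : Fin n), ∀ z ∈ flag (b t) (j + 1), Real.exp (τ j * h t) * D.H L c (h t) z ≤ 2 ^ n * D.H L c' (h t) z := by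
  classical
  have step : ∀ t, ∃ π : Equiv.Perm (Fin n), ∀ (j : Fin n), ∀ z ∈ flag (b t) (j+1), D.Nv L c (h t) D.s0 z ≤
      2 ^ n * ∑ k ∈ univ.filter (· ≤ j), Real.exp (c D.s0 (π k) * h t) * D.v D.s0 (L D.s0 z (π k)) := by
    intro t
    obtain ⟨π, hinj, him, hle⟩ := davenport (D.v D.s0) (fun i => (LinearMap.proj i : (Fin n → K) →ₗ[K] K) ∘ₗ (L D.s0 : (Fin n → K) →ₗ[K] (Fin n → K)))
      (fun i => Real.exp (c D.s0 i * h t)) (fun i => Real.exp_pos _) (flag (b t)) (flag_mono _) (flag_rank _) n univ (by simp)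
    have hi : Function.Injective (fun k : Fin n => π k) := fun k l hkl => Fin.ext (hinj (by simp) (by simp) hkl)
    refine ⟨Equiv.ofBijective _ (Finite.injective_iff_bijective.1 hi), fun j z hz => ?_⟩
    refine (hle (j+1) j.2 z hz).trans ?_
    have h1 : ∑ k ∈ Finset.range (j+1), Real.exp (c D.s0 (π k) * h t) * D.v D.s0 (L D.s0 z (π k)) = ∑ k ∈ univ.filter (· ≤ j), Real.exp (c D.s0 (π k) * h t) * D.v D.s0 (L D.s0 z (π k)) := by
      symm
      refine sum_bij (fun (k : Fin n) _ => (k : ℕ)) ?_ ?_ ?_ ?_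
      · intro k hk; simp at hk ⊢; omega
      · intro k _ l _ hkl; exact Fin.ext hkl
      · intro k hk; have hk' := mem_range.1 hk; exact ⟨⟨k, by omega⟩, mem_filter.2 ⟨mem_univ _, Fin.le_def.2 (Nat.lt_succ_iff.1 hk')⟩, rfl⟩
      · intros; rfl
    simp only [LinearMap.comp_apply, LinearMap.proj_apply, LinearEquiv.coe_coe]
    rw [h1]
    refine mul_le_mul_of_nonneg_right (pow_le_pow_right₀ (by norm_num) (by omega)) (sum_nonneg fun _ _ => mul_nonneg (Real.exp_pos _).le ((D.v _).nonneg _))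
  choose π hπ using step
  obtain ⟨p, hp⟩ : ∃ p, ∀ᶠ t in 𝒰, π t = p := by
    have := (Ultrafilter.eventually_exists_iff (f := 𝒰) (P := fun (p : Equiv.Perm (Fin n)) t => π t = p)).1 (Eventually.of_forall fun t => ⟨π t, rfl⟩)
    exact this
  refine ⟨fun s i => if s = D.s0 then c s i + τ (p.symm i) else c s i, ?_, ?_⟩
  · have : ∀ s, ∑ i, (if s = D.s0 then c s i + τ (p.symm i) else c s i) = ∑ i, c s i + if s = D.s0 then ∑ i, τ i else 0 := by
      intro s
      by_cases hs : s = D.s0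
      · simp [hs, sum_add_distrib, Equiv.sum_comp p.symm τ]
      · simp [hs]
    simp [this, sum_add_distrib]
  · filter_upwards [hp, hh.eventually_ge_atTop 0] with t ht h0 j z hz
    have h1 := hπ t j z hz
    rw [ht] at h1
    set c' : D.σ → Fin n → ℝ := fun s i => if s = D.s0 then c s i + τ (p.symm i) else c s i
    unfold SD.H
    rw [← Finset.mul_prod_erase _ _ (mem_univ D.s0), ← Finset.mul_prod_erase _ (fun s => D.Nv L c' (h t) s z) (mem_univ D.s0)]
    have h2 : ∏ s ∈ univ.erase D.s0, D.Nv L c' (h t) s z = ∏ s ∈ univ.erase D.s0, D.Nv L c (h t) s z := by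
      refine prod_congr rfl fun s hs => ?_
      simp [SD.Nv, c', Finset.ne_of_mem_erase hs]
    rw [h2, ← mul_assoc, ← mul_assoc]
    refine mul_le_mul_of_nonneg_right ?_ (prod_nonneg fun s _ => Nv_nonneg s z)
    have h3 : Real.exp (τ j * h t) * ∑ k ∈ univ.filter (· ≤ j), Real.exp (c D.s0 (p k) * h t) * D.v D.s0 (L D.s0 z (p k)) ≤ D.Nv L c' (h t) D.s0 z := by
      unfold SD.Nv
      rw [← Equiv.sum_comp p, Finset.mul_sum]
      refine le_trans (sum_le_sum (g := fun k => Real.exp (c' D.s0 (p k) * h t) * D.v D.s0 (L D.s0 z (p k))) fun k hk => ?_) (sum_le_sum_of_subset_of_nonneg (filter_subset _ _) fun _ _ _ => mul_nonneg (Real.exp_pos _).le ((D.v _).nonneg _))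
      rw [← mul_assoc, ← Real.exp_add]
      refine mul_le_mul_of_nonneg_right (Real.exp_le_exp.2 ?_) ((D.v _).nonneg _)
      have := hτ (mem_filter.1 hk).2
      simp only [c', if_true, Equiv.symm_apply_apply]
      nlinarith
    calc _ ≤ Real.exp (τ j * h t) * (2 ^ n * _) := mul_le_mul_of_nonneg_left h1 (Real.exp_pos _).le
      _ = 2 ^ n * (Real.exp (τ j * h t) * _) := by ring
      _ ≤ _ := mul_le_mul_of_nonneg_left h3 (by positivity)
end Lau
end
end
section
open Filter Finset
noncomputable section
namespace Lau
variable {K : Type} [Field K] {D : SD K} {n : ℕ} {T : Type} {𝒰 : Ultrafilter T} {h : T → ℝ}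
def SD.Int (D : SD K) {n : ℕ} (z : Fin n → K) : Prop := ∀ i, z i ∈ D.R
lemma bound_coord (L : D.GL n) (c : D.σ → Fin n → ℝ) : ∃ C > 0, ∃ M ≥ 0, ∀ x ≥ 0, ∀ s z i,
    D.v s (z i) ≤ C * Real.exp (M * x) * D.Nv L c x s z := by
  classical
  set B : ℝ := 1 + ∑ s, ∑ i, ∑ k, D.v s ((L s).symm (Pi.single k 1) i) with hB
  set M : ℝ := ∑ s, ∑ i, |c s i| with hM
  have hBnn : ∀ s i k, 0 ≤ D.v s ((L s).symm (Pi.single k 1) i) := fun s i k => (D.v s).nonneg _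
  have hB1 : 1 ≤ B := by
    have : 0 ≤ ∑ s, ∑ i, ∑ k, D.v s ((L s).symm (Pi.single k 1) i) := sum_nonneg fun s _ => sum_nonneg fun i _ => sum_nonneg fun k _ => hBnn s i k
    linarith
  refine ⟨B, by linarith, M, sum_nonneg fun _ _ => sum_nonneg fun _ _ => abs_nonneg _, fun x hx s z i => ?_⟩
  have h1 : z i = ∑ k, L s z k * (L s).symm (Pi.single k 1) i := by
    have : z = (L s).symm (∑ k, L s z k • Pi.single k (1:K)) := by
      rw [LinearEquiv.eq_symm_apply]
      ext j; simp [Finset.sum_apply, Pi.single_apply]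
    conv_lhs => rw [this]
    simp [map_sum, Finset.sum_apply]
  rw [h1, SD.Nv, Finset.mul_sum]
  refine (av_sum _ _ _).trans (sum_le_sum fun k _ => ?_)
  rw [map_mul]
  have e1 : D.v s ((L s).symm (Pi.single k 1) i) ≤ B := by
    have a1 := single_le_sum (f := fun k => D.v s ((L s).symm (Pi.single k 1) i)) (fun k _ => hBnn s i k) (mem_univ k)
    have a2 := single_le_sum (f := fun i => ∑ k, D.v s ((L s).symm (Pi.single k 1) i)) (fun i _ => sum_nonneg fun k _ => hBnn s i k) (mem_univ i)
    have a3 := single_le_sum (f := fun s => ∑ i, ∑ k, D.v s ((L s).symm (Pi.single k 1) i)) (fun s _ => sum_nonneg fun i _ => sum_nonneg fun k _ => hBnn s i k) (mem_univ s)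
    linarith
  have e2 : 1 ≤ Real.exp (M * x) * Real.exp (c s k * x) := by
    rw [← Real.exp_add, Real.one_le_exp_iff]
    have a1 := single_le_sum (f := fun i => |c s i|) (fun k _ => abs_nonneg _) (mem_univ k)
    have a2 := single_le_sum (f := fun s => ∑ i, |c s i|) (fun i _ => sum_nonneg fun k _ => abs_nonneg _) (mem_univ s)
    have := neg_abs_le (c s k)
    nlinarith
  calc D.v s (L s z k) * D.v s ((L s).symm (Pi.single k 1) i) ≤ D.v s (L s z k) * B := mul_le_mul_of_nonneg_left e1 ((D.v s).nonneg _)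
    _ ≤ (D.v s (L s z k) * B) * (Real.exp (M * x) * Real.exp (c s k * x)) := le_mul_of_one_le_right (mul_nonneg ((D.v s).nonneg _) (by linarith)) e2
    _ = _ := by ring
lemma lowB (L : D.GL n) (c : D.σ → Fin n → ℝ) : ∃ A > 0, ∃ M, ∀ x ≥ 0, ∀ z : Fin n → K, D.Int z → z ≠ 0 →
    A * Real.exp (-M * x) ≤ D.H L c x z := by
  obtain ⟨C, hC, M, hM, hb⟩ := bound_coord L c
  set q := Fintype.card D.σ
  refine ⟨(C ^ q)⁻¹, by positivity, q * M, fun x hx z hz hz0 => ?_⟩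
  obtain ⟨i, hi⟩ := Function.ne_iff.1 hz0
  have h1 := D.prod_ge _ (hz i) hi
  have h2 : ∏ s, D.v s (z i) ≤ ∏ s, (C * Real.exp (M * x) * D.Nv L c x s z) :=
    prod_le_prod (fun s _ => (D.v s).nonneg _) fun s _ => hb x hx s z i
  rw [prod_mul_distrib, prod_const, card_univ, mul_pow, ← Real.exp_nat_mul] at h2
  have h3 := h1.trans h2
  change 1 ≤ C ^ q * Real.exp (q * (M * x)) * D.H L c x z at h3
  rw [show -(q * M) * x = -(q * (M * x)) by ring, Real.exp_neg, ← mul_inv, inv_le_iff_one_le_mul₀ (by positivity)]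
  linarith
lemma upB (L : D.GL n) (c : D.σ → Fin n → ℝ) (z : Fin n → K) : ∃ B, ∃ M, ∀ x ≥ 0, D.H L c x z ≤ B * Real.exp (M * x) := by
  set M : ℝ := ∑ s, ∑ i, |c s i| with hM
  refine ⟨∏ s, ∑ i, D.v s (L s z i), ∑ s : D.σ, M, fun x hx => ?_⟩
  rw [sum_mul, Real.exp_sum, ← prod_mul_distrib]
  refine prod_le_prod (fun s _ => Nv_nonneg s z) fun s _ => ?_
  rw [SD.Nv, sum_mul]
  refine sum_le_sum fun i _ => ?_
  rw [mul_comm]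
  refine mul_le_mul_of_nonneg_left (Real.exp_le_exp.2 (mul_le_mul_of_nonneg_right ?_ hx)) ((D.v s).nonneg _)
  have a1 := single_le_sum (f := fun i => |c s i|) (fun k _ => abs_nonneg _) (mem_univ i)
  have a2 := single_le_sum (f := fun s => ∑ i, |c s i|) (fun i _ => sum_nonneg fun k _ => abs_nonneg _) (mem_univ s)
  have := le_abs_self (c s i)
  linarith
lemma flag_ne_top (b : Fin n → Fin n → K) {j : ℕ} (hj : j < n) : ∃ i, (Pi.single i 1 : Fin n → K) ∉ flag b j := by
  by_contra! hcon
  have h1 : (⊤ : Submodule K (Fin n → K)) ≤ flag b j := by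
    rw [← (Pi.basisFun K (Fin n)).span_eq, Submodule.span_le]
    rintro _ ⟨i, rfl⟩
    simpa using hcon i
  have h2 := Submodule.finrank_mono h1
  have := flag_rank b j
  simp at h2; omega
lemma flag_eq_of {b b' : Fin n → Fin n → K} {j : ℕ} (hbb : ∀ i : Fin n, (i:ℕ) < j → b i = b' i) : flag b j = flag b' j := by
  unfold flag
  congr 1
  exact Set.image_congr fun i hi => hbb i hi
lemma near_minima (L : D.GL n) (c : D.σ → Fin n → ℝ) {x : ℝ} (hx : 0 ≤ x) : ∃ b : Fin n → Fin n → K,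
    ∀ j : Fin n, D.Int (b j) ∧ b j ∉ flag b j ∧ ∀ z, D.Int z → z ∉ flag b j → D.H L c x (b j) ≤ 2 * D.H L c x z := by
  classical
  obtain ⟨A, hA, M, hAM⟩ := lowB L c
  have pick : ∀ (V : Submodule K (Fin n → K)), (∃ z, D.Int z ∧ z ∉ V) → ∃ z, D.Int z ∧ z ∉ V ∧ ∀ z', D.Int z' → z' ∉ V → D.H L c x z ≤ 2 * D.H L c x z' := by
    rintro V ⟨z0, hz0⟩
    set S := (D.H L c x) '' {z | D.Int z ∧ z ∉ V}
    have hS : ∀ y ∈ S, A * Real.exp (-M * x) ≤ y := by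
      rintro _ ⟨z, ⟨hz, hzV⟩, rfl⟩
      exact hAM x hx z hz (fun h => hzV (h ▸ V.zero_mem))
    have hne : S.Nonempty := ⟨_, z0, hz0, rfl⟩
    have hinf : 0 < sInf S := lt_of_lt_of_le (by positivity) (le_csInf hne hS)
    obtain ⟨_, ⟨z, hz, rfl⟩, hlt⟩ := exists_lt_of_csInf_lt hne (show sInf S < 2 * sInf S by linarith)
    refine ⟨z, hz.1, hz.2, fun z' h1 h2 => hlt.le.trans ?_⟩
    have := csInf_le ⟨_, hS⟩ (show D.H L c x z' ∈ S from ⟨z', ⟨h1, h2⟩, rfl⟩)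
    linarith
  have main : ∀ k ≤ n, ∃ b : Fin n → Fin n → K,
    ∀ j : Fin n, (j : ℕ) < k → D.Int (b j) ∧ b j ∉ flag b j ∧ ∀ z, D.Int z → z ∉ flag b j → D.H L c x (b j) ≤ 2 * D.H L c x z := by
    intro k
    induction k with
    | zero => intro _; exact ⟨0, by simp⟩
    | succ k ih =>
      intro hk
      obtain ⟨b, hb⟩ := ih (by omega)
      obtain ⟨i, hi⟩ := flag_ne_top b (j := k) (by omega)
      obtain ⟨z, hz⟩ := pick (flag b k) ⟨_, fun l => by by_cases h : l = i <;> simp [h, D.R.one_mem, D.R.zero_mem], hi⟩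
      refine ⟨Function.update b ⟨k, by omega⟩ z, fun j hj => ?_⟩
      have hf : flag (Function.update b ⟨k, by omega⟩ z) j = flag b j := by
        refine flag_eq_of fun i hi => ?_
        rw [Function.update_of_ne]
        intro h; have := congrArg Fin.val h; simp at this; omega
      rw [hf]
      rcases Nat.lt_succ_iff_lt_or_eq.1 hj with h | h
      · rw [Function.update_of_ne (by intro h'; have := congrArg Fin.val h'; simp at this; omega)]
        exact hb j h
      · have : j = ⟨k, by omega⟩ := Fin.ext h
        rw [this]
        simpa using hz
  obtain ⟨b, hb⟩ := main n le_rfl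
  exact ⟨b, fun j => hb j j.2⟩
lemma linInd_of_flag {b : Fin n → Fin n → K} (hb : ∀ j : Fin n, b j ∉ flag b j) : LinearIndependent K b := by
  classical
  rw [Fintype.linearIndependent_iff]
  intro g hg
  by_contra! hcon
  obtain ⟨i, hi⟩ := hcon
  have hne : (univ.filter fun i => g i ≠ 0).Nonempty := ⟨i, by simpa using hi⟩
  set m := (univ.filter fun i => g i ≠ 0).max' hne
  have hm : g m ≠ 0 := by simpa using Finset.max'_mem _ hne
  have hgt : ∀ k, m < k → g k = 0 := by
    intro k hk
    by_contra h0
    exact absurd (le_max' (univ.filter fun i => g i ≠ 0) k (by simpa using h0)) (not_le.2 hk)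
  apply hb m
  have : b m = ∑ k ∈ univ.erase m, (-(g m)⁻¹ * g k) • b k := by
    rw [← Finset.add_sum_erase _ _ (mem_univ m)] at hg
    have h2 : ∑ k ∈ univ.erase m, (-(g m)⁻¹ * g k) • b k = -(g m)⁻¹ • ∑ k ∈ univ.erase m, g k • b k := by
      rw [Finset.smul_sum]; simp_rw [smul_smul]
    rw [h2, eq_neg_of_add_eq_zero_right hg, neg_smul_neg, smul_smul, inv_mul_cancel₀ hm, one_smul]
  rw [this]
  refine Submodule.sum_mem _ fun k hk => ?_
  rcases lt_or_ge m k with h | h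
  · simp [hgt k h]
  · exact Submodule.smul_mem _ _ (Submodule.subset_span ⟨k, lt_of_le_of_ne h (Finset.ne_of_mem_erase hk), rfl⟩)
lemma flag_n {b : Fin n → Fin n → K} (hb : LinearIndependent K b) : flag b n = ⊤ := by
  unfold flag
  have : {i : Fin n | (i:ℕ) < n} = Set.univ := by ext; simp
  rw [this, Set.image_univ]
  exact hb.span_eq_top_of_card_eq_finrank' (by simp)
structure Tight (𝒰 : Ultrafilter T) (h : T → ℝ) (L : D.GL n) (c : D.σ → Fin n → ℝ) (b : T → Fin n → Fin n → K) (μ : Fin n → ℝ) : Prop where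
  int : ∀ᶠ t in 𝒰, ∀ j, D.Int (b t j)
  ind : ∀ᶠ t in 𝒰, LinearIndependent K (b t)
  el : ∀ j, EL 𝒰 h (fun t => D.H L c (h t) (b t j)) (μ j)
  sum : ∑ j, μ j = ∑ s, ∑ i, c s i
lemma exists_flag_step {b : Fin n → Fin n → K} {z : Fin n → K} (hz : z ∈ flag b n) (hz0 : z ≠ 0) :
    ∃ j : Fin n, z ∈ flag b (j + 1) ∧ z ∉ flag b j := by
  classical
  have hex : ∃ k, z ∈ flag b k := ⟨n, hz⟩
  have h0 : Nat.find hex ≠ 0 := by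
    intro h0
    have := Nat.find_spec hex
    rw [h0] at this
    simp [flag] at this
    exact hz0 this
  have hle := Nat.find_min' hex hz
  refine ⟨⟨Nat.find hex - 1, by omega⟩, ?_, Nat.find_min hex (Nat.sub_lt (Nat.pos_of_ne_zero h0) one_pos)⟩
  have := Nat.find_spec hex
  simpa [Nat.sub_add_cancel (Nat.one_le_iff_ne_zero.2 h0)] using this
theorem exists_tight (hn : 0 < n) (L : D.GL n) (c : D.σ → Fin n → ℝ) (hh : Tendsto h 𝒰 atTop) :
    ∃ b μ, Monotone μ ∧ Tight 𝒰 h L c b μ := by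
  have : NeZero n := ⟨hn.ne'⟩
  have h0 : ∀ᶠ t in 𝒰, 0 ≤ h t := hh.eventually_ge_atTop 0
  have ex : ∀ t, ∃ b : Fin n → Fin n → K, 0 ≤ h t → 
    ∀ j : Fin n, D.Int (b j) ∧ b j ∉ flag b j ∧ ∀ z, D.Int z → z ∉ flag b j → D.H L c (h t) (b j) ≤ 2 * D.H L c (h t) z := by
    intro t
    by_cases ht : 0 ≤ h t
    · obtain ⟨b, hb⟩ := near_minima L c ht
      exact ⟨b, fun _ => hb⟩
    · exact ⟨0, fun h => absurd h ht⟩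
  choose b hb using ex
  obtain ⟨A, hA, M, hAM⟩ := lowB L c
  have hup : ∃ B M', ∀ x ≥ 0, ∀ i, D.H L c x (Pi.single i 1) ≤ B * Real.exp (M' * x) := by
    choose B M' hBM using fun i : Fin n => upB L c (Pi.single i 1)
    refine ⟨∑ i, |B i|, ∑ i, |M' i|, fun x hx i => (hBM i x hx).trans ?_⟩
    have a1 := single_le_sum (f := fun i => |B i|) (fun k _ => abs_nonneg _) (mem_univ i)
    have a2 := single_le_sum (f := fun i => |M' i|) (fun k _ => abs_nonneg _) (mem_univ i)
    refine mul_le_mul ((le_abs_self _).trans a1) (Real.exp_le_exp.2 (mul_le_mul_of_nonneg_right ((le_abs_self _).trans a2) hx)) (Real.exp_pos _).le ((abs_nonneg _).trans a1)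
  obtain ⟨B, M', hBM⟩ := hup
  have hne : ∀ t, 0 ≤ h t → ∀ j, b t j ≠ 0 := fun t ht j h0 => (hb t ht j).2.1 (h0 ▸ Submodule.zero_mem _)
  have hexp : ∀ j, ∃ μ, EL 𝒰 h (fun t => D.H L c (h t) (b t j)) μ ∧ ∀ ε > 0, ∀ᶠ t in 𝒰, Real.exp ((μ - ε) * h t) ≤ D.H L c (h t) (b t j) := by
    intro j
    refine exists_exponent hh hA (M := max M M') (B := 2 * |B|) ?_ ?_
    · filter_upwards [h0] with t ht
      refine le_trans (mul_le_mul_of_nonneg_left (Real.exp_le_exp.2 (mul_le_mul_of_nonneg_right (neg_le_neg (le_max_left _ _)) ht)) hA.le) (hAM (h t) ht _ (hb t ht j).1 (hne t ht j))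
    · filter_upwards [h0] with t ht
      obtain ⟨i, hi⟩ := flag_ne_top (b t) j.2
      have h1 := (hb t ht j).2.2 _ (fun l => by by_cases h : l = i <;> simp [h, D.R.one_mem, D.R.zero_mem]) hi
      have h2 := hBM (h t) ht i
      have h3 : B * Real.exp (M' * h t) ≤ |B| * Real.exp (max M M' * h t) :=
        mul_le_mul (le_abs_self _) (Real.exp_le_exp.2 (mul_le_mul_of_nonneg_right (le_max_right _ _) ht)) (Real.exp_pos _).le (abs_nonneg _)
      linarith
  choose μ hμ1 hμ2 using hexp
  have hmono : Monotone μ := by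
    intro i j hij
    refine le_of_forall_pos_le_add fun ε hε => ?_
    have : μ i - ε ≤ μ j := by
      refine ((hμ1 j).cmul hh (fun t => H_nonneg _) 2).le hh ?_
      filter_upwards [hμ2 i ε hε, h0] with t h1 ht
      exact h1.trans ((hb t ht i).2.2 _ (hb t ht j).1 fun hmem => (hb t ht j).2.1 (flag_mono _ hij hmem))
    linarith
  have hint : ∀ᶠ t in 𝒰, ∀ j, D.Int (b t j) := by
    filter_upwards [h0] with t ht j using (hb t ht j).1
  have hind : ∀ᶠ t in 𝒰, LinearIndependent K (b t) := by
    filter_upwards [h0] with t ht using linInd_of_flag fun j => (hb t ht j).2.1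
  refine ⟨b, μ, hmono, hint, hind, hμ1, le_antisymm ?_ ?_⟩
  · obtain ⟨c', hc', hfl⟩ := flatten L c hh b (fun j => -μ j) (fun i j hij => neg_le_neg (hmono hij))
    obtain ⟨C, hC⟩ := D.fm n hn L
    set S := ∑ s, ∑ i, c' s i with hS
    have : 0 ≤ S / n := by
      refine le_of_forall_pos_le_add fun ε hε => ?_
      have : -ε ≤ S / n := by
        refine ((EL.exp hh (S / n)).cmul hh (fun t => (Real.exp_pos _).le) (2 ^ n * 2 * C)).le hh ?_
        have hall : ∀ᶠ t in 𝒰, ∀ j, Real.exp ((μ j - ε) * h t) ≤ D.H L c (h t) (b t j) := eventually_all.2 fun j => hμ2 j ε hε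
        filter_upwards [hfl, hall, h0, hind] with t h1 h2 ht h3
        obtain ⟨z, hz0, hz, hle⟩ := hC (fun s i => c' s i * h t)
        have hle : D.H L c' (h t) z ≤ C * Real.exp (S / n * h t) := by
          refine hle.trans (le_of_eq ?_)
          rw [hS]; simp_rw [← sum_mul]; ring_nf
        obtain ⟨j, hj1, hj2⟩ := exists_flag_step (b := b t) (by rw [flag_n h3]; trivial) hz0
        have h4 := h1 j z hj1
        have h5 := (hb t ht j).2.2 z hz hj2
        have h6 := h2 j
        have h7 : Real.exp (-ε * h t) = Real.exp (-μ j * h t) * Real.exp ((μ j - ε) * h t) := by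
          rw [← Real.exp_add]; ring_nf
        have h8 : Real.exp (-μ j * h t) * Real.exp ((μ j - ε) * h t) ≤ Real.exp (-μ j * h t) * (2 * D.H L c (h t) z) :=
          mul_le_mul_of_nonneg_left (h6.trans h5) (Real.exp_pos _).le
        have h9 : 2 ^ n * D.H L c' (h t) z ≤ 2 ^ n * (C * Real.exp (S / n * h t)) := mul_le_mul_of_nonneg_left hle (by positivity)
        rw [h7]
        nlinarith
      linarith
    have hn' : (0:ℝ) < n := by exact_mod_cast hn
    have := (le_div_iff₀ hn').1 this
    simp at hc'
    linarith
  · obtain ⟨C, hC, hHad⟩ := hadamard L c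
    refine ((EL.prod hh univ (fun j t => H_nonneg (b t j)) fun j _ => hμ1 j).cmul hh (fun t => prod_nonneg fun j _ => H_nonneg _) C).le hh ?_
    filter_upwards [hint, hind] with t h1 h2 using hHad _ _ h2 h1
lemma Tight.low {L : D.GL n} {c : D.σ → Fin n → ℝ} {b : T → Fin n → Fin n → K} {μ : Fin n → ℝ} (ht : Tight 𝒰 h L c b μ)
    (hh : Tendsto h 𝒰 atTop) (z : T → Fin n → K) (hz : ∀ᶠ t in 𝒰, D.Int (z t)) (j : Fin n)
    (hj : ∀ᶠ t in 𝒰, z t ∉ Submodule.span K (b t '' {i | i ≠ j})) {ν : ℝ} (hν : EL 𝒰 h (fun t => D.H L c (h t) (z t)) ν) : μ j ≤ ν := by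
  classical
  obtain ⟨C, hC, hHad⟩ := hadamard L c
  have h1 := ((EL.prod hh univ (f := fun i t => D.H L c (h t) (Function.update (b t) j (z t) i)) (m := Function.update μ j ν) (fun j t => H_nonneg _) (by
    intro i _
    by_cases hij : i = j
    · subst hij; simpa using hν
    · simpa [hij] using ht.el i)).cmul hh (fun t => prod_nonneg fun j _ => H_nonneg _) C).le hh (ν := ∑ s, ∑ i, c s i) (by
      filter_upwards [ht.int, ht.ind, hz, hj] with t h1 h2 h3 h4
      refine hHad _ _ ?_ ?_
      · have hu : insert j {i : Fin n | i ≠ j} = Set.univ := by ext i; simp [em]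
        rw [← linearIndepOn_univ_iff, ← hu, linearIndepOn_insert (by simp)]
        have hc : Set.EqOn (Function.update (b t) j (z t)) (b t) {i | i ≠ j} := fun i hi => Function.update_of_ne hi _ _
        rw [Set.image_congr hc, Function.update_self, linearIndepOn_congr hc]
        exact ⟨(linearIndepOn_univ_iff.2 h2).mono (Set.subset_univ _), h4⟩
      · intro i
        by_cases hij : i = j
        · subst hij; simpa using (show ∀ i, z t i ∈ D.R from h3)
        · simpa [hij] using (show ∀ k, b t i k ∈ D.R from h1 i))
  rw [← ht.sum, sum_update_of_mem (mem_univ j), ← Finset.add_sum_erase _ _ (mem_univ j), Finset.sdiff_singleton_eq_erase] at h1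
  linarith
end Lau
end
end
section
open Filter Finset
noncomputable section
namespace Lau
open Polynomial in
lemma W1 {K : Type} [Field K] [CharZero K] {r : ℕ} (g : Fin r → K[X]) (hg : LinearIndependent K g) :
    (Matrix.of fun (i b : Fin r) => derivative^[(i:ℕ)] (g b)).det ≠ 0 := by
  classical
  intro hdet
  obtain ⟨p, hp0, hp⟩ := Matrix.exists_vecMul_eq_zero_iff.2 hdet
  have hne : (univ.filter fun i => p i ≠ 0).Nonempty := by
    obtain ⟨i, hi⟩ := Function.ne_iff.1 hp0
    exact ⟨i, by simpa using hi⟩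
  set s := (univ.filter fun i => p i ≠ 0).max' hne
  have hs : p s ≠ 0 := by simpa using Finset.max'_mem _ hne
  have hgt : ∀ k, s < k → p k = 0 := by
    intro k hk
    by_contra h0
    exact absurd (le_max' (univ.filter fun i => p i ≠ 0) k (by simpa using h0)) (not_le.2 hk)
  obtain ⟨x0, hx0⟩ : ∃ x, (p s).eval x ≠ 0 := by
    by_contra! h
    exact hs (Polynomial.funext (by simpa using h))
  let f : (Fin r → K) →ₗ[K] (Fin s → K) := LinearMap.pi fun i => (Polynomial.leval x0) ∘ₗ ((Polynomial.derivative (R := K)) ^ (i:ℕ)) ∘ₗ (Fintype.linearCombination K g)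
  have hker : LinearMap.ker f ≠ ⊥ := LinearMap.ker_ne_bot_of_finrank_lt (by simp)
  obtain ⟨a, ha, ha0⟩ := Submodule.exists_mem_ne_zero_of_ne_bot hker
  set G := Fintype.linearCombination K g a with hG
  have hG0 : G ≠ 0 := by
    intro h
    exact ha0 (funext (Fintype.linearIndependent_iff.1 hg a (by simpa [hG, Fintype.linearCombination_apply] using h)))
  have hGi : ∀ i < (s:ℕ), (derivative^[i] G).eval x0 = 0 := by
    intro i hi
    have := congrFun (LinearMap.mem_ker.1 ha) ⟨i, hi⟩
    simpa [f, Module.End.pow_apply] using this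
  have hPG : ∑ i, p i * derivative^[(i:ℕ)] G = 0 := by
    have h1 : ∀ i : ℕ, derivative^[i] G = ∑ b, a b • derivative^[i] (g b) := by
      intro i
      rw [hG, Fintype.linearCombination_apply, ← Module.End.pow_apply, map_sum]
      simp [Module.End.pow_apply]
    simp_rw [h1, Finset.mul_sum]
    rw [sum_comm]
    refine sum_eq_zero fun b _ => ?_
    have := congrFun hp b
    simp only [Matrix.vecMul, dotProduct, Matrix.of_apply, Pi.zero_apply] at this
    simp_rw [mul_smul_comm, ← Finset.smul_sum, this, smul_zero]
  set e := rootMultiplicity x0 G with he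
  have hse : (s:ℕ) ≤ e := by
    rcases Nat.eq_zero_or_pos (s:ℕ) with h | h
    · omega
    · have := (lt_rootMultiplicity_iff_isRoot_iterate_derivative (n := (s:ℕ)-1) (t := x0) hG0).2 (fun m hm => hGi m (by omega))
      omega
  have hdvd : (X - C x0) ^ (e - s + 1) ∣ derivative^[(s:ℕ)] G := by
    have h1 : (X - C x0) ^ (e - s + 1) ∣ p s * derivative^[(s:ℕ)] G := by
      rw [← Finset.add_sum_erase _ _ (mem_univ s)] at hPG
      rw [eq_neg_of_add_eq_zero_left hPG, dvd_neg]
      refine Finset.dvd_sum fun i hi => ?_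
      rcases lt_or_ge s i with h | h
      · simp [hgt i h]
      · have hlt : i < s := lt_of_le_of_ne h (Finset.ne_of_mem_erase hi)
        refine Dvd.dvd.mul_left ?_ _
        refine (pow_dvd_pow _ ?_).trans (pow_sub_dvd_iterate_derivative_of_pow_dvd (i:ℕ) (pow_rootMultiplicity_dvd G x0))
        have : (i:ℕ) < s := hlt
        omega
    refine (IsCoprime.pow_left ?_).dvd_of_dvd_mul_left h1
    rw [Polynomial.irreducible_X_sub_C x0 |>.coprime_iff_not_dvd, dvd_iff_isRoot]
    exact hx0
  have : e < rootMultiplicity x0 G := by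
    rw [lt_rootMultiplicity_iff_isRoot_iterate_derivative hG0]
    intro m hm
    rcases Nat.lt_or_ge m s with h | h
    · exact hGi m h
    · have h2 := pow_sub_dvd_iterate_derivative_of_pow_dvd (m - s) hdvd
      rw [← Function.iterate_add_apply, Nat.sub_add_cancel h] at h2
      rw [← dvd_iff_isRoot]
      refine dvd_trans ?_ h2
      exact dvd_pow_self _ (by omega)
  omega
end Lau
end
end
section
open Filter Finset
noncomputable section
namespace Lau
open MvPolynomial
variable {K : Type} [Field K] {m : ℕ}
def HJ (J : Fin m →₀ ℕ) : MvPolynomial (Fin m) K →ₗ[K] MvPolynomial (Fin m) K :=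
  (basisMonomials (Fin m) K).constr K fun α => monomial (α - J) (∏ k, ((α k).choose (J k) : K))
lemma HJ_monomial (J α : Fin m →₀ ℕ) (c : K) : HJ J (monomial α c) = monomial (α - J) (c * ∏ k, ((α k).choose (J k) : K)) := by
  have : monomial α c = c • basisMonomials (Fin m) K α := by simp [smul_monomial]
  rw [this, map_smul, HJ, Module.Basis.constr_basis, smul_monomial, smul_eq_mul]
lemma HJ_coeff (J α : Fin m →₀ ℕ) (f : MvPolynomial (Fin m) K) :
    (HJ J f).coeff α = f.coeff (α + J) * ∏ k, ((α k + J k).choose (J k) : K) := by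
  classical
  induction f using MvPolynomial.induction_on' with
  | monomial β c =>
    rw [HJ_monomial, coeff_monomial, coeff_monomial]
    by_cases h : J ≤ β
    · by_cases h2 : β = α + J
      · subst h2; simp
      · rw [if_neg, if_neg h2, zero_mul]
        intro h3; exact h2 (by rw [← h3, tsub_add_cancel_of_le h])
    · have h2 : β ≠ α + J := fun h2 => h (h2 ▸ le_add_self)
      rw [if_neg h2, zero_mul]
      obtain ⟨k, hk⟩ : ∃ k, β k < J k := by simpa [Finsupp.le_def] using h
      rw [prod_eq_zero (mem_univ k) (by rw [Nat.choose_eq_zero_of_lt hk, Nat.cast_zero]), mul_zero, ite_self]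
  | add p q hp hq => rw [map_add, coeff_add, hp, hq, coeff_add, add_mul]
lemma HJ_zero (f : MvPolynomial (Fin m) K) : HJ 0 f = f := by
  ext α; simp [HJ_coeff]
lemma pderiv_HJ (k : Fin m) (J : Fin m →₀ ℕ) (f : MvPolynomial (Fin m) K) :
    pderiv k (HJ J f) = ((J k + 1 : ℕ) : K) • HJ (J + Finsupp.single k 1) f := by
  set ε : Fin m →₀ ℕ := Finsupp.single k 1 with hε
  ext α
  rw [coeff_pderiv, ← hε, HJ_coeff, coeff_smul, HJ_coeff, smul_eq_mul, show α + ε + J = α + (J + ε) by abel]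
  rw [← Finset.mul_prod_erase _ _ (mem_univ k), ← Finset.mul_prod_erase (univ) (fun i : Fin m => (((α i + (J + ε) i).choose ((J + ε) i) : ℕ) : K)) (mem_univ k)]
  have h1 : ∏ i ∈ univ.erase k, (((α + ε) i + J i).choose (J i) : K) = ∏ i ∈ univ.erase k, ((α i + (J + ε) i).choose ((J + ε) i) : K) := by
    refine prod_congr rfl fun i hi => ?_
    have : ε i = 0 := Finsupp.single_eq_of_ne (Finset.ne_of_mem_erase hi)
    simp [this]
  rw [h1]
  have h2 : ((α k + 1 + J k).choose (J k) : K) * (α k + 1) = (J k + 1 : ℕ) * ((α k + (J k + 1)).choose (J k + 1) : K) := by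
    have := Nat.choose_succ_right_eq (α k + J k + 1) (J k)
    rw [show α k + J k + 1 - J k = α k + 1 by omega] at this
    have := congrArg (Nat.cast : ℕ → K) this
    push_cast at this ⊢
    rw [show α k + 1 + J k = α k + J k + 1 by ring, show α k + (J k + 1) = α k + J k + 1 by ring]
    linear_combination -this
  have h3 : ε k = 1 := Finsupp.single_eq_same
  generalize ∏ i ∈ univ.erase k, ((α i + (J + ε) i).choose ((J + ε) i) : K) = P
  simp only [Finsupp.add_apply, h3]
  linear_combination (coeff (α + (J + ε)) f * P) * h2
def kron (N : ℕ) : MvPolynomial (Fin m) K →ₐ[K] Polynomial K := aeval fun k => Polynomial.X ^ (N ^ (k:ℕ))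
lemma kron_inj {N : ℕ} (f : MvPolynomial (Fin m) K) (hf : ∀ k, degreeOf k f < N) (h0 : kron N f = 0) : f = 0 := by
  classical
  by_contra hne
  obtain ⟨α, hα⟩ := (MvPolynomial.support_nonempty).2 hne
  set w : (Fin m →₀ ℕ) → ℕ := fun β => ∑ k, β k * N ^ (k:ℕ)
  have hw : ∀ β ∈ f.support, w β = w α → β = α := by
    intro β hβ hwe
    have hb : ∀ γ ∈ f.support, ∀ k, γ k < N := fun γ hγ k => lt_of_le_of_lt (monomial_le_degreeOf k hγ) (hf k)
    have := finFunctionFinEquiv.injective (a₁ := fun k => (⟨β k, hb β hβ k⟩ : Fin N)) (a₂ := fun k => ⟨α k, hb α hα k⟩) (by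
      ext; simpa [finFunctionFinEquiv_apply] using hwe)
    ext k
    simpa using congrArg Fin.val (congrFun this k)
  have h1 : kron N f = ∑ β ∈ f.support, Polynomial.monomial (w β) (f.coeff β) := by
    rw [kron, aeval_def, eval₂_eq']
    refine sum_congr rfl fun β _ => ?_
    rw [← Polynomial.C_mul_X_pow_eq_monomial]
    congr 1
    rw [← prod_pow_eq_pow_sum]
    exact prod_congr rfl fun k _ => by rw [← pow_mul, mul_comm]
  have h2 := congrArg (fun p => Polynomial.coeff p (w α)) h1
  simp only [h0, Polynomial.finsetSum_coeff, Polynomial.coeff_monomial, Polynomial.coeff_zero] at h2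
  rw [sum_eq_single α (fun β hβ hne => if_neg fun h => hne (hw β hβ h)) (fun h => absurd hα h), if_pos rfl] at h2
  exact (mem_support_iff.1 hα) h2.symm
lemma kron_deriv (N : ℕ) (f : MvPolynomial (Fin m) K) : Polynomial.derivative (kron N f) =
    ∑ k : Fin m, Polynomial.derivative (Polynomial.X ^ (N ^ (k:ℕ)) : Polynomial K) * kron N (pderiv k f) := by
  classical
  induction f using MvPolynomial.induction_on with
  | C a => simp [kron]
  | add p q hp hq => simp only [map_add, hp, hq, mul_add, sum_add_distrib]
  | mul_X p i hp =>
    have hX : ∀ i, kron N (X i : MvPolynomial (Fin m) K) = Polynomial.X ^ (N ^ (i:ℕ)) := fun i => by simp [kron]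
    have : ∀ k : Fin m, Polynomial.derivative (Polynomial.X ^ (N ^ (k:ℕ)) : Polynomial K) * kron N (pderiv k (p * X i)) =
      (Polynomial.derivative (Polynomial.X ^ (N ^ (k:ℕ)) : Polynomial K) * kron N (pderiv k p)) * Polynomial.X ^ (N ^ (i:ℕ)) + (if k = i then kron N p * Polynomial.derivative (Polynomial.X ^ (N ^ (i:ℕ)) : Polynomial K) else 0) := by
      intro k
      rw [pderiv_mul, map_add, map_mul, map_mul, hX, pderiv_X]
      by_cases hk : k = i
      · subst hk; simp; ring
      · simp [hk, Ne.symm hk]; ring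
    rw [sum_congr rfl fun k _ => this k, sum_add_distrib, ← sum_mul, ← hp, map_mul, hX, Polynomial.derivative_mul]
    simp
lemma det_choose {A : Type*} [CommRing A] {r : ℕ} (S : Fin r → Set (Fin r → A)) (v : Fin r → Fin r → A) (hv : ∀ a, v a ∈ Submodule.span A (S a))
    (hdet : (Matrix.of v).det ≠ 0) : ∃ w : Fin r → Fin r → A, (∀ a, w a ∈ S a) ∧ (Matrix.of w).det ≠ 0 := by
  classical
  have : ∀ I : Finset (Fin r), ∃ w : Fin r → Fin r → A, (∀ a ∈ I, w a ∈ S a) ∧ (∀ a ∉ I, w a = v a) ∧ (Matrix.of w).det ≠ 0 := by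
    intro I
    induction I using Finset.induction_on with
    | empty => exact ⟨v, by simp, by simp, hdet⟩
    | insert i I hi ih =>
      obtain ⟨w, h1, h2, h3⟩ := ih
      by_contra! hcon
      apply h3
      have hz : ∀ u ∈ Submodule.span A (S i), (Matrix.detRowAlternating (R := A)).toMultilinearMap.toLinearMap w i u = 0 := by
        intro u hu
        refine Submodule.span_induction (p := fun u _ => (Matrix.detRowAlternating (R := A)).toMultilinearMap.toLinearMap w i u = 0) ?_ (map_zero _) ?_ ?_ hu
        · intro u hu
          refine hcon (Function.update w i u) ?_ ?_
          · intro a ha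
            by_cases hai : a = i
            · subst hai; simpa using hu
            · rw [Function.update_of_ne hai]; exact h1 a (by simpa [hai] using ha)
          · intro a ha
            simp only [mem_insert, not_or] at ha
            rw [Function.update_of_ne ha.1]; exact h2 a ha.2
        · intro x y _ _ hx hy; rw [map_add, hx, hy, add_zero]
        · intro a x _ hx; rw [map_smul, hx, smul_zero]
      have := hz (w i) (h2 i hi ▸ hv i)
      rw [MultilinearMap.toLinearMap_apply, Function.update_eq_self] at this
      exact this
  obtain ⟨w, h1, -, h3⟩ := this univ
  exact ⟨w, fun a => h1 a (mem_univ a), h3⟩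
lemma GW [CharZero K] {r : ℕ} (f : Fin r → MvPolynomial (Fin m) K) (hf : LinearIndependent K f) :
    ∃ J : Fin r → Fin m →₀ ℕ, (∀ a, (J a).degree ≤ (a:ℕ)) ∧ (Matrix.of fun a b => HJ (J a) (f b)).det ≠ 0 := by
  classical
  set N := 1 + ∑ b, ∑ k, degreeOf k (f b)
  have hN : ∀ b k, degreeOf k (f b) < N := by
    intro b k
    have a1 := single_le_sum (f := fun k => degreeOf k (f b)) (fun _ _ => Nat.zero_le _) (mem_univ k)
    have a2 := single_le_sum (f := fun b => ∑ k, degreeOf k (f b)) (fun _ _ => Nat.zero_le _) (mem_univ b)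
    exact Nat.lt_one_add_iff.2 (a1.trans a2)
  have hind : LinearIndependent K fun b => kron N (f b) := by
    rw [Fintype.linearIndependent_iff] at hf ⊢
    intro g hg
    refine hf g (kron_inj (N := N) _ (fun k => ?_) (by simpa [map_sum] using hg))
    refine lt_of_le_of_lt (degreeOf_sum_le k univ (fun b => g b • f b)) ?_
    rw [Finset.sup_lt_iff (by simp [N])]
    intro b _
    refine lt_of_le_of_lt ?_ (hN b k)
    rw [smul_eq_C_mul]
    exact degreeOf_C_mul_le _ _ _
  have hW := W1 _ hind
  set Rw : (Fin m →₀ ℕ) → Fin r → Polynomial K := fun J b => kron N (HJ J (f b)) with hRw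
  have hsp : ∀ a : ℕ, (fun b => Polynomial.derivative^[a] (kron N (f b))) ∈ Submodule.span (Polynomial K) (Rw '' {J | J.degree ≤ a}) := by
    intro a
    induction a with
    | zero => exact Submodule.subset_span ⟨0, by simp, by simp [hRw, HJ_zero]⟩
    | succ a ih =>
      have : ∀ v ∈ Submodule.span (Polynomial K) (Rw '' {J | J.degree ≤ a}), (fun b => Polynomial.derivative (v b)) ∈ Submodule.span (Polynomial K) (Rw '' {J | J.degree ≤ a + 1}) := by
        intro v hv
        have hsub : {J : Fin m →₀ ℕ | J.degree ≤ a} ⊆ {J | J.degree ≤ a + 1} := fun J hJ => Nat.le_succ_of_le hJ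
        induction hv using Submodule.span_induction with
        | mem v hv =>
          obtain ⟨J, hJ, rfl⟩ := hv
          have : (fun b => Polynomial.derivative (Rw J b)) = ∑ k : Fin m, (Polynomial.derivative (Polynomial.X ^ (N ^ (k:ℕ)) : Polynomial K) * Polynomial.C ((J k + 1 : ℕ) : K)) • Rw (J + Finsupp.single k 1) := by
            ext1 b
            rw [hRw, Finset.sum_apply]
            simp only [kron_deriv, pderiv_HJ, Pi.smul_apply, smul_eq_mul, map_smul, mul_assoc, ← Polynomial.smul_eq_C_mul]
          rw [this]
          refine Submodule.sum_mem _ fun k _ => Submodule.smul_mem _ _ (Submodule.subset_span ⟨_, ?_, rfl⟩)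
          have : J.degree ≤ a := hJ
          simp only [Set.mem_ofPred_eq, map_add, Finsupp.degree_single]; omega
        | zero => simp only [Pi.zero_apply, Polynomial.derivative_zero]; exact Submodule.zero_mem _
        | add x y _ _ hx hy =>
          have := Submodule.add_mem _ hx hy
          convert this using 1
          ext1 b; simp
        | smul p x hx' hx =>
          have := Submodule.add_mem _ (Submodule.smul_mem _ (Polynomial.derivative p) (Submodule.span_mono (Set.image_mono hsub) hx')) (Submodule.smul_mem _ p hx)
          convert this using 1
          ext1 b; simp [Polynomial.derivative_mul]
      have := this _ ih
      simpa only [Function.iterate_succ_apply'] using this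
  obtain ⟨w, hw, hdet⟩ := det_choose (fun a : Fin r => Rw '' {J | J.degree ≤ (a:ℕ)}) _ (fun a => hsp a) hW
  choose J hJ hJw using hw
  refine ⟨J, hJ, fun h0 => hdet ?_⟩
  have := congrArg (kron N) h0
  rw [map_zero, AlgHom.map_det] at this
  convert this using 2
  ext a b
  simp [← hJw a, hRw]
end Lau
end
end
section
open Filter Finset
noncomputable section
namespace Lau
open MvPolynomial
variable {K : Type} [Field K] {τ : Type}
def nrm (w : AbsoluteValue K ℝ) (ρ : τ → ℝ) (P : MvPolynomial τ K) : ℝ :=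
  ∑ e ∈ P.support, w (P.coeff e) * e.prod fun k i => ρ k ^ i
section
variable {w : AbsoluteValue K ℝ} {ρ : τ → ℝ} (hρ : ∀ k, 0 ≤ ρ k)
lemma wt_nonneg (hρ : ∀ k, 0 ≤ ρ k) (e : τ →₀ ℕ) : 0 ≤ e.prod fun k i => ρ k ^ i :=
  prod_nonneg fun k _ => pow_nonneg (hρ k) _
lemma nrm_eq {P : MvPolynomial τ K} {S : Finset (τ →₀ ℕ)} (h : P.support ⊆ S) :
    nrm w ρ P = ∑ e ∈ S, w (P.coeff e) * e.prod fun k i => ρ k ^ i :=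
  sum_subset h fun e _ he => by rw [notMem_support_iff.1 he, map_zero, zero_mul]
lemma nrm_zero : nrm w ρ (0 : MvPolynomial τ K) = 0 := by simp [nrm]
lemma nrm_monomial (e : τ →₀ ℕ) (c : K) : nrm w ρ (monomial e c) = w c * e.prod fun k i => ρ k ^ i := by
  classical
  rw [nrm_eq support_monomial_subset]; simp
include hρ
lemma nrm_nonneg (P : MvPolynomial τ K) : 0 ≤ nrm w ρ P :=
  sum_nonneg fun e _ => mul_nonneg (w.nonneg _) (wt_nonneg hρ e)
lemma coeff_le_nrm (P : MvPolynomial τ K) (e : τ →₀ ℕ) : w (P.coeff e) * (e.prod fun k i => ρ k ^ i) ≤ nrm w ρ P := by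
  classical
  rw [nrm_eq (Finset.subset_insert e _)]
  exact single_le_sum (f := fun e => w (P.coeff e) * (e.prod fun k i => ρ k ^ i)) (fun e _ => mul_nonneg (w.nonneg _) (wt_nonneg hρ e)) (mem_insert_self _ _)
lemma nrm_add (P Q : MvPolynomial τ K) : nrm w ρ (P + Q) ≤ nrm w ρ P + nrm w ρ Q := by
  classical
  rw [nrm_eq support_add, nrm_eq (P := P) Finset.subset_union_left, nrm_eq (P := Q) Finset.subset_union_right, ← sum_add_distrib]
  refine sum_le_sum fun e _ => ?_
  rw [← add_mul, coeff_add]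
  exact mul_le_mul_of_nonneg_right (w.add_le _ _) (wt_nonneg hρ e)
lemma nrm_sum {α : Type*} (S : Finset α) (f : α → MvPolynomial τ K) : nrm w ρ (∑ a ∈ S, f a) ≤ ∑ a ∈ S, nrm w ρ (f a) := by
  classical
  induction S using Finset.induction_on with
  | empty => simp [nrm_zero]
  | insert a S ha ih => rw [sum_insert ha, sum_insert ha]; exact (nrm_add hρ _ _).trans (by linarith)
lemma nrm_mul (P Q : MvPolynomial τ K) : nrm w ρ (P * Q) ≤ nrm w ρ P * nrm w ρ Q := by
  conv_lhs => rw [P.as_sum, Q.as_sum, sum_mul_sum]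
  refine (nrm_sum hρ _ _).trans ((sum_le_sum fun e _ => nrm_sum hρ _ _).trans (le_of_eq ?_))
  rw [nrm, nrm, sum_mul_sum]
  refine sum_congr rfl fun e _ => sum_congr rfl fun f _ => ?_
  rw [monomial_mul, nrm_monomial, map_mul, Finsupp.prod_add_index' (by simp) (by simp [pow_add])]
  ring
omit hρ in
lemma nrm_C (c : K) : nrm w ρ (C c) = w c := by rw [← monomial_zero', nrm_monomial]; simp
lemma nrm_prod {α : Type*} (S : Finset α) (f : α → MvPolynomial τ K) : nrm w ρ (∏ a ∈ S, f a) ≤ ∏ a ∈ S, nrm w ρ (f a) := by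
  classical
  induction S using Finset.induction_on with
  | empty => simp [← C_1, nrm_C, -map_one]
  | insert a S ha ih =>
    rw [prod_insert ha, prod_insert ha]
    exact (nrm_mul hρ _ _).trans (mul_le_mul_of_nonneg_left ih (nrm_nonneg hρ _))
lemma nrm_pow (P : MvPolynomial τ K) (i : ℕ) : nrm w ρ (P ^ i) ≤ nrm w ρ P ^ i := by
  simpa using nrm_prod hρ (Finset.range i) fun _ => P
lemma nrm_aeval {τ' : Type} {ρ' : τ' → ℝ} (g : τ' → MvPolynomial τ K) (hg : ∀ j, nrm w ρ (g j) ≤ ρ' j) (P : MvPolynomial τ' K) :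
    nrm w ρ (aeval g P) ≤ nrm w ρ' P := by
  conv_lhs => rw [P.as_sum, map_sum]
  refine (nrm_sum hρ _ _).trans (sum_le_sum fun e _ => ?_)
  rw [aeval_monomial]
  refine (nrm_mul hρ _ _).trans ?_
  rw [algebraMap_eq, nrm_C]
  refine mul_le_mul_of_nonneg_left ((nrm_prod hρ _ _).trans (prod_le_prod (fun _ _ => nrm_nonneg hρ _) fun j _ => (nrm_pow hρ _ _).trans ?_)) (w.nonneg _)
  exact pow_le_pow_left₀ (nrm_nonneg hρ _) (hg j) _
lemma nrm_det {r : ℕ} (M : Matrix (Fin r) (Fin r) (MvPolynomial τ K)) : nrm w ρ M.det ≤ ∏ a, ∑ i, nrm w ρ (M a i) := by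
  rw [← Matrix.det_transpose, Matrix.det_apply']
  refine (nrm_sum hρ _ _).trans ?_
  rw [prod_univ_sum]
  have h1 : ∀ p : Equiv.Perm (Fin r), nrm w ρ (((Equiv.Perm.sign p : ℤ) : MvPolynomial τ K) * ∏ i, M.transpose (p i) i) ≤ ∏ j, nrm w ρ (M j (p j)) := by
    intro p
    have : nrm w ρ ((Equiv.Perm.sign p : ℤ) : MvPolynomial τ K) = 1 := by
      rw [← map_intCast (C : K →+* MvPolynomial τ K), nrm_C]
      rcases Int.units_eq_one_or (Equiv.Perm.sign p) with h | h <;> simp [h]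
    refine (nrm_mul hρ _ _).trans ?_
    rw [this, one_mul]; exact nrm_prod hρ _ _
  refine (sum_le_sum fun p _ => h1 p).trans ?_
  rw [← sum_image (f := fun q : Fin r → Fin r => ∏ j, nrm w ρ (M j (q j))) (s := univ)
    (g := fun p : Equiv.Perm (Fin r) => (p : Fin r → Fin r)) (fun a _ b _ h => Equiv.coe_fn_injective h)]
  exact sum_le_sum_of_subset_of_nonneg (fun q _ => by simp) fun q _ _ => prod_nonneg fun j _ => nrm_nonneg hρ _
end
section
variable {A : Type} [CommRing A]
def Ge (q : τ → ℝ) (θ : ℝ) (P : MvPolynomial τ A) : Prop := ∀ α : τ →₀ ℕ, P.coeff α ≠ 0 → θ ≤ α.sum fun k i => i * q k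
lemma Ge.mono {q : τ → ℝ} {θ θ' : ℝ} {P : MvPolynomial τ A} (h : Ge q θ P) (hθ : θ' ≤ θ) : Ge q θ' P := fun α ha => hθ.trans (h α ha)
lemma Ge.add {q : τ → ℝ} {θ : ℝ} {P Q : MvPolynomial τ A} (h : Ge q θ P) (h' : Ge q θ Q) : Ge q θ (P + Q) := by
  intro α ha
  rw [coeff_add] at ha
  by_cases h0 : P.coeff α = 0
  · exact h' α (by simpa [h0] using ha)
  · exact h α h0
lemma Ge.zero {q : τ → ℝ} {θ : ℝ} : Ge q θ (0 : MvPolynomial τ A) := fun α ha => absurd (coeff_zero α) ha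
lemma Ge.sum {q : τ → ℝ} {θ : ℝ} {α : Type*} {S : Finset α} {f : α → MvPolynomial τ A} (h : ∀ a ∈ S, Ge q θ (f a)) : Ge q θ (∑ a ∈ S, f a) :=
  sum_induction f (Ge q θ) (fun _ _ => Ge.add) Ge.zero h
lemma Ge.mul {q : τ → ℝ} {θ θ' : ℝ} {P Q : MvPolynomial τ A} (h : Ge q θ P) (h' : Ge q θ' Q) : Ge q (θ + θ') (P * Q) := by
  classical
  intro α ha
  rw [coeff_mul] at ha
  obtain ⟨⟨a, b⟩, hab, hne⟩ := exists_ne_zero_of_sum_ne_zero ha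
  replace hab : a + b = α := by simpa using hab
  rw [← hab, Finsupp.sum_add_index' (by simp) (by intros; push_cast; ring)]
  exact add_le_add (h a (left_ne_zero_of_mul hne)) (h' b (right_ne_zero_of_mul hne))
lemma Ge.C {q : τ → ℝ} (c : A) : Ge q 0 (MvPolynomial.C c : MvPolynomial τ A) := by
  classical
  intro α ha
  rw [coeff_C] at ha
  have : 0 = α := by by_contra h; simp [h] at ha
  simp [← this]
lemma Ge.prod {q : τ → ℝ} {α : Type*} {S : Finset α} {f : α → MvPolynomial τ A} {θ : α → ℝ} (h : ∀ a ∈ S, Ge q (θ a) (f a)) : Ge q (∑ a ∈ S, θ a) (∏ a ∈ S, f a) := by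
  classical
  induction S using Finset.induction_on with
  | empty => simpa using Ge.C (1:A)
  | insert a S ha ih =>
    rw [prod_insert ha, sum_insert ha]
    exact (h a (mem_insert_self _ _)).mul (ih fun b hb => h b (mem_insert_of_mem hb))
lemma Ge.det {q : τ → ℝ} {r : ℕ} {M : Matrix (Fin r) (Fin r) (MvPolynomial τ A)} {θ : Fin r → ℝ} (h : ∀ a i, Ge q (θ i) (M a i)) : Ge q (∑ i, θ i) M.det := by
  rw [Matrix.det_apply']
  refine Ge.sum fun p _ => ?_
  have := (Ge.C (q := q) (((Equiv.Perm.sign p : ℤ) : A))).mul (Ge.prod (S := univ) fun i _ => h (p i) i)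
  rw [zero_add] at this
  rwa [map_intCast] at this
end
def CR (R : Subring K) : Subring (MvPolynomial τ K) := (MvPolynomial.map R.subtype).range
lemma mem_CR {R : Subring K} {P : MvPolynomial τ K} : P ∈ CR R ↔ ∀ α, P.coeff α ∈ R := by
  classical
  constructor
  · rintro ⟨Q, rfl⟩ α
    rw [coeff_map]; exact (Q.coeff α).2
  · intro h
    rw [P.as_sum]
    exact Subring.sum_mem _ fun α _ => ⟨monomial α ⟨P.coeff α, h α⟩, by simp⟩
lemma det_mem' {A : Type*} [CommRing A] {R : Subring A} {m : Type*} [Fintype m] [DecidableEq m] (M : Matrix m m A) (h : ∀ i j, M i j ∈ R) : M.det ∈ R := by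
  rw [Matrix.det_apply']
  refine R.sum_mem fun p _ => R.mul_mem (intCast_mem R _) (R.prod_mem fun i _ => h _ _)
end Lau
end
end
section
open Filter Finset
noncomputable section
namespace Lau
open MvPolynomial
variable {K : Type} [Field K] {m : ℕ}
def shift (ξ : Fin m → K) : MvPolynomial (Fin m) K →ₐ[K] MvPolynomial (Fin m) K := aeval fun k => X k + C (ξ k)
lemma pderiv_shift (ξ : Fin m → K) (k : Fin m) (f : MvPolynomial (Fin m) K) : pderiv k (shift ξ f) = shift ξ (pderiv k f) := by
  classical
  induction f using MvPolynomial.induction_on with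
  | C a => simp [shift]
  | add p q hp hq => simp only [map_add, hp, hq]
  | mul_X p i hp =>
    have hX : shift ξ (X i) = X i + C (ξ i) := by simp [shift]
    rw [map_mul, pderiv_mul, hp, hX, pderiv_mul, map_add, map_add, map_mul, map_mul, hX, pderiv_C, add_zero]
    congr 2
    by_cases h : k = i
    · subst h; simp
    · rw [pderiv_X_of_ne (Ne.symm h), map_zero]
lemma HJ_shift [CharZero K] (ξ : Fin m → K) (f : MvPolynomial (Fin m) K) (J : Fin m →₀ ℕ) : HJ J (shift ξ f) = shift ξ (HJ J f) := by
  classical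
  generalize hN : J.degree = N
  induction N generalizing J with
  | zero => rw [(Finsupp.degree_eq_zero_iff J).1 hN, HJ_zero, HJ_zero]
  | succ N ih =>
    obtain ⟨k, hk⟩ : ∃ k, J k ≠ 0 := by
      by_contra! h
      have : J = 0 := Finsupp.ext h
      simp [this] at hN
    obtain ⟨J', rfl⟩ : ∃ J', J = J' + Finsupp.single k 1 := ⟨J - Finsupp.single k 1, by
      rw [tsub_add_cancel_of_le]; rw [Finsupp.single_le_iff]; omega⟩
    rw [map_add, Finsupp.degree_single] at hN
    have h1 := congrArg (pderiv k) (ih J' (by omega))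
    rw [pderiv_shift, pderiv_HJ, pderiv_HJ, map_smul] at h1
    exact smul_right_injective _ (Nat.cast_ne_zero.2 (Nat.succ_ne_zero (J' k))) h1
lemma Ge.HJ {q : Fin m → ℝ} {θ : ℝ} {P : MvPolynomial (Fin m) K} (h : Ge q θ P) (J : Fin m →₀ ℕ) :
    Ge q (θ - ∑ k, J k * q k) (HJ J P) := by
  intro α ha
  rw [HJ_coeff] at ha
  have := h _ (left_ne_zero_of_mul ha)
  rw [Finsupp.sum_fintype _ _ (by simp)] at this ⊢
  simp only [Finsupp.add_apply, Nat.cast_add, add_mul, sum_add_distrib] at this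
  linarith
lemma CR_HJ {R : Subring K} {P : MvPolynomial (Fin m) K} (h : P ∈ CR R) (J : Fin m →₀ ℕ) : HJ J P ∈ CR R := by
  rw [mem_CR] at h ⊢
  intro α; rw [HJ_coeff]
  exact R.mul_mem (h _) (R.prod_mem fun k _ => natCast_mem R _)
lemma nrm_HJ (w : AbsoluteValue K ℝ) {P : MvPolynomial (Fin m) K} {d : Fin m → ℕ} (hd : ∀ α, P.coeff α ≠ 0 → ∀ k, α k ≤ d k) (J : Fin m →₀ ℕ) :
    nrm w 1 (HJ J P) ≤ 2 ^ (∑ k, d k) * nrm w 1 P := by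
  classical
  have h1 : ∀ α, w (coeff α (HJ J P)) ≤ 2 ^ (∑ k, d k) * w (P.coeff (α + J)) := by
    intro α
    rw [HJ_coeff, map_mul, mul_comm]
    by_cases h0 : P.coeff (α + J) = 0
    · simp [h0]
    refine mul_le_mul_of_nonneg_right ?_ (w.nonneg _)
    rw [map_prod, ← prod_pow_eq_pow_sum]
    refine prod_le_prod (fun _ _ => w.nonneg _) fun k _ => ?_
    refine (w.apply_nat_le_self _).trans ?_
    have := hd _ h0 k
    exact_mod_cast (Nat.choose_le_two_pow _ _).trans (Nat.pow_le_pow_right (by norm_num) this)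
  calc nrm w 1 (HJ J P) ≤ ∑ α ∈ (HJ J P).support, 2 ^ (∑ k, d k) * w (P.coeff (α + J)) := by
        refine sum_le_sum fun α _ => ?_
        simpa [Finsupp.prod] using h1 α
    _ = 2 ^ (∑ k, d k) * ∑ α ∈ (HJ J P).support.image (· + J), w (P.coeff α) := by
        rw [Finset.mul_sum, sum_image (fun a _ b _ h => add_right_cancel h)]
    _ ≤ _ := by
        refine mul_le_mul_of_nonneg_left ?_ (by positivity)
        rw [nrm]
        simp only [Pi.one_apply, one_pow, Finsupp.prod, prod_const_one, mul_one]
        refine sum_le_sum_of_subset_of_nonneg (fun α hα => ?_) fun _ _ _ => w.nonneg _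
        obtain ⟨β, hβ, rfl⟩ := mem_image.1 hα
        rw [mem_support_iff, HJ_coeff] at hβ
        exact mem_support_iff.2 (left_ne_zero_of_mul hβ)
def φ1 : MvPolynomial (Fin m) K →ₐ[K] MvPolynomial (Fin (m+1)) K := rename Fin.succ
def φ2 : Polynomial K →ₐ[K] MvPolynomial (Fin (m+1)) K := Polynomial.aeval (X 0)
lemma E_coeff (f : MvPolynomial (Fin m) K) (g : Polynomial K) (i : ℕ) (α : Fin m →₀ ℕ) :
    coeff (α.cons i) (φ1 f * φ2 g) = coeff α f * g.coeff i := by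
  have h1 : finSuccEquiv K m (φ1 f) = Polynomial.C f := by
    induction f using MvPolynomial.induction_on with
    | C a => simp [φ1, finSuccEquiv_apply]
    | add p q hp hq => simp only [map_add, hp, hq]
    | mul_X p i hp => rw [map_mul, map_mul, hp, map_mul, φ1, rename_X, finSuccEquiv_X_succ]
  have h2 : finSuccEquiv K m (φ2 g) = Polynomial.map C g := by
    rw [φ2, Polynomial.aeval_def, ← AlgEquiv.coe_ringEquiv, Polynomial.map, ← RingEquiv.coe_toRingHom, Polynomial.hom_eval₂]
    congr 1
    · ext a : 1; simp [finSuccEquiv_apply]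
    · simp [finSuccEquiv_X_zero]
  rw [← finSuccEquiv_coeff_coeff, map_mul, h1, h2, Polynomial.coeff_C_mul, Polynomial.coeff_map, mul_comm, coeff_C_mul, mul_comm]
lemma HJ_E (f : MvPolynomial (Fin m) K) (g : Polynomial K) (i : ℕ) (J : Fin m →₀ ℕ) :
    HJ (J.cons i) (φ1 f * φ2 g) = φ1 (HJ J f) * φ2 (Polynomial.hasseDeriv i g) := by
  ext α
  obtain ⟨j, β, rfl⟩ : ∃ j β, α = Finsupp.cons j β := ⟨α 0, α.tail, (Finsupp.cons_tail α).symm⟩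
  have : Finsupp.cons j β + Finsupp.cons i J = Finsupp.cons (j + i) (β + J) := by
    ext k; refine Fin.cases ?_ (fun k => ?_) k <;> simp
  rw [HJ_coeff, this, E_coeff, E_coeff, HJ_coeff, Fin.prod_univ_succ, Polynomial.hasseDeriv_coeff]
  simp only [Finsupp.cons_zero, Finsupp.cons_succ]
  ring
lemma hasse_det [CharZero K] {r : ℕ} (g : Fin r → Polynomial K) (hg : LinearIndependent K g) :
    (Matrix.of fun (i b : Fin r) => Polynomial.hasseDeriv (i:ℕ) (g b)).det ≠ 0 := by
  intro h
  apply W1 g hg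
  have : (Matrix.of fun (i b : Fin r) => Polynomial.derivative^[(i:ℕ)] (g b)) = Matrix.of fun (i b : Fin r) => ((Nat.factorial (i:ℕ) : ℕ) : Polynomial K) * (Matrix.of fun (i b : Fin r) => Polynomial.hasseDeriv (i:ℕ) (g b)) i b := by
    ext1 i b
    rw [Matrix.of_apply, Matrix.of_apply, Matrix.of_apply, ← nsmul_eq_mul, ← Polynomial.factorial_smul_hasseDeriv]; rfl
  rw [this, Matrix.det_mul_column, h, mul_zero]
lemma decomp (Q : MvPolynomial (Fin (m+1)) K) (d0 : ℕ) (h0 : Q ≠ 0) (hd : ∀ α, Q.coeff α ≠ 0 → α 0 ≤ d0) :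
    ∃ (r : ℕ) (f : Fin r → MvPolynomial (Fin m) K) (g : Fin r → Polynomial K), 0 < r ∧ r ≤ d0 + 1 ∧ LinearIndependent K f ∧ LinearIndependent K g ∧
      Q = ∑ b, φ1 (f b) * φ2 (g b) ∧ ∀ b α, (f b).coeff α ≠ 0 → ∃ i, Q.coeff (α.cons i) ≠ 0 := by
  classical
  set q := fun i => (finSuccEquiv K m Q).coeff i
  have hq : ∀ i, q i ≠ 0 → i ∈ Finset.range (d0 + 1) := by
    intro i hi
    obtain ⟨α, hα⟩ := MvPolynomial.ne_zero_iff.1 hi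
    rw [finSuccEquiv_coeff_coeff] at hα
    have := hd _ hα
    rw [Finsupp.cons_zero] at this
    exact mem_range.2 (by omega)
  obtain ⟨B, hB, hsp, hli⟩ := exists_linearIndependent K (Set.range q)
  have hBs : B ⊆ ↑((Finset.range (d0+1)).image q) := by
    intro x hx
    obtain ⟨i, rfl⟩ := hB hx
    have : q i ≠ 0 := hli.ne_zero ⟨_, hx⟩
    exact mem_coe.2 (mem_image_of_mem q (hq i this))
  have hfin : B.Finite := (Finset.finite_toSet _).subset hBs
  have := hfin.fintype
  set e := (Fintype.equivFin B).symm with he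
  set r := Fintype.card B
  set f : Fin r → MvPolynomial (Fin m) K := fun b => (e b : MvPolynomial (Fin m) K) with hf
  have hfi : LinearIndependent K f := hli.comp e e.injective
  have hmem : ∀ i, q i ∈ Submodule.span K (Set.range f) := by
    intro i
    have : Set.range f = B := by
      ext x; constructor
      · rintro ⟨b, rfl⟩; exact (e b).2
      · intro hx; exact ⟨e.symm ⟨x, hx⟩, by simp [hf]⟩
    rw [this, hsp]; exact Submodule.subset_span ⟨i, rfl⟩
  choose a ha using fun i => (Submodule.mem_span_range_iff_exists_fun K).1 (hmem i)
  have hqe : ∀ b, ∃ i ∈ Finset.range (d0+1), q i = f b := by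
    intro b
    simpa using hBs (e b).2
  set g : Fin r → Polynomial K := fun b => ∑ i ∈ Finset.range (d0+1), Polynomial.monomial i (a i b) with hg
  have hgc : ∀ b i, (g b).coeff i = if i ∈ Finset.range (d0+1) then a i b else 0 := by
    intro b i; simp only [hg, Polynomial.finsetSum_coeff, Polynomial.coeff_monomial]; simp
  refine ⟨r, f, g, ?_, ?_, hfi, ?_, ?_, fun b α ha => by
    obtain ⟨i, -, hi⟩ := hqe b
    exact ⟨i, by rwa [← finSuccEquiv_coeff_coeff, show (finSuccEquiv K m Q).coeff i = f b from hi]⟩⟩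
  · by_contra hr
    have hr : r = 0 := by omega
    have hz : ∀ i, q i = 0 := fun i => by
      rw [← ha i]; refine sum_eq_zero fun b _ => absurd b.2 (by omega)
    apply h0
    apply (finSuccEquiv K m).injective
    rw [map_zero]; ext1 i; exact hz i
  · have h1 : r = B.ncard := by rw [Set.ncard_eq_toFinset_card']; simp [r]
    rw [h1]
    refine (Set.ncard_le_ncard hBs (Finset.finite_toSet _)).trans ?_
    rw [Set.ncard_coe_finset]
    exact card_image_le.trans (by simp)
  · rw [Fintype.linearIndependent_iff]
    intro c hc b
    obtain ⟨i, hi, hib⟩ := hqe b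
    have h1 : ∀ b', a i b' = if b' = b then 1 else 0 := by
      have := Fintype.linearIndependent_iff.1 hfi (fun b' => a i b' - if b' = b then 1 else 0) (by
        simp only [sub_smul, sum_sub_distrib, ha, ite_smul, one_smul, zero_smul]; simp [hib])
      exact fun b' => sub_eq_zero.1 (this b')
    have h2 := congrArg (fun p => Polynomial.coeff p i) hc
    simpa [Polynomial.finsetSum_coeff, hgc, mem_range.1 hi, h1] using h2
  · ext α
    obtain ⟨j, β, rfl⟩ : ∃ j β, α = Finsupp.cons j β := ⟨α 0, α.tail, (Finsupp.cons_tail α).symm⟩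
    simp only [coeff_sum, E_coeff, hgc]
    rw [← finSuccEquiv_coeff_coeff]
    change coeff β (q j) = _
    by_cases hj : j ∈ Finset.range (d0+1)
    · rw [← ha j, coeff_sum]
      simp [mem_range.1 hj, mul_comm]
    · have : q j = 0 := by by_contra h; exact hj (hq j h)
      rw [this]
      simp only [if_neg hj]; simp
end Lau
end
end
section
open Filter Finset
noncomputable section
namespace Lau
open MvPolynomial
variable {K : Type} [Field K] {m : ℕ}
lemma nrm_one {τ : Type} (w : AbsoluteValue K ℝ) (P : MvPolynomial τ K) : nrm w 1 P = ∑ e ∈ P.support, w (P.coeff e) := by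
  simp [nrm, Finsupp.prod]
lemma nrm_pos' {τ : Type} (w : AbsoluteValue K ℝ) {P : MvPolynomial τ K} (h : P ≠ 0) : 0 < nrm w 1 P := by
  rw [nrm_one]
  exact sum_pos (fun e he => w.pos (mem_support_iff.1 he)) (support_nonempty.2 h)
def SD.hQ (D : SD K) {τ : Type} (Q : MvPolynomial τ K) : ℝ := ∑ s, Real.log (nrm (D.v s) 1 Q)
lemma hQ_nonneg (D : SD K) {τ : Type} {Q : MvPolynomial τ K} (h : Q ≠ 0) (hR : Q ∈ CR D.R) : 0 ≤ D.hQ Q := by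
  obtain ⟨e, he⟩ := MvPolynomial.ne_zero_iff.1 h
  have h1 := D.prod_ge _ (mem_CR.1 hR e) he
  rw [SD.hQ, ← Real.log_prod fun s _ => (nrm_pos' _ h).ne']
  refine Real.log_nonneg (h1.trans (prod_le_prod (fun s _ => (D.v s).nonneg _) fun s _ => ?_))
  have := coeff_le_nrm (w := D.v s) (ρ := 1) (fun _ => zero_le_one) Q e
  simpa [Finsupp.prod] using this
lemma nrm_F (w : AbsoluteValue K ℝ) (F : MvPolynomial (Fin m) K) (G : Polynomial K) (i : ℕ) :
    nrm w 1 (C (G.coeff i) * F) ≤ nrm w 1 (φ1 F * φ2 G) := by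
  classical
  rw [nrm_one, nrm_one]
  have : ∀ e, coeff e (C (G.coeff i) * F) = coeff (e.cons i) (φ1 F * φ2 G) := fun e => by rw [E_coeff, coeff_C_mul, mul_comm]
  simp_rw [this]
  rw [← sum_image (g := Finsupp.cons i) (f := fun e => w (coeff e (φ1 F * φ2 G))) (fun a _ b _ h => by simpa using congrArg Finsupp.tail h)]
  refine sum_le_sum_of_subset_of_nonneg (fun e he => ?_) fun _ _ _ => w.nonneg _
  obtain ⟨a, ha, rfl⟩ := mem_image.1 he
  rw [mem_support_iff, this] at ha
  exact mem_support_iff.2 ha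
lemma nrm_G (w : AbsoluteValue K ℝ) (F : MvPolynomial (Fin m) K) (G : Polynomial K) (α : Fin m →₀ ℕ) :
    ∑ i ∈ (Polynomial.C (F.coeff α) * G).support, w ((Polynomial.C (F.coeff α) * G).coeff i) ≤ nrm w 1 (φ1 F * φ2 G) := by
  classical
  rw [nrm_one]
  have : ∀ i, (Polynomial.C (F.coeff α) * G).coeff i = coeff (α.cons i) (φ1 F * φ2 G) := fun e => by rw [E_coeff, Polynomial.coeff_C_mul]
  simp_rw [this]
  rw [← sum_image (g := fun i => Finsupp.cons i α) (f := fun e => w (coeff e (φ1 F * φ2 G))) (fun a _ b _ h => by simpa using congrArg (fun z => z 0) h)]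
  refine sum_le_sum_of_subset_of_nonneg (fun e he => ?_) fun _ _ _ => w.nonneg _
  obtain ⟨a, ha, rfl⟩ := mem_image.1 he
  rw [Polynomial.mem_support_iff, this] at ha
  exact mem_support_iff.2 ha
lemma shift_E (ξ : Fin (m+1) → K) (F : MvPolynomial (Fin m) K) (G : Polynomial K) :
    shift ξ (φ1 F * φ2 G) = φ1 (shift (fun k => ξ k.succ) F) * φ2 (G.comp (Polynomial.X + Polynomial.C (ξ 0))) := by
  rw [map_mul]
  congr 1
  · have : (shift ξ).comp φ1 = φ1.comp (shift fun k => ξ k.succ) := by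
      ext k; simp [shift, φ1]
    exact DFunLike.congr_fun this F
  · have : (shift ξ).comp φ2 = φ2.comp (Polynomial.aeval (Polynomial.X + Polynomial.C (ξ 0))) := by
      ext; simp [shift, φ2]
    rw [Polynomial.comp_eq_aeval]
    exact DFunLike.congr_fun this G
lemma sum_lower {θ : ℝ} (h0 : 0 < θ) (h1 : θ ≤ 1) (r d : ℕ) (hd : 0 < d) (hr : r ≤ d + 1) :
    θ ^ 2 * r / 32 ≤ ∑ i : Fin r, max 0 (θ / 2 - (i:ℕ) / (d:ℝ)) := by
  set p := min r (⌊θ * d / 4⌋₊ + 1)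
  rw [Fin.sum_univ_eq_sum_range (fun i : ℕ => max 0 (θ / 2 - i / (d:ℝ)))]
  have hd' : (0:ℝ) < d := by exact_mod_cast hd
  have hp : θ * r / 8 ≤ (p:ℝ) := by
    rw [Nat.cast_min, le_min_iff]
    have hr' : (r:ℝ) ≤ d + 1 := by exact_mod_cast hr
    have hd1 : (1:ℝ) ≤ d := by exact_mod_cast hd
    have hr0 : (0:ℝ) ≤ r := by positivity
    constructor
    · nlinarith
    · have := Nat.lt_floor_add_one (θ * d / 4)
      push_cast; nlinarith
  calc θ ^ 2 * r / 32 = (θ * r / 8) * (θ / 4) := by ring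
    _ ≤ p * (θ / 4) := by gcongr
    _ = ∑ i ∈ Finset.range p, θ / 4 := by simp
    _ ≤ ∑ i ∈ Finset.range p, max 0 (θ / 2 - i / (d:ℝ)) := by
        refine sum_le_sum fun i hi => le_max_of_le_right ?_
        have : i ≤ ⌊θ * d / 4⌋₊ := by have := mem_range.1 hi; omega
        have : (i:ℝ) ≤ θ * d / 4 := (Nat.le_floor_iff (by positivity)).1 this
        have : (i:ℝ) / d ≤ θ / 4 := by rw [div_le_iff₀ hd']; linarith
        linarith
    _ ≤ _ := sum_le_sum_of_subset_of_nonneg (fun i hi => by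
        simp only [mem_range] at *; omega) fun _ _ _ => le_max_left _ _
def RLs (D : SD K) (m : ℕ) : Prop := ∀ θ : ℝ, 0 < θ → ∃ ω : ℝ, 0 < ω ∧ ∀ (d : Fin m → ℕ) (ξ : Fin m → K) (Q : MvPolynomial (Fin m) K), (∀ k, 0 < d k) →
    (∀ i j, i < j → (d i : ℝ) ≤ ω * d j) → Q ≠ 0 → Q ∈ CR D.R → (∀ α, Q.coeff α ≠ 0 → ∀ k, α k ≤ d k) →
    (∀ k, D.hQ Q + ∑ i : Fin m, (d i : ℝ) ≤ ω * d k * D.ht (ξ k)) → ¬ Ge (fun k => ((d k : ℝ))⁻¹) θ (shift ξ Q)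
lemma RL_step [CharZero K] (D : SD K) (ih : RLs D m) {θ : ℝ} (h0 : 0 < θ) (h1 : θ ≤ 1) : ∃ ω : ℝ, 0 < ω ∧ ∀ (d : Fin (m+1) → ℕ) (ξ : Fin (m+1) → K) (Q : MvPolynomial (Fin (m+1)) K), (∀ k, 0 < d k) →
    (∀ i j, i < j → (d i : ℝ) ≤ ω * d j) → Q ≠ 0 → Q ∈ CR D.R → (∀ α, Q.coeff α ≠ 0 → ∀ k, α k ≤ d k) →
    (∀ k, D.hQ Q + ∑ i : Fin (m+1), (d i : ℝ) ≤ ω * d k * D.ht (ξ k)) → ¬ Ge (fun k => ((d k : ℝ))⁻¹) θ (shift ξ Q) := by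
  classical
  obtain ⟨ω1, hω1, ih⟩ := ih (θ ^ 2 / 64) (by positivity)
  set A : ℝ := 1 + Fintype.card D.σ * Real.log 4 with hA
  have hA1 : 1 ≤ A := by have : 0 ≤ Real.log 4 := Real.log_nonneg (by norm_num); rw [hA]; nlinarith [(Nat.cast_nonneg (Fintype.card D.σ) : (0:ℝ) ≤ _)]
  set ω := min ω1 (min (θ ^ 2 / 128) ω1) / (A + 1) with hω
  have hω0 : 0 < ω := by positivity
  have hωa : (A + 1) * ω ≤ ω1 := by rw [hω, mul_div_cancel₀ _ (by positivity)]; exact min_le_left _ _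
  have hωb : (A + 1) * ω ≤ θ ^ 2 / 128 := by rw [hω, mul_div_cancel₀ _ (by positivity)]; exact (min_le_right _ _).trans (min_le_left _ _)
  have hωc : ω ≤ θ / 2 := by nlinarith
  have hωd : ω ≤ ω1 := by nlinarith
  refine ⟨ω, hω0, fun d ξ Q hd hdd hQ hQR hdeg hh hGe => ?_⟩
  have hd' : ∀ k, (0:ℝ) < d k := fun k => by exact_mod_cast hd k
  obtain ⟨r, f, g, hr0, hrd, hf, hg, hQe, hfdeg⟩ := decomp Q (d 0) hQ fun α ha => hdeg α ha 0
  obtain ⟨J, hJ, hJdet⟩ := GW f hf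
  have hGdet := hasse_det g hg
  set F := (Matrix.of fun a b => HJ (J a) (f b)).det
  set G := (Matrix.of fun (i b : Fin r) => Polynomial.hasseDeriv (i:ℕ) (g b)).det
  set M : Matrix (Fin r) (Fin r) (MvPolynomial (Fin (m+1)) K) := Matrix.of fun a i => HJ ((J a).cons (i:ℕ)) Q with hM
  have hU : M.det = φ1 F * φ2 G := by
    have : M = ((Matrix.of fun a b => HJ (J a) (f b)).map φ1) * ((Matrix.of fun (i b : Fin r) => Polynomial.hasseDeriv (i:ℕ) (g b)).map φ2).transpose := by
      ext1 a i
      rw [Matrix.mul_apply, hM, Matrix.of_apply, hQe, map_sum]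
      exact sum_congr rfl fun b _ => by rw [HJ_E]; rfl
    rw [this, Matrix.det_mul, Matrix.det_transpose]
    congr 1
    · exact (AlgHom.map_det φ1 _).symm
    · exact (AlgHom.map_det φ2 _).symm
  have hr' : (0:ℝ) < r := by exact_mod_cast hr0
  have hUR : M.det ∈ CR D.R := det_mem' _ fun a i => CR_HJ hQR _
  set S := ∑ k, (d k : ℝ) with hS
  have hrS : (r:ℝ) ≤ 2 ^ (∑ k, d k) := by
    have h1 : d 0 ≤ ∑ k, d k := single_le_sum (f := d) (fun _ _ => Nat.zero_le _) (mem_univ 0)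
    have h2 : r ≤ 2 ^ (∑ k, d k) := by have := Nat.lt_two_pow_self (n := ∑ k, d k); omega
    exact_mod_cast h2
  have hUn : ∀ s, nrm (D.v s) 1 M.det ≤ (4 ^ (∑ k, d k) * nrm (D.v s) 1 Q) ^ r := by
    intro s
    have hn : ∀ P : MvPolynomial (Fin (m+1)) K, 0 ≤ nrm (D.v s) 1 P := nrm_nonneg fun _ => zero_le_one
    refine (nrm_det (fun _ => zero_le_one) M).trans ?_
    calc _ ≤ ∏ a : Fin r, (4 ^ (∑ k, d k) * nrm (D.v s) 1 Q) := by
          refine prod_le_prod (fun a _ => sum_nonneg fun i _ => hn _) fun a _ => ?_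
          refine (sum_le_sum fun i _ => nrm_HJ (D.v s) hdeg _).trans ?_
          rw [sum_const, card_univ, Fintype.card_fin, nsmul_eq_mul, ← mul_assoc]
          refine mul_le_mul_of_nonneg_right ?_ (hn _)
          rw [show (4:ℝ) = 2 * 2 by norm_num, mul_pow]
          gcongr
      _ = _ := by simp
  have hF0 : F ≠ 0 := hJdet
  have hG0 : G ≠ 0 := hGdet
  obtain ⟨i0, hi0⟩ : ∃ i, G.coeff i ≠ 0 := by by_contra! h; exact hG0 (Polynomial.ext h)
  obtain ⟨α0, hα0⟩ := MvPolynomial.ne_zero_iff.1 hF0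
  have hlog : ∀ X : D.σ → ℝ, (∀ s, 0 < X s) → (∀ s, X s ≤ nrm (D.v s) 1 M.det) → ∑ s, Real.log (X s) ≤ r * (D.hQ Q + (A - 1) * S) := by
    intro X hX hXU
    calc ∑ s, Real.log (X s) ≤ ∑ s, r * (S * Real.log 4 + Real.log (nrm (D.v s) 1 Q)) := by
          refine sum_le_sum fun s _ => ?_
          refine (Real.log_le_log (hX s) ((hXU s).trans (hUn s))).trans (le_of_eq ?_)
          rw [Real.log_pow, Real.log_mul (by positivity) (nrm_pos' _ hQ).ne', Real.log_pow, hS]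
          push_cast; rfl
      _ = _ := by
          rw [← Finset.mul_sum, sum_add_distrib, SD.hQ, hA, sum_const, card_univ, nsmul_eq_mul]; ring
  have hqn := hQ_nonneg D hQ hQR
  have hSpos : 0 < S := sum_pos (fun k _ => hd' k) ⟨0, mem_univ _⟩
  have hlog' : ∀ X : D.σ → ℝ, (∀ s, 0 < X s) → (∀ s, X s ≤ nrm (D.v s) 1 M.det) → ∑ s, Real.log (X s) + r * S ≤ r * (A * (D.hQ Q + S)) := by
    intro X h2 h3
    have := hlog X h2 h3
    have : r * (D.hQ Q + (A - 1) * S) + r * S ≤ r * (A * (D.hQ Q + S)) := by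
      rw [← mul_add]; refine mul_le_mul_of_nonneg_left ?_ hr'.le; nlinarith
    linarith
  have hUGe : Ge (fun k => ((d k : ℝ))⁻¹) (θ ^ 2 * r / 32) (shift ξ M.det) := by
    have e1 : shift ξ M.det = (M.map (shift ξ)).det := AlgHom.map_det _ _
    rw [e1]
    refine Ge.mono (Ge.det (θ := fun i : Fin r => max 0 (θ / 2 - (i:ℕ) / (d 0:ℝ))) fun a i => ?_) (sum_lower h0 h1 r (d 0) (hd 0) hrd)
    rw [Matrix.map_apply, hM, Matrix.of_apply, ← HJ_shift]
    have e2 : ∀ P : MvPolynomial (Fin (m+1)) K, Ge (fun k => ((d k : ℝ))⁻¹) 0 P := fun P α _ => sum_nonneg fun k _ => by positivity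
    have e3 := hGe.HJ ((J a).cons (i:ℕ))
    have e4 : θ / 2 - (i:ℕ) / (d 0:ℝ) ≤ θ - ∑ k : Fin (m+1), ((J a).cons (i:ℕ) k : ℝ) * (d k:ℝ)⁻¹ := by
      rw [Fin.sum_univ_succ]
      simp only [Finsupp.cons_zero, Finsupp.cons_succ]
      have : ∑ k : Fin m, ((J a k : ℕ):ℝ) * (d k.succ : ℝ)⁻¹ ≤ ω := by
        calc _ ≤ ∑ k : Fin m, ((J a k : ℕ):ℝ) * (ω / d 0) := by
              refine sum_le_sum fun k _ => mul_le_mul_of_nonneg_left ?_ (by positivity)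
              rw [inv_eq_one_div, div_le_div_iff₀ (hd' _) (hd' _), one_mul]
              exact hdd 0 k.succ (Fin.succ_pos k)
          _ = ((J a).degree : ℕ) * (ω / d 0) := by rw [← sum_mul, Finsupp.degree_eq_sum]; push_cast; rfl
          _ ≤ d 0 * (ω / d 0) := by
              refine mul_le_mul_of_nonneg_right ?_ (by have := hd' 0; positivity)
              have := hJ a; have := a.2
              exact_mod_cast (by omega : (J a).degree ≤ d 0)
          _ = ω := by have := hd' 0; field_simp
      rw [div_eq_mul_inv ((i:ℕ):ℝ)]
      linarith
    intro α ha
    exact max_le (e2 _ α ha) (e4.trans (e3 α ha))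
  rw [hU, shift_E] at hUGe
  set e := G.rootMultiplicity (ξ 0) with he
  set G' := G.comp (Polynomial.X + Polynomial.C (ξ 0)) with hG'
  have hG'e : G'.coeff e ≠ 0 := by
    rw [he, Polynomial.rootMultiplicity_eq_natTrailingDegree]
    apply Polynomial.coeff_natTrailingDegree_ne_zero.2
    intro h
    apply hG0
    have := (Polynomial.comp_eq_zero_iff.1 h)
    rcases this with h | ⟨-, h⟩
    · exact h
    · have := congrArg (fun p => Polynomial.coeff p 1) h; simp [Polynomial.coeff_C] at this
  by_cases hcase : θ ^ 2 * r / 64 ≤ e / d 0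
  ·
    have hne : Polynomial.C (F.coeff α0) * G ≠ 0 := mul_ne_zero (by simpa using hα0) hG0
    have h5 := D.roth1 _ hne (fun i => by
      rw [Polynomial.coeff_C_mul, ← E_coeff, ← hU]; exact mem_CR.1 hUR _) (ξ 0) e (Dvd.dvd.mul_left (Polynomial.pow_rootMultiplicity_dvd G (ξ 0)) _)
    have h6 := hlog' (fun s => ∑ i ∈ (Polynomial.C (F.coeff α0) * G).support, D.v s ((Polynomial.C (F.coeff α0) * G).coeff i)) (fun s =>
      sum_pos (fun i hi => (D.v s).pos (Polynomial.mem_support_iff.1 hi)) (Polynomial.support_nonempty.2 hne)) (fun s => by rw [hU]; exact nrm_G _ _ _ _)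
    have h7 := hh 0
    rw [le_div_iff₀ (hd' 0)] at hcase
    have hht := D.ht_nonneg (ξ 0)
    have h8 : θ ^ 2 * r / 64 * d 0 * D.ht (ξ 0) < r * (A * (ω * d 0 * D.ht (ξ 0))) := by
      calc _ ≤ e * D.ht (ξ 0) := mul_le_mul_of_nonneg_right hcase hht
        _ < r * (A * (D.hQ Q + S)) := by nlinarith
        _ ≤ _ := by gcongr
    have h9 : r * (A * (ω * d 0 * D.ht (ξ 0))) ≤ θ ^ 2 * r / 64 * d 0 * D.ht (ξ 0) := by
      have : A * ω ≤ θ ^ 2 / 64 := by nlinarith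
      calc _ = (A * ω) * (r * d 0 * D.ht (ξ 0)) := by ring
        _ ≤ θ ^ 2 / 64 * (r * d 0 * D.ht (ξ 0)) := by
            refine mul_le_mul_of_nonneg_right this ?_
            have := hd' 0; positivity
        _ = _ := by ring
    linarith
  · push Not at hcase
    have hne : C (G.coeff i0) * F ≠ 0 := mul_ne_zero (by simpa using hi0) hF0
    refine ih (fun k => r * d k.succ) (fun k => ξ k.succ) (C (G.coeff i0) * F) (fun k => Nat.mul_pos hr0 (hd _)) ?_ hne ?_ ?_ ?_ ?_
    · intro i j hij
      push_cast
      have := hdd i.succ j.succ (Fin.succ_lt_succ_iff.2 hij)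
      calc (r:ℝ) * d i.succ ≤ r * (ω * d j.succ) := by gcongr
        _ ≤ r * (ω1 * d j.succ) := by gcongr
        _ = _ := by ring
    · rw [mem_CR]; intro α
      rw [coeff_C_mul, mul_comm, ← E_coeff, ← hU]; exact mem_CR.1 hUR _
    · intro α ha k
      have e1 : ∀ a b, Ge (fun j => if j = k then (-1:ℝ) else 0) (-(d k.succ : ℝ)) (HJ (J a) (f b)) := by
        intro a b β hβ
        rw [HJ_coeff] at hβ
        obtain ⟨i, hi⟩ := hfdeg b _ (left_ne_zero_of_mul hβ)
        have := hdeg _ hi k.succ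
        rw [Finsupp.cons_succ, Finsupp.add_apply] at this
        rw [Finsupp.sum_fintype _ _ (by simp)]
        simp
        omega
      have e2 := Ge.det (M := Matrix.of fun a b => HJ (J a) (f b)) (θ := fun _ => -(d k.succ : ℝ)) (fun a b => e1 a b) α (by rw [coeff_C_mul] at ha; exact right_ne_zero_of_mul ha)
      rw [Finsupp.sum_fintype _ _ (by simp)] at e2
      simp at e2
      exact_mod_cast e2
    · intro k
      have h6 := hlog' (fun s => nrm (D.v s) 1 (C (G.coeff i0) * F)) (fun s => nrm_pos' _ hne) (fun s => by rw [hU]; exact nrm_F _ _ _ _)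
      have h7 := hh k.succ
      have hht := D.ht_nonneg (ξ k.succ)
      have h8 : ∑ i : Fin m, ((r * d i.succ : ℕ) : ℝ) ≤ r * S := by
        rw [hS, Fin.sum_univ_succ]; push_cast; rw [← Finset.mul_sum]; have := hd' 0; nlinarith
      calc _ ≤ r * (A * (D.hQ Q + S)) := by rw [SD.hQ]; linarith
        _ ≤ r * (A * (ω * d k.succ * D.ht (ξ k.succ))) := by gcongr
        _ = (A * ω) * (r * d k.succ * D.ht (ξ k.succ)) := by ring
        _ ≤ ω1 * (r * d k.succ * D.ht (ξ k.succ)) := by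
            refine mul_le_mul_of_nonneg_right (by nlinarith) ?_
            have := hd' k.succ; positivity
        _ = _ := by push_cast; ring
    · rw [map_mul]
      have e1 : shift (fun k => ξ k.succ) (C (G.coeff i0)) = (C (G.coeff i0) : MvPolynomial (Fin m) K) := by simp [shift]
      rw [e1]
      intro α ha
      rw [coeff_C_mul] at ha
      have h5 := hUGe (α.cons e) (by rw [E_coeff]; exact mul_ne_zero (right_ne_zero_of_mul ha) hG'e)
      rw [Finsupp.sum_fintype _ _ (by simp)] at h5 ⊢
      rw [Fin.sum_univ_succ] at h5
      simp only [Finsupp.cons_zero, Finsupp.cons_succ] at h5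
      rw [← div_eq_mul_inv] at h5
      have : ∑ k : Fin m, (α k : ℝ) * ((r * d k.succ : ℕ):ℝ)⁻¹ = (∑ k : Fin m, (α k : ℝ) * (d k.succ : ℝ)⁻¹) / r := by
        rw [sum_div]; refine sum_congr rfl fun k _ => ?_
        push_cast; rw [mul_inv]; ring
      rw [this, le_div_iff₀ hr']
      linarith
theorem RL [CharZero K] (D : SD K) (m : ℕ) : RLs D m := by
  induction m with
  | zero =>
    intro θ h0
    refine ⟨1, one_pos, fun d ξ Q _ _ hQ _ _ _ hGe => ?_⟩
    obtain ⟨e, he⟩ := MvPolynomial.ne_zero_iff.1 hQ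
    have h1 : shift ξ Q = Q := by
      have : shift ξ = AlgHom.id K (MvPolynomial (Fin 0) K) := by ext k; exact k.elim0
      rw [this]; rfl
    rw [h1] at hGe
    have := hGe e he
    rw [Finsupp.sum_fintype _ _ (by simp)] at this
    simp at this; linarith
  | succ m ih =>
    intro θ h0
    obtain ⟨ω, hω, h⟩ := RL_step D ih (lt_min h0 one_pos) (min_le_right θ 1)
    exact ⟨ω, hω, fun d ξ Q a b c e f g hGe => h d ξ Q a b c e f g (hGe.mono (min_le_left _ _))⟩
end Lau
end
end
section
open Filter Finset
noncomputable section
namespace Lau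
open MvPolynomial
variable {K : Type} [Field K] {τ : Type}
structure Fil {S : Type} [CommRing S] [Algebra K S] (I : ℝ → S → Prop) : Prop where
  zero : ∀ θ, I θ 0
  add : ∀ {θ a b}, I θ a → I θ b → I θ (a + b)
  mul : ∀ {θ θ' a b}, I θ a → I θ' b → I (θ + θ') (a * b)
  c : ∀ c : K, I 0 (algebraMap K S c)
  mono : ∀ {θ θ' a}, I θ a → θ' ≤ θ → I θ' a
section
variable {S : Type} [CommRing S] [Algebra K S] {I : ℝ → S → Prop} (hI : Fil (K := K) I)
include hI
lemma Fil.sum {α : Type*} {T : Finset α} {f : α → S} {θ : ℝ} (h : ∀ a ∈ T, I θ (f a)) : I θ (∑ a ∈ T, f a) :=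
  sum_induction f (I θ) (fun _ _ => hI.add) (hI.zero θ) h
lemma Fil.prod {α : Type*} {T : Finset α} {f : α → S} {θ : α → ℝ} (h : ∀ a ∈ T, I (θ a) (f a)) : I (∑ a ∈ T, θ a) (∏ a ∈ T, f a) := by
  classical
  induction T using Finset.induction_on with
  | empty => simpa using hI.c 1
  | insert a T ha ih =>
    rw [prod_insert ha, sum_insert ha]
    exact hI.mul (h a (mem_insert_self _ _)) (ih fun b hb => h b (mem_insert_of_mem hb))
lemma Fil.pow {a : S} {θ : ℝ} (h : I θ a) (k : ℕ) : I (k * θ) (a ^ k) := by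
  simpa using hI.prod (T := Finset.range k) (f := fun _ => a) (θ := fun _ => θ) fun _ _ => h
lemma Fil.aeval {q : τ → ℝ} {θ : ℝ} {P : MvPolynomial τ K} {g : τ → S} (hP : Ge q θ P) (hg : ∀ x, I (q x) (g x)) : I θ (aeval g P) := by
  rw [P.as_sum, map_sum]
  refine hI.sum fun e he => ?_
  rw [aeval_monomial]
  have := hI.mul (hI.c (P.coeff e)) (hI.prod (T := e.support) fun x _ => hI.pow (hg x) (e x))
  rw [zero_add] at this
  exact hI.mono this (hP e (mem_support_iff.1 he))
lemma Fil.aeval_sub {q : τ → ℝ} {θ : ℝ} {P : MvPolynomial τ K} {g g' : τ → S} (hP : Ge q θ P) (hg : ∀ x, I (q x) (g x)) (hg' : ∀ x, I (q x) (g' x))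
    (hd : ∀ x, I (q x + 1) (g x - g' x)) : I (θ + 1) (MvPolynomial.aeval g P - MvPolynomial.aeval g' P) := by
  classical
  have mulS : ∀ {a b a' b' : S} {x y : ℝ}, I x a' → I y b → I (x + 1) (a - a') → I (y + 1) (b - b') → I (x + y + 1) (a * b - a' * b') := by
    intro a b a' b' x y h1 h2 h3 h4
    have h5 := hI.mul h3 h2
    have h6 := hI.mul h1 h4
    rw [show a * b - a' * b' = (a - a') * b + a' * (b - b') by ring]
    refine hI.add ?_ ?_
    · rwa [show x + y + 1 = x + 1 + y by ring]
    · rwa [show x + y + 1 = x + (y + 1) by ring]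
  have powS : ∀ x (k : ℕ), I (k * q x + 1) (g x ^ k - g' x ^ k) := by
    intro x k
    induction k with
    | zero => simpa using hI.zero _
    | succ k ih =>
      rw [pow_succ, pow_succ]
      have := mulS (hI.pow (hg' x) k) (hg x) ih (hd x)
      push_cast; rwa [show ((k:ℝ) + 1) * q x + 1 = k * q x + q x + 1 by ring]
  have prodS : ∀ (e : τ →₀ ℕ) (T : Finset τ), I (∑ x ∈ T, e x * q x + 1) (∏ x ∈ T, g x ^ e x - ∏ x ∈ T, g' x ^ e x) := by
    intro e T
    induction T using Finset.induction_on with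
    | empty => simpa using hI.zero _
    | insert a T ha ih =>
      rw [prod_insert ha, sum_insert ha, prod_insert ha]
      exact mulS (hI.pow (hg' a) _) (hI.prod fun x _ => hI.pow (hg x) (e x)) (powS a _) ih
  rw [P.as_sum, map_sum, map_sum, ← sum_sub_distrib]
  refine hI.sum fun e he => ?_
  rw [aeval_monomial, aeval_monomial, ← mul_sub]
  have := hI.mul (hI.c (P.coeff e)) (prodS e e.support)
  rw [zero_add] at this
  exact hI.mono this (add_le_add_left (hP e (mem_support_iff.1 he)) 1)
end
lemma filGe {A : Type} [CommRing A] [Algebra K A] (q : τ → ℝ) : Fil (K := K) (S := MvPolynomial τ A) (Ge q) :=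
  ⟨fun _ => Ge.zero, Ge.add, Ge.mul, fun c => by rw [IsScalarTower.algebraMap_apply K A]; exact Ge.C _, Ge.mono⟩
lemma filGB {τ' : Type} (q : τ' → ℝ) : Fil (K := K) (S := MvPolynomial τ (MvPolynomial τ' K)) (fun θ b => ∀ β, Ge q θ (coeff β b)) := by
  classical
  refine ⟨fun _ _ => by rw [coeff_zero]; exact Ge.zero, fun ha hb β => by rw [coeff_add]; exact (ha β).add (hb β), fun ha hb β => ?_, fun c β => ?_, fun ha h β => (ha β).mono h⟩
  · rw [coeff_mul]; exact Ge.sum fun x _ => (ha _).mul (hb _)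
  · rw [IsScalarTower.algebraMap_apply K (MvPolynomial τ' K), algebraMap_eq, coeff_C]
    split_ifs
    · exact Ge.C _
    · exact Ge.zero
lemma Ge.X {A : Type} [CommRing A] (q : τ → ℝ) (x : τ) : Ge q (q x) (X x : MvPolynomial τ A) := by
  classical
  intro α ha
  rw [coeff_X'] at ha
  have : Finsupp.single x 1 = α := by by_contra h; simp [h] at ha
  rw [← this]; simp
lemma second_moment {m : ℕ} {ι : Fin m → Type} [∀ k, DecidableEq (ι k)] (E : ∀ k, Finset (ι k)) (y : ∀ k, ι k → ℝ) (h0 : ∀ k, ∑ e ∈ E k, y k e = 0) (h1 : ∀ k, ∀ e ∈ E k, |y k e| ≤ 1) :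
    ∑ e ∈ Fintype.piFinset E, (∑ k, y k (e k)) ^ 2 ≤ m * #(Fintype.piFinset E) := by
  classical
  have h2 : ∀ k k', k ≠ k' → ∑ e ∈ Fintype.piFinset E, y k (e k) * y k' (e k') = 0 := by
    intro k k' hk
    have := prod_univ_sum E (fun j x => if j = k then y j x else if j = k' then y j x else 1)
    have h3 : ∀ e : (∀ k, ι k), ∏ j, (if j = k then y j (e j) else if j = k' then y j (e j) else 1) = y k (e k) * y k' (e k') := by
      intro e
      rw [← Finset.mul_prod_erase _ _ (mem_univ k), ← Finset.mul_prod_erase _ _ (mem_erase.2 ⟨hk.symm, mem_univ k'⟩), prod_eq_one, mul_one, if_pos rfl, if_neg hk.symm, if_pos rfl]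
      intro j hj
      simp only [mem_erase] at hj
      rw [if_neg hj.2.1, if_neg hj.1]
    simp only [h3] at this
    rw [← this]
    exact prod_eq_zero (mem_univ k) (by simpa using h0 k)
  calc ∑ e ∈ Fintype.piFinset E, (∑ k, y k (e k)) ^ 2 = ∑ k, ∑ k', ∑ e ∈ Fintype.piFinset E, y k (e k) * y k' (e k') := by
        rw [sum_congr rfl fun k _ => sum_comm, sum_comm]
        exact sum_congr rfl fun e _ => by rw [sq, sum_mul_sum]
    _ = ∑ k, ∑ e ∈ Fintype.piFinset E, y k (e k) * y k (e k) := sum_congr rfl fun k _ => sum_eq_single k (fun k' _ h => h2 k k' h.symm) (by simp)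
    _ ≤ ∑ k : Fin m, ∑ e ∈ Fintype.piFinset E, (1:ℝ) := by
        refine sum_le_sum fun k _ => sum_le_sum fun e he => ?_
        rw [← sq, sq_le_one_iff_abs_le_one]
        exact h1 k _ (Fintype.mem_piFinset.1 he k)
    _ = _ := by simp
def Ex {m : ℕ} (n : ℕ) (d : Fin m → ℕ) : Finset (Fin m → Fin n → ℕ) := Fintype.piFinset fun k => Finset.piAntidiag univ (d k)
lemma mem_Ex {m n : ℕ} {d : Fin m → ℕ} {e : Fin m → Fin n → ℕ} : e ∈ Ex n d ↔ ∀ k, ∑ i, e k i = d k := by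
  simp [Ex, Fintype.mem_piFinset]
lemma mean_zero {n : ℕ} (hn : 0 < n) (d : ℕ) (hd : 0 < d) (i : Fin n) :
    ∑ e ∈ Finset.piAntidiag (univ : Finset (Fin n)) d, ((e i : ℝ) / d - 1 / n) = 0 := by
  classical
  set E := Finset.piAntidiag (univ : Finset (Fin n)) d
  have h1 : ∀ i', ∑ e ∈ E, (e i' : ℝ) = ∑ e ∈ E, (e i : ℝ) := by
    intro i'
    refine sum_nbij' (fun e => e ∘ Equiv.swap i i') (fun e => e ∘ Equiv.swap i i') ?_ ?_ ?_ ?_ ?_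
    · intro e he; simp only [E, mem_piAntidiag] at he ⊢
      exact ⟨by rw [← he.1]; exact Equiv.sum_comp (Equiv.swap i i') e, by simp⟩
    · intro e he; simp only [E, mem_piAntidiag] at he ⊢
      exact ⟨by rw [← he.1]; exact Equiv.sum_comp (Equiv.swap i i') e, by simp⟩
    · intro e _; ext x; simp
    · intro e _; ext x; simp
    · intro e _; simp
  have h2 : (n:ℝ) * ∑ e ∈ E, (e i : ℝ) = d * #E := by
    have : ∑ i' : Fin n, ∑ e ∈ E, (e i' : ℝ) = n * ∑ e ∈ E, (e i : ℝ) := by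
      rw [sum_congr rfl fun i' _ => h1 i']; simp
    rw [← this, sum_comm]
    have h3 : ∀ e ∈ E, ∑ i' : Fin n, (e i' : ℝ) = d := by
      intro e he
      simp only [E, mem_piAntidiag] at he
      exact_mod_cast he.1
    rw [sum_congr rfl h3]; simp; ring
  rw [sum_sub_distrib, ← sum_div, sum_const, nsmul_eq_mul]
  have : (0:ℝ) < n := by exact_mod_cast hn
  have : (0:ℝ) < d := by exact_mod_cast hd
  field_simp
  linarith
def Good {m n : ℕ} (η : ℝ) (d : Fin m → ℕ) (e : Fin m → Fin n → ℕ) : Prop := ∀ i : Fin n, |∑ k, (e k i : ℝ) / d k - m / n| ≤ η * m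
open Classical in
lemma few_bad {n : ℕ} (hn : 0 < n) {η : ℝ} (hη : 0 < η) (a : ℕ) : ∃ m : ℕ, 0 < m ∧ ∀ d : Fin m → ℕ, (∀ k, 0 < d k) →
    a * #((Ex n d).filter fun e => ¬ Good η d e) ≤ #(Ex n d) := by
  obtain ⟨m, hm⟩ := exists_nat_gt (a * n / η ^ 2)
  have hm0 : (0:ℝ) < m := lt_of_le_of_lt (by positivity) hm
  refine ⟨m, by exact_mod_cast hm0, fun d hd => ?_⟩
  have hsm : ∀ i : Fin n, ∑ e ∈ Ex n d, (∑ k, ((e k i : ℝ) / d k - 1 / n)) ^ 2 ≤ m * #(Ex n d) := by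
    intro i
    refine second_moment (fun k => Finset.piAntidiag univ (d k)) (fun k e => (e i : ℝ) / d k - 1 / n) (fun k => mean_zero hn (d k) (hd k) i) ?_
    intro k e he
    simp only [mem_piAntidiag] at he
    have h1 : e i ≤ d k := by rw [← he.1]; exact single_le_sum (fun _ _ => Nat.zero_le _) (mem_univ i)
    have h2 : (e i : ℝ) / d k ≤ 1 := div_le_one_of_le₀ (by exact_mod_cast h1) (by positivity)
    have h3 : 0 ≤ (e i : ℝ) / d k := by positivity
    have h4 : (1:ℝ) / n ≤ 1 := div_le_one_of_le₀ (by exact_mod_cast hn) (by positivity)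
    have h5 : (0:ℝ) ≤ 1 / n := by positivity
    rw [abs_le]; constructor <;> linarith
  have h1 : (η * m) ^ 2 * #((Ex n d).filter fun e => ¬ Good η d e) ≤ n * (m * #(Ex n d)) := by
    calc _ = ∑ e ∈ (Ex n d).filter fun e => ¬ Good η d e, (η * m) ^ 2 := by simp; ring
      _ ≤ ∑ e ∈ (Ex n d).filter fun e => ¬ Good η d e, ∑ i, (∑ k, ((e k i : ℝ) / d k - 1 / n)) ^ 2 := by
          refine sum_le_sum fun e he => ?_
          have := (mem_filter.1 he).2
          rw [Good] at this; push Not at this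
          obtain ⟨i, hi⟩ := this
          have h2 : ∑ k : Fin m, ((e k i : ℝ) / d k - 1 / n) = ∑ k, (e k i : ℝ) / d k - m / n := by
            rw [sum_sub_distrib]; simp; ring
          refine le_trans ?_ (single_le_sum (f := fun i => (∑ k, ((e k i : ℝ) / d k - 1 / n)) ^ 2) (fun i _ => sq_nonneg _) (mem_univ i))
          rw [h2, ← sq_abs (∑ k, (e k i : ℝ) / d k - m / n)]
          exact pow_le_pow_left₀ (by positivity) hi.le 2
      _ ≤ ∑ e ∈ Ex n d, ∑ i, (∑ k, ((e k i : ℝ) / d k - 1 / n)) ^ 2 := sum_le_sum_of_subset_of_nonneg (filter_subset _ _) fun e _ _ => sum_nonneg fun i _ => sq_nonneg _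
      _ ≤ _ := by
          rw [sum_comm]
          refine (sum_le_sum fun i _ => hsm i).trans ?_
          simp
  have h2 : (a:ℝ) * #((Ex n d).filter fun e => ¬ Good η d e) ≤ #(Ex n d) := by
    rw [div_lt_iff₀ (by positivity)] at hm
    set x := (#((Ex n d).filter fun e => ¬ Good η d e) : ℝ)
    set y := (#(Ex n d) : ℝ)
    have hx : 0 ≤ x := by positivity
    have hn' : (0:ℝ) < n := by exact_mod_cast hn
    have h3 : η ^ 2 * m * x ≤ n * y := by
      have : m * (η ^ 2 * m * x) ≤ m * (n * y) := by nlinarith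
      exact le_of_mul_le_mul_left this hm0
    have h4 : a * n * x ≤ n * y := le_trans (by nlinarith) h3
    have : n * (a * x) ≤ n * y := by linarith
    exact le_of_mul_le_mul_left this hn'
  exact_mod_cast h2
end Lau
end
end
section
open Filter Finset
open MvPolynomial
noncomputable section
namespace Lau
variable {K : Type} [Field K] {m n : ℕ}
def lf (M : Matrix (Fin n) (Fin n) K) (x : Fin m × Fin n) : MvPolynomial (Fin m × Fin n) K := ∑ j, C (M x.2 j) * X (x.1, j)
def MH {A : Type} [CommRing A] (d : Fin m → ℕ) (P : MvPolynomial (Fin m × Fin n) A) : Prop := ∀ α, P.coeff α ≠ 0 → ∀ k, ∑ i, α (k, i) = d k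
def bq (n : ℕ) (k : Fin m) (x : Fin m × Fin n) : ℝ := if x.1 = k then 1 else 0
lemma bq_sum (k : Fin m) (α : Fin m × Fin n →₀ ℕ) (r : ℝ) : (α.sum fun x i => (i:ℝ) * (r * bq n k x)) = r * ∑ i, α (k, i) := by
  rw [Finsupp.sum_fintype _ _ (by simp), Fintype.sum_prod_type, sum_eq_single k]
  · simp [bq, Finset.mul_sum, mul_comm]
  · intro b _ hb; simp [bq, hb]
  · simp
lemma MH_iff {A : Type} [CommRing A] {d : Fin m → ℕ} {P : MvPolynomial (Fin m × Fin n) A} : MH d P ↔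
    ∀ k, Ge (fun x => 1 * bq n k x) (1 * d k) P ∧ Ge (fun x => -1 * bq n k x) (-1 * d k) P := by
  simp only [MH, Ge, bq_sum]
  constructor
  · intro h k
    constructor <;> intro α ha <;> rw [← h α ha k]
  · intro h α ha k
    have h1 := (h k).1 α ha
    have h2 := (h k).2 α ha
    have : ((∑ i, α (k, i) : ℕ) : ℝ) = d k := by push_cast; push_cast at h1 h2; linarith
    exact_mod_cast this
lemma lf_Ge (M : Matrix (Fin n) (Fin n) K) (r : ℝ) (k : Fin m) (x : Fin m × Fin n) : Ge (fun x => r * bq n k x) (r * bq n k x) (lf M x) := by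
  refine Ge.sum fun j _ => ?_
  have := (Ge.C (q := fun x => r * bq n k x) (M x.2 j)).mul (Ge.X (A := K) (fun x => r * bq n k x) (x.1, j))
  refine this.mono (by simp [bq])
lemma MH.lf {d : Fin m → ℕ} {P : MvPolynomial (Fin m × Fin n) K} (h : MH d P) (M : Matrix (Fin n) (Fin n) K) : MH d (aeval (lf M) P) := by
  rw [MH_iff] at h ⊢
  exact fun k => ⟨(filGe _).aeval (h k).1 (lf_Ge M 1 k), (filGe _).aeval (h k).2 (lf_Ge M (-1) k)⟩
lemma lf_lf (M M' : Matrix (Fin n) (Fin n) K) (h : M' * M = 1) (P : MvPolynomial (Fin m × Fin n) K) : aeval (lf M) (aeval (lf M') P) = P := by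
  rw [comp_aeval_apply]
  have : (fun i => aeval (lf M) (lf M' i)) = (X : Fin m × Fin n → MvPolynomial (Fin m × Fin n) K) := by
    funext x
    simp only [lf, map_sum, map_mul, algHom_C, aeval_X, algebraMap_eq, Finset.mul_sum]
    rw [sum_comm]
    simp_rw [← mul_assoc, ← map_mul, ← sum_mul, ← map_sum, ← Matrix.mul_apply, h, Matrix.one_apply]
    simp
  rw [this]; simp
lemma MH_tot {d : Fin m → ℕ} {α : Fin m × Fin n →₀ ℕ} (h : ∀ k, ∑ i, α (k, i) = d k) {A : Type*} [CommMonoid A] (c : A) :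
    (α.prod fun _ i => c ^ i) = c ^ ∑ k, d k := by
  rw [Finsupp.prod_fintype _ _ (by simp), prod_pow_eq_pow_sum, Fintype.sum_prod_type]
  simp_rw [h]
lemma MH.nrm {d : Fin m → ℕ} {P : MvPolynomial (Fin m × Fin n) K} (h : MH d P) (w : AbsoluteValue K ℝ) (c : ℝ) :
    nrm w (fun _ => c) P = nrm w 1 P * c ^ ∑ k, d k := by
  rw [nrm_one, Lau.nrm, sum_mul]
  refine sum_congr rfl fun e he => ?_
  rw [MH_tot (h e (mem_support_iff.1 he))]
lemma nrm_lf (w : AbsoluteValue K ℝ) (M : Matrix (Fin n) (Fin n) K) (x : Fin m × Fin n) : nrm w 1 (lf M x) ≤ ∑ i, ∑ j, w (M i j) := by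
  refine (nrm_sum (by simp) _ _).trans (le_trans (sum_le_sum fun j _ => ?_) (single_le_sum (f := fun i => ∑ j, w (M i j)) (fun i _ => sum_nonneg fun _ _ => w.nonneg _) (mem_univ x.2)))
  rw [C_mul_X_eq_monomial, nrm_monomial]; simp
lemma common_den (D : SD K) {ι : Type*} (S : Finset ι) (f : ι → K) : ∃ c ∈ D.O, c ≠ 0 ∧ ∀ i ∈ S, c * f i ∈ D.O := by
  classical
  induction S using Finset.induction_on with
  | empty => exact ⟨1, D.O.one_mem, one_ne_zero, by simp⟩
  | insert a S _ ih =>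
    obtain ⟨c, h1, h2, h3⟩ := ih
    obtain ⟨c', h1', h2', h3'⟩ := D.frac (f a)
    refine ⟨c * c', D.O.mul_mem h1 h1', mul_ne_zero h2 h2', fun i hi => ?_⟩
    rcases mem_insert.1 hi with rfl | hi
    · rw [mul_assoc]; exact D.O.mul_mem h1 h3'
    · rw [mul_comm c, mul_assoc]; exact D.O.mul_mem h1' (h3 i hi)
def fe (e : Fin m → Fin n → ℕ) : Fin m × Fin n →₀ ℕ := Finsupp.equivFunOnFinite.symm fun x => e x.1 x.2
lemma fe_self (α : Fin m × Fin n →₀ ℕ) : fe (fun k i => α (k, i)) = α := by ext x; rfl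
lemma card_Ex (d : Fin m → ℕ) : #(Ex n d) ≤ (2 ^ n) ^ ∑ k, d k := by
  have : Ex n d ⊆ Fintype.piFinset fun k => Fintype.piFinset fun _ => range (d k + 1) := by
    intro e he
    simp only [Fintype.mem_piFinset, mem_range]
    intro k i
    rw [← mem_Ex.1 he k]
    exact Nat.lt_succ_of_le (single_le_sum (f := e k) (by simp) (mem_univ i))
  refine (card_le_card this).trans ?_
  simp only [Fintype.card_piFinset, card_range, prod_const, card_univ, Fintype.card_fin]
  rw [← prod_pow_eq_pow_sum]
  refine prod_le_prod' fun k _ => ?_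
  rw [pow_right_comm]
  exact Nat.pow_le_pow_left Nat.lt_two_pow_self n
open Classical in
theorem aux (D : SD K) (hn : 0 < n) (M : D.σ → Matrix (Fin n) (Fin n) K) {η : ℝ} (hη : 0 < η) : ∃ m : ℕ, 0 < m ∧ ∃ c : ℝ, 1 ≤ c ∧ ∀ d : Fin m → ℕ, (∀ k, 0 < d k) →
    ∃ P : MvPolynomial (Fin m × Fin n) K, P ≠ 0 ∧ P ∈ CR D.R ∧ MH d P ∧ ∀ s, nrm (D.v s) 1 P ≤ c ^ (∑ k, d k) ∧
      nrm (D.v s) 1 (aeval (lf (M s)) P) ≤ c ^ (∑ k, d k) ∧ ∀ α, coeff α (aeval (lf (M s)) P) ≠ 0 → Good η d fun k i => α (k, i) := by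
  obtain ⟨m, hm, hfew⟩ := few_bad hn hη (2 * Fintype.card D.σ)
  obtain ⟨c0, hc0, hc0', hc⟩ := common_den D (univ : Finset (D.σ × Fin n × Fin n)) fun x => M x.1 x.2.1 x.2.2
  obtain ⟨Cs, hCs, hsl⟩ := D.sl
  set M' : D.σ → Matrix (Fin n) (Fin n) K := fun s => c0 • M s with hM'
  set c1 : ℝ := 1 + (∑ x : D.σ × D.σ, ∑ i, ∑ j, D.v x.1 (M' x.2 i j)) + ∑ x : D.σ × D.σ, ∑ i, ∑ j, D.v x.1 (M x.2 i j) with hc1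
  have p1 : ∀ (N : D.σ → Matrix (Fin n) (Fin n) K) (x : D.σ × D.σ), 0 ≤ ∑ i, ∑ j, D.v x.1 (N x.2 i j) := fun N s => sum_nonneg fun i _ => sum_nonneg fun _ _ => (D.v s.1).nonneg _
  have b1 : ∀ (N : D.σ → Matrix (Fin n) (Fin n) K) s s', ∑ i, ∑ j, D.v s (N s' i j) ≤ ∑ x : D.σ × D.σ, ∑ i, ∑ j, D.v x.1 (N x.2 i j) := fun N s s' =>
    single_le_sum (f := fun x : D.σ × D.σ => ∑ i, ∑ j, D.v x.1 (N x.2 i j)) (fun s _ => p1 N s) (mem_univ (s, s'))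
  have b2 : ∀ N : D.σ → Matrix (Fin n) (Fin n) K, 0 ≤ ∑ x : D.σ × D.σ, ∑ i, ∑ j, D.v x.1 (N x.2 i j) := fun N => sum_nonneg fun s _ => p1 N s
  have hc1' : 1 ≤ c1 := by have := b2 M; have := b2 M'; linarith
  have hM'l : ∀ s s' (x : Fin m × Fin n), nrm (D.v s) 1 (lf (M' s') x) ≤ c1 := fun s s' x => (nrm_lf _ _ _).trans (by have := b1 M' s s'; have := b2 M; linarith)
  have hMl : ∀ s s' (x : Fin m × Fin n), nrm (D.v s) 1 (lf (M s') x) ≤ c1 := fun s s' x => (nrm_lf _ _ _).trans (by have := b1 M s s'; have := b2 M'; linarith)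
  refine ⟨m, hm, Cs * (2 ^ n) * (2 ^ n) * c1 * c1, ?_, fun d hd => ?_⟩
  · have : (1:ℝ) ≤ 2 ^ n := one_le_pow₀ (by norm_num)
    repeat refine one_le_mul_of_one_le_of_one_le ?_ (by assumption)
    exact hCs
  set Dd := ∑ k, d k with hDd
  have hD1 : 1 ≤ Dd := (hd ⟨0, hm⟩).trans_le (single_le_sum (f := d) (by simp) (mem_univ _))
  let A : D.σ × {e // e ∈ (Ex n d).filter fun e => ¬ Good η d e} → {e // e ∈ Ex n d} → K :=
    fun a b => coeff (fe a.2.1) (aeval (lf (M' a.1)) (monomial (fe b.1) (1:K)))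
  have hMHm : ∀ b : {e // e ∈ Ex n d}, ∀ k, ∑ i, fe b.1 (k, i) = d k := fun b k => mem_Ex.1 b.2 k
  obtain ⟨p, p0, pR, pA, pB⟩ := hsl _ _ A (c1 ^ Dd) (one_le_pow₀ hc1') (by
    intro a b
    refine mem_CR.1 ?_ _
    rw [aeval_monomial, map_one, one_mul]
    refine prod_mem fun x _ => pow_mem (sum_mem fun j _ => ?_) _
    rw [mem_CR]; intro α
    rw [C_mul_X_eq_monomial, coeff_monomial]
    split_ifs
    · exact hc (a.1, x.2, j) (mem_univ _)
    · exact D.O.zero_mem) (by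
    intro s a b
    have h1 := coeff_le_nrm (w := D.v s) (ρ := 1) (by simp) (aeval (lf (M' a.1)) (monomial (fe b.1) (1:K))) (fe a.2.1)
    have h2 := nrm_aeval (w := D.v s) (ρ := 1) (by simp) (lf (M' a.1)) (hM'l s a.1) (monomial (fe b.1) (1:K))
    rw [nrm_monomial, MH_tot (hMHm b)] at h2
    simp only [Pi.one_apply, one_pow, Finsupp.prod, prod_const_one, mul_one] at h1
    exact h1.trans (h2.trans (by simp [hDd]))) (by
    simp only [Fintype.card_coe, card_pos]
    refine ⟨fun k i => if i = ⟨0, hn⟩ then d k else 0, mem_Ex.2 fun k => by simp⟩) (by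
    have := hfew d hd
    simpa only [Fintype.card_prod, Fintype.card_coe, mul_assoc] using this)
  set P : MvPolynomial (Fin m × Fin n) K := ∑ b, monomial (fe b.1) (p b) with hP
  have fe_inj : ∀ b b' : {e // e ∈ Ex n d}, fe b.1 = fe b'.1 → b = b' := fun b b' h => by
    ext k i; exact DFunLike.congr_fun h (k, i)
  have hco : ∀ b : {e // e ∈ Ex n d}, coeff (fe b.1) P = p b := fun b => by
    rw [hP, coeff_sum, sum_eq_single b]
    · simp
    · intro b' _ hb; rw [coeff_monomial, if_neg fun h => hb (fe_inj _ _ h)]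
    · simp
  have hsup : ∀ α, coeff α P ≠ 0 → ∃ b : {e // e ∈ Ex n d}, fe b.1 = α := fun α ha => by
    by_contra! h
    refine ha ?_
    rw [hP, coeff_sum]
    exact sum_eq_zero fun b _ => by rw [coeff_monomial, if_neg (h b)]
  have hMHP : MH d P := fun α ha => by
    obtain ⟨b, rfl⟩ := hsup α ha
    exact hMHm b
  have hnP : ∀ s, nrm (D.v s) 1 P ≤ (Cs * (2 ^ n) * (2 ^ n) * c1) ^ Dd := fun s => by
    have hE : (Fintype.card {e // e ∈ Ex n d} : ℝ) ≤ (2 ^ n) ^ Dd := by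
      rw [Fintype.card_coe]; exact_mod_cast card_Ex d
    calc nrm (D.v s) 1 P ≤ ∑ b, nrm (D.v s) 1 (monomial (fe b.1) (p b)) := nrm_sum (by simp) _ _
      _ ≤ ∑ b : {e // e ∈ Ex n d}, Cs * Fintype.card {e // e ∈ Ex n d} * c1 ^ Dd := sum_le_sum fun b _ => by
          rw [nrm_monomial]; simpa using pB s b
      _ = Fintype.card {e // e ∈ Ex n d} * (Cs * Fintype.card {e // e ∈ Ex n d} * c1 ^ Dd) := by simp
      _ ≤ (2 ^ n) ^ Dd * (Cs ^ Dd * (2 ^ n) ^ Dd * c1 ^ Dd) := by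
          have : Cs ≤ Cs ^ Dd := le_self_pow₀ hCs (by omega)
          gcongr
      _ = _ := by rw [mul_pow, mul_pow, mul_pow]; ring
  have hbase : (1:ℝ) ≤ Cs * (2 ^ n) * (2 ^ n) * c1 := by
    have : (1:ℝ) ≤ 2 ^ n := one_le_pow₀ (by norm_num)
    repeat refine one_le_mul_of_one_le_of_one_le ?_ (by assumption)
    exact hCs
  refine ⟨P, fun h => p0 (funext fun b => by rw [← hco b, h]; simp), mem_CR.2 fun α => ?_, hMHP, fun s => ⟨(hnP s).trans ?_, ?_, fun α ha => ?_⟩⟩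
  · by_cases h : coeff α P = 0
    · rw [h]; exact D.R.zero_mem
    · obtain ⟨b, rfl⟩ := hsup α h
      rw [hco]; exact pR b
  · exact pow_le_pow_left₀ (by linarith) (le_mul_of_one_le_right (by linarith) hc1') _
  · refine (nrm_aeval (by simp) _ (hMl s s) P).trans ?_
    rw [hMHP.nrm, mul_pow _ c1]
    exact mul_le_mul_of_nonneg_right (hnP s) (by positivity)
  · by_contra hG
    have hα := hMHP.lf (M s) α ha
    have hb : (fun k i => α (k, i)) ∈ (Ex n d).filter fun e => ¬ Good η d e := mem_filter.2 ⟨mem_Ex.2 hα, hG⟩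
    have := pA (s, ⟨_, hb⟩)
    simp only [A, fe_self] at this
    have e1 : ∀ b : {e // e ∈ Ex n d}, aeval (lf (M' s)) (monomial (fe b.1) (1:K)) = C (c0 ^ Dd) * aeval (lf (M s)) (monomial (fe b.1) (1:K)) := fun b => by
      have : lf (m := m) (M' s) = fun x => C c0 * lf (M s) x := by
        funext x; simp [lf, hM', Finset.mul_sum, mul_assoc]
      rw [this, aeval_monomial, aeval_monomial, ← MH_tot (hMHm b) c0]
      simp only [mul_pow, prod_mul_distrib, map_one, one_mul, Finsupp.prod, map_prod, map_pow]
    refine ha (mul_left_cancel₀ (pow_ne_zero Dd hc0') ?_)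
    rw [mul_zero, ← this, hP, map_sum, coeff_sum, mul_sum]
    refine sum_congr rfl fun b _ => ?_
    have e2 : (monomial (fe b.1)) (p b) = C (p b) * monomial (fe b.1) (1:K) := by rw [C_mul_monomial, mul_one]
    rw [e1, coeff_C_mul, e2, map_mul, algHom_C, algebraMap_eq, coeff_C_mul]; ring
end Lau
end
end
section
open Filter Finset
open MvPolynomial
noncomputable section
namespace Lau
variable {K : Type} [Field K] {m n : ℕ} {D : SD K}
def Zs (V : Fin m → Fin n → Fin n → K) (x : Fin m × Fin n) : MvPolynomial (Fin m × Fin n) K := ∑ r, C (V x.1 r x.2) * X (x.1, r)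
lemma Zs_lf (f : (Fin n → K) →ₗ[K] (Fin n → K)) (V : Fin m → Fin n → Fin n → K) (x : Fin m × Fin n) :
    aeval (Zs V) (lf (LinearMap.toMatrix' f) x) = Zs (fun k r => f (V k r)) x := by
  simp only [lf, Zs, map_sum, map_mul, algHom_C, aeval_X, algebraMap_eq, Finset.mul_sum]
  rw [sum_comm]
  refine sum_congr rfl fun r _ => ?_
  simp_rw [← mul_assoc, ← map_mul, ← sum_mul, ← map_sum]
  congr 2
  conv_rhs => rw [← LinearMap.toMatrix'_mulVec f (V x.1 r)]
  rfl
lemma Zs_mem {R : Subring K} {V : Fin m → Fin n → Fin n → K} (hV : ∀ k r i, V k r i ∈ R) {P : MvPolynomial (Fin m × Fin n) K} (hP : P ∈ CR R) :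
    aeval (Zs V) P ∈ CR R := by
  rw [P.as_sum, map_sum]
  refine sum_mem fun e _ => ?_
  rw [aeval_monomial]
  refine mul_mem ?_ (prod_mem fun x _ => pow_mem (sum_mem fun r _ => ?_) _)
  · rw [mem_CR]; intro α
    rw [algebraMap_eq, coeff_C]; split_ifs
    · exact mem_CR.1 hP e
    · exact R.zero_mem
  · rw [mem_CR]; intro α
    rw [C_mul_X_eq_monomial, coeff_monomial]; split_ifs
    · exact hV _ _ _
    · exact R.zero_mem
lemma Zs_MH {d : Fin m → ℕ} {P : MvPolynomial (Fin m × Fin n) K} (h : MH d P) (V : Fin m → Fin n → Fin n → K) : MH d (aeval (Zs V) P) := by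
  rw [MH_iff] at h ⊢
  have : ∀ (r : ℝ) k x, Ge (fun x => r * bq n k x) (r * bq n k x) (Zs V x) := fun r k x => Ge.sum fun j _ =>
    ((Ge.C (q := fun x => r * bq n k x) (V x.1 j x.2)).mul (Ge.X (A := K) (fun x => r * bq n k x) (x.1, j))).mono (by simp [bq])
  exact fun k => ⟨(filGe _).aeval (h k).1 (this 1 k), (filGe _).aeval (h k).2 (this (-1) k)⟩
lemma good_sum {η D0 : ℝ} (h0 : 0 ≤ η) (hD0 : 0 ≤ D0) {d : Fin m → ℕ} (hd : ∀ k, 0 < d k) {x : Fin m → ℝ} (h1 : ∀ k, D0 ≤ d k * x k) (h2 : ∀ k, d k * x k ≤ (1 + η) * D0)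
    {e : Fin m → Fin n → ℕ} (he : ∀ k, ∑ i, e k i = d k) (hG : Good η d e) (a : Fin n → ℝ) :
    -∑ i, a i * ∑ k, x k * e k i ≤ -((∑ i, a i) * (D0 * m / n)) + 2 * η * D0 * m * ∑ i, |a i| := by
  have key : ∀ i, |∑ k, x k * e k i - D0 * m / n| ≤ 2 * η * D0 * m := by
    intro i
    have e1 : ∑ k, x k * e k i - D0 * m / n = ∑ k, (d k * x k - D0) * (e k i / d k) + D0 * (∑ k, (e k i : ℝ) / d k - m / n) := by
      rw [mul_sub, Finset.mul_sum, ← add_sub_assoc, ← sum_add_distrib]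
      congr 1
      · refine sum_congr rfl fun k _ => ?_
        have : (d k : ℝ) ≠ 0 := by exact_mod_cast (hd k).ne'
        field_simp; ring
      · ring
    have e2 : |∑ k, (d k * x k - D0) * (e k i / d k : ℝ)| ≤ ∑ k : Fin m, η * D0 := by
      refine (abs_sum_le_sum_abs _ _).trans (sum_le_sum fun k _ => ?_)
      have hk : (0:ℝ) < d k := by exact_mod_cast hd k
      have : (e k i : ℝ) ≤ d k := by rw [← he k]; exact_mod_cast single_le_sum (f := e k) (by simp) (mem_univ i)
      rw [abs_mul, abs_of_nonneg (by linarith [h1 k]), abs_of_nonneg (by positivity)]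
      calc (d k * x k - D0) * (e k i / d k : ℝ) ≤ (η * D0) * 1 := mul_le_mul (by linarith [h2 k]) ((div_le_one hk).2 this) (by positivity) (by positivity)
        _ = _ := mul_one _
    have e3 : |D0 * (∑ k, (e k i : ℝ) / d k - m / n)| ≤ D0 * (η * m) := by
      rw [abs_mul, abs_of_nonneg hD0]; exact mul_le_mul_of_nonneg_left (hG i) hD0
    rw [e1]
    refine (abs_add_le _ _).trans ((add_le_add e2 e3).trans (le_of_eq ?_))
    simp; ring
  have : -∑ i, a i * ∑ k, x k * e k i = -((∑ i, a i) * (D0 * m / n)) + ∑ i, -(a i * (∑ k, x k * e k i - D0 * m / n)) := by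
    rw [sum_mul, sum_neg_distrib, ← neg_add, ← sum_add_distrib]
    congr 1; exact sum_congr rfl fun i _ => by ring
  rw [this, Finset.mul_sum]
  gcongr with i
  refine (neg_le_abs _).trans ?_
  rw [abs_mul, mul_comm]
  exact mul_le_mul_of_nonneg_right (key i) (abs_nonneg _)
lemma van_loc (hn : 0 < n) (L : D.GL n) (c : D.σ → Fin n → ℝ) (s : D.σ) {P : MvPolynomial (Fin m × Fin n) K} {d : Fin m → ℕ} (hP : MH d P)
    {η D0 C0 : ℝ} (h0 : 0 ≤ η) (hD0 : 0 ≤ D0) (hd : ∀ k, 0 < d k) {x : Fin m → ℝ} (h1 : ∀ k, D0 ≤ d k * x k) (h2 : ∀ k, d k * x k ≤ (1 + η) * D0)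
    (hG : nrm (D.v s) 1 (aeval (lf (LinearMap.toMatrix' ((L s).symm : (Fin n → K) →ₗ[K] _))) P) ≤ C0 ^ (∑ k, d k))
    (hgood : ∀ α, coeff α (aeval (lf (LinearMap.toMatrix' ((L s).symm : (Fin n → K) →ₗ[K] _))) P) ≠ 0 → Good η d fun k i => α (k, i))
    {V : Fin m → Fin n → Fin n → K} (hV : ∀ k r, V k r ≠ 0) (α : Fin m × Fin n →₀ ℕ) :
    D.v s (coeff α (aeval (Zs V) P)) ≤ (n * C0) ^ (∑ k, d k) * Real.exp (-((∑ i, c s i) * (D0 * m / n)) + 2 * η * D0 * m * ∑ i, |c s i|) *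
      ∏ y : Fin m × Fin n, D.Nv L c (x y.1) s (V y.1 y.2) ^ α y := by
  set G := aeval (lf (LinearMap.toMatrix' ((L s).symm : (Fin n → K) →ₗ[K] _))) P with hGdef
  have hGM : MH d G := hP.lf _
  have hPG : aeval (Zs V) P = aeval (Zs fun k r => L s (V k r)) G := by
    have : P = aeval (lf (LinearMap.toMatrix' (L s : (Fin n → K) →ₗ[K] _))) G := by
      rw [hGdef, lf_lf]
      rw [← LinearMap.toMatrix'_comp]; simp
    conv_lhs => rw [this, comp_aeval_apply]
    simp_rw [Zs_lf]; rfl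
  set ρ : Fin m × Fin n → ℝ := fun y => (D.Nv L c (x y.1) s (V y.1 y.2))⁻¹ with hρ
  have hNpos : ∀ y : Fin m × Fin n, 0 < D.Nv L c (x y.1) s (V y.1 y.2) := fun y => Nv_pos s (hV _ _)
  have hρ0 : ∀ y, 0 ≤ ρ y := fun y => inv_nonneg.2 (hNpos y).le
  have hY : ∀ y : Fin m × Fin n, nrm (D.v s) ρ (Zs (fun k r => L s (V k r)) y) ≤ n * Real.exp (-(c s y.2 * x y.1)) := by
    intro y
    refine (nrm_sum hρ0 _ _).trans ?_
    have : ∀ r : Fin n, nrm (D.v s) ρ (C (L s (V y.1 r) y.2) * X (y.1, r)) ≤ Real.exp (-(c s y.2 * x y.1)) := by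
      intro r
      rw [C_mul_X_eq_monomial, nrm_monomial, Finsupp.prod_single_index (by simp), pow_one, ← div_eq_mul_inv, div_le_iff₀ (hNpos (y.1, r)),
        Real.exp_neg, inv_mul_eq_div, le_div_iff₀ (Real.exp_pos _), mul_comm]
      exact single_le_sum (f := fun i => Real.exp (c s i * x y.1) * D.v s (L s (V y.1 r) i)) (fun i _ => mul_nonneg (Real.exp_pos _).le ((D.v s).nonneg _)) (mem_univ y.2)
    refine (sum_le_sum fun r _ => this r).trans (le_of_eq ?_)
    simp
  have hN := coeff_le_nrm (w := D.v s) hρ0 (aeval (Zs fun k r => L s (V k r)) G) α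
  rw [← hPG] at hN
  replace hN := hN.trans ((le_of_eq (by rw [hPG])).trans (nrm_aeval hρ0 _ hY G))
  have hB : nrm (D.v s) (fun y : Fin m × Fin n => n * Real.exp (-(c s y.2 * x y.1))) G ≤ (n * C0) ^ (∑ k, d k) * Real.exp (-((∑ i, c s i) * (D0 * m / n)) + 2 * η * D0 * m * ∑ i, |c s i|) := by
    set E := Real.exp (-((∑ i, c s i) * (D0 * m / n)) + 2 * η * D0 * m * ∑ i, |c s i|)
    have : ∀ e ∈ G.support, (e.prod fun y i => (n * Real.exp (-(c s y.2 * x y.1)) : ℝ) ^ i) ≤ (n:ℝ) ^ (∑ k, d k) * E := by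
      intro e he
      have hee := hGM e (mem_support_iff.1 he)
      simp_rw [mul_pow, Finsupp.prod, prod_mul_distrib]
      rw [← Finsupp.prod, MH_tot hee, ← Finsupp.prod, Finsupp.prod_fintype _ _ (by simp)]
      refine mul_le_mul_of_nonneg_left ?_ (by positivity)
      simp_rw [← Real.exp_nat_mul]
      rw [← Real.exp_sum]
      refine Real.exp_le_exp.2 (le_trans (le_of_eq ?_) (good_sum h0 hD0 hd h1 h2 (e := fun k i => e (k, i)) hee (hgood e (mem_support_iff.1 he)) (c s)))
      rw [Fintype.sum_prod_type_right, ← sum_neg_distrib]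
      refine sum_congr rfl fun i _ => ?_
      rw [Finset.mul_sum, ← sum_neg_distrib]
      exact sum_congr rfl fun k _ => by ring
    calc _ ≤ ∑ e ∈ G.support, D.v s (coeff e G) * ((n:ℝ) ^ (∑ k, d k) * E) := sum_le_sum fun e he => mul_le_mul_of_nonneg_left (this e he) ((D.v s).nonneg _)
      _ = nrm (D.v s) 1 G * ((n:ℝ) ^ (∑ k, d k) * E) := by rw [nrm_one, sum_mul]
      _ ≤ C0 ^ (∑ k, d k) * ((n:ℝ) ^ (∑ k, d k) * E) := mul_le_mul_of_nonneg_right hG (by positivity)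
      _ = _ := by rw [mul_pow]; ring
  have hN2 := hN.trans hB
  rw [Finsupp.prod_fintype _ _ (by simp)] at hN2
  simp only [hρ, inv_pow, prod_inv_distrib] at hN2
  rwa [← div_eq_mul_inv, div_le_iff₀ (prod_pos fun y _ => pow_pos (hNpos y) _)] at hN2
lemma van (hn : 0 < n) (L : D.GL n) (c : D.σ → Fin n → ℝ) {P : MvPolynomial (Fin m × Fin n) K} {d : Fin m → ℕ} (hP : MH d P) (hPR : P ∈ CR D.R)
    {η D0 C0 : ℝ} (h0 : 0 ≤ η) (h01 : η ≤ 1) (hD0 : 0 ≤ D0) (hC0 : 1 ≤ C0) (hd : ∀ k, 0 < d k) {x : Fin m → ℝ} (h1 : ∀ k, D0 ≤ d k * x k) (h2 : ∀ k, d k * x k ≤ (1 + η) * D0)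
    (hG : ∀ s, nrm (D.v s) 1 (aeval (lf (LinearMap.toMatrix' ((L s).symm : (Fin n → K) →ₗ[K] _))) P) ≤ C0 ^ (∑ k, d k))
    (hgood : ∀ s α, coeff α (aeval (lf (LinearMap.toMatrix' ((L s).symm : (Fin n → K) →ₗ[K] _))) P) ≠ 0 → Good η d fun k i => α (k, i))
    {V : Fin m → Fin n → Fin n → K} (hV : ∀ k r, V k r ≠ 0) (hVR : ∀ k r i, V k r i ∈ D.R) (r0 : Fin n) {Λ ε θ : ℝ} (hΛ : 0 ≤ Λ) (hε : 0 ≤ ε)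
    (hH0 : ∀ k, D.H L c (x k) (V k r0) ≤ Real.exp (Λ * x k)) (hH : ∀ k r, r ≠ r0 → D.H L c (x k) (V k r) ≤ Real.exp (ε * x k))
    (hfin : Fintype.card D.σ * ((∑ k, d k : ℕ) * Real.log (n * C0)) + D0 * m * (2 * η * (∑ s, ∑ i, |c s i|) + 2 * Λ * θ + 2 * ε - (∑ s, ∑ i, c s i) / n) < 0)
    (α : Fin m × Fin n →₀ ℕ) (hα : coeff α (aeval (Zs V) P) ≠ 0) : θ * m ≤ ∑ k, (α (k, r0) : ℝ) / d k := by
  by_contra! hlt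
  have hge := D.prod_ge _ (mem_CR.1 (Zs_mem hVR hPR) α) hα
  have hαd := Zs_MH hP V α hα
  have hloc := prod_le_prod (s := univ) (fun s _ => (D.v s).nonneg _) fun s _ => van_loc hn L c s hP h0 hD0 hd h1 h2 (hG s) (hgood s) hV α
  rw [prod_mul_distrib, prod_mul_distrib, Finset.prod_comm (s := univ) (t := univ), prod_const, card_univ, ← Real.exp_sum] at hloc
  simp_rw [prod_pow] at hloc
  have hHp : ∏ y : Fin m × Fin n, (∏ s, D.Nv L c (x y.1) s (V y.1 y.2)) ^ α y ≤ Real.exp (2 * D0 * m * (Λ * θ + ε)) := by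
    have : ∀ y : Fin m × Fin n, (∏ s, D.Nv L c (x y.1) s (V y.1 y.2)) ^ α y ≤ Real.exp (α y * (((if y.2 = r0 then Λ else 0) + ε) * x y.1)) := by
      intro y
      have hx : 0 ≤ x y.1 := by
        have : 0 ≤ d y.1 * x y.1 := hD0.trans (h1 _)
        exact nonneg_of_mul_nonneg_right this (by exact_mod_cast hd _)
      rw [Real.exp_nat_mul]
      refine pow_le_pow_left₀ (H_nonneg (L := L) (c := c) _) ?_ _
      split_ifs with hy
      · rw [hy]; exact (hH0 _).trans (Real.exp_le_exp.2 (by nlinarith))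
      · rw [zero_add]; exact hH _ _ hy
    refine (prod_le_prod (fun y _ => pow_nonneg (H_nonneg (L := L) (c := c) _) _) fun y _ => this y).trans ?_
    rw [← Real.exp_sum, Fintype.sum_prod_type]
    refine Real.exp_le_exp.2 ?_
    have hk : ∀ k, ∑ r, (α (k, r) : ℝ) * (((if r = r0 then Λ else 0) + ε) * x k) ≤ 2 * D0 * (Λ * (α (k, r0) / d k) + ε) := by
      intro k
      have hdk : (0:ℝ) < d k := by exact_mod_cast hd k
      have e1 : ∑ r, (α (k, r) : ℝ) * (((if r = r0 then Λ else 0) + ε) * x k) = (d k * x k) * (Λ * (α (k, r0) / d k) + ε) := by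
        have : (∑ r, (α (k, r) : ℝ)) = d k := by exact_mod_cast hαd k
        have e2 : ∀ r, (α (k, r) : ℝ) * (((if r = r0 then Λ else 0) + ε) * x k) = (if r = r0 then α (k, r) * Λ * x k else 0) + α (k, r) * (ε * x k) := fun r => by split_ifs <;> ring
        simp_rw [e2]
        rw [sum_add_distrib, ← sum_mul, this]
        simp; field_simp
      rw [e1]
      refine mul_le_mul_of_nonneg_right ((h2 k).trans (by nlinarith)) (by positivity)
    refine (sum_le_sum fun k _ => hk k).trans ?_
    rw [← Finset.mul_sum, sum_add_distrib, ← Finset.mul_sum]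
    simp only [sum_const, card_univ, Fintype.card_fin, nsmul_eq_mul]
    have : Λ * ∑ k, (α (k, r0) : ℝ) / d k ≤ Λ * (θ * m) := mul_le_mul_of_nonneg_left hlt.le hΛ
    calc _ ≤ 2 * D0 * (Λ * (θ * m) + m * ε) := by gcongr
      _ = _ := by ring
  have hnC : 0 < (n * C0 : ℝ) := by have : (0:ℝ) < n := by exact_mod_cast hn
                                    positivity
  have hfinal := hge.trans (hloc.trans (mul_le_mul_of_nonneg_left hHp (by positivity)))
  rw [← Real.exp_log (pow_pos (pow_pos hnC _) _), ← Real.exp_add, ← Real.exp_add] at hfinal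
  rw [Real.one_le_exp_iff, Real.log_pow, Real.log_pow, sum_add_distrib, sum_neg_distrib, ← sum_mul, ← Finset.mul_sum] at hfinal
  refine absurd hfinal (not_le.2 (lt_of_eq_of_lt ?_ hfin))
  ring
end Lau
end
end
section
open Filter Finset
open MvPolynomial
noncomputable section
namespace Lau
variable {K : Type} [Field K] {m n : ℕ}
lemma Ge_nn {τ A : Type} [CommRing A] {q : τ → ℝ} (hq : ∀ x, 0 ≤ q x) (P : MvPolynomial τ A) : Ge q 0 P := fun _ _ =>
  sum_nonneg fun x _ => mul_nonneg (Nat.cast_nonneg _) (hq x)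
section
variable (j l : Fin n)
abbrev Oc (x : Fin m × Fin n) : Prop := x.2 ≠ j ∧ x.2 ≠ l
def qO (x : Fin m × Fin n) : ℝ := if Oc j l x then 1 else 0
def gg (F : Fin m → MvPolynomial (Fin m) K) (x : Fin m × Fin n) : MvPolynomial (Fin m × Fin n) (MvPolynomial (Fin m) K) :=
  C (if x.2 = j then F x.1 else 1) * (if Oc j l x then X x else 1)
def aj (α : Fin m × Fin n →₀ ℕ) : Fin m →₀ ℕ := Finsupp.equivFunOnFinite.symm fun k => α (k, j)
def aO (α : Fin m × Fin n →₀ ℕ) : Fin m × Fin n →₀ ℕ := α.filter (Oc j l)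
variable {j l}
lemma g1_monomial (α : Fin m × Fin n →₀ ℕ) (c : K) : aeval (gg j l X) (monomial α c) = monomial (aO j l α) (monomial (aj j α) c) := by
  rw [aeval_monomial, Finsupp.prod_fintype _ _ (by simp), monomial_eq (s := aO j l α), monomial_eq (s := aj j α), Finsupp.prod_fintype _ _ (by simp), Finsupp.prod_fintype _ _ (by simp)]
  simp only [gg, mul_pow, prod_mul_distrib]
  rw [map_mul, ← mul_assoc]
  congr 1
  · congr 1
    rw [Fintype.prod_prod_type, map_prod]
    refine prod_congr rfl fun k _ => ?_
    rw [prod_eq_single j]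
    · simp [aj]
    · intro i _ hi; simp [hi]
    · simp
  · refine prod_congr rfl fun x _ => ?_
    by_cases h : Oc j l x
    · rw [if_pos h, aO, Finsupp.filter_apply_pos _ _ h]
    · rw [if_neg h, aO, Finsupp.filter_apply_neg _ _ h]; simp
lemma aj_inj (hjl : j ≠ l) {d : Fin m → ℕ} {α β : Fin m × Fin n →₀ ℕ} (h1 : ∀ k, ∑ i, α (k, i) = d k) (h2 : ∀ k, ∑ i, β (k, i) = d k)
    (hO : aO j l α = aO j l β) (hj : aj j α = aj j β) : α = β := by
  have e1 : ∀ k i, i ≠ l → α (k, i) = β (k, i) := by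
    intro k i hi
    by_cases h : i = j
    · subst h; exact DFunLike.congr_fun hj k
    · have := DFunLike.congr_fun hO (k, i)
      rwa [aO, aO, Finsupp.filter_apply_pos _ _ ⟨h, hi⟩, Finsupp.filter_apply_pos _ _ ⟨h, hi⟩] at this
  ext ⟨k, i⟩
  by_cases hi : i = l
  · subst hi
    have a1 := h1 k
    have a2 := h2 k
    rw [← add_sum_erase _ _ (mem_univ i)] at a1 a2
    rw [sum_congr rfl fun i' hi' => e1 k i' (ne_of_mem_erase hi')] at a1
    omega
  · exact e1 k i hi
lemma qO_nn (x : Fin m × Fin n) : 0 ≤ qO j l x := by unfold qO; split_ifs <;> norm_num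
lemma gg_Ge (F : Fin m → MvPolynomial (Fin m) K) (x : Fin m × Fin n) : Ge (qO j l) (qO j l x) (gg (K := K) j l F x) := by
  by_cases h : Oc j l x
  · have := (Ge.C (q := qO j l) (if x.2 = j then F x.1 else 1)).mul (Ge.X (A := MvPolynomial (Fin m) K) (qO j l) x)
    rw [zero_add] at this
    rwa [gg, if_pos h]
  · have : qO j l x = 0 := if_neg h
    rw [this]; exact Ge_nn qO_nn _
end
lemma dec {S : Type} [CommRing S] [Algebra K S] {j l r0 : Fin n} (hjl : j ≠ l) (ℓ : Fin n → K) (V : Fin n → Fin n → K) (hV0 : V r0 = Pi.single j 1)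
    (a : ∀ i, i ≠ j → Fin n → K) (ha : ∀ i hi i', (Pi.single i 1 - (ℓ i / ℓ j) • Pi.single j 1 : Fin n → K) i' = ∑ r, a i hi r * V r i') (x : S) (z : Fin n → S) (i' : Fin n) :
    ∑ r, algebraMap K S (V r i') * ((if r = r0 then x else 0) + ∑ i : {i // i ≠ j}, (if i.1 = l then 1 else z i.1) * algebraMap K S (a i.1 i.2 r)) =
      if i' = j then x - algebraMap K S (ℓ l / ℓ j) - ∑ i ∈ univ.filter (fun i => i ≠ j ∧ i ≠ l), algebraMap K S (ℓ i / ℓ j) * z i else if i' = l then 1 else z i' := by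
  have e1 : ∑ r, algebraMap K S (V r i') * ((if r = r0 then x else 0) + ∑ i : {i // i ≠ j}, (if i.1 = l then 1 else z i.1) * algebraMap K S (a i.1 i.2 r)) =
      x * algebraMap K S ((Pi.single j 1 : Fin n → K) i') + ∑ i ∈ univ.filter (fun i => i ≠ j),
          (if i = l then 1 else z i) * algebraMap K S ((Pi.single i 1 - (ℓ i / ℓ j) • Pi.single j 1 : Fin n → K) i') := by
    rw [sum_subtype (p := fun i => i ≠ j) (univ.filter (fun i => i ≠ j)) (by simp)]
    simp_rw [mul_add, sum_add_distrib]
    congr 1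
    · simp [hV0, mul_comm]
    · simp_rw [Finset.mul_sum]
      rw [sum_comm]
      refine sum_congr rfl fun i _ => ?_
      rw [ha i.1 i.2, map_sum, Finset.mul_sum]
      exact sum_congr rfl fun r _ => by rw [map_mul]; ring
  rw [e1]
  by_cases h : i' = j
  · subst h
    have e2 : univ.filter (fun i => i ≠ i') = insert l (univ.filter fun i => i ≠ i' ∧ i ≠ l) := by
      ext i; simp only [mem_filter, mem_univ, true_and, mem_insert]; have := hjl.symm; constructor
      · intro hi; by_cases hl : i = l <;> simp [hl, hi]
      · rintro (rfl | hi) <;> simp_all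
    have e3 : ∀ i ∈ univ.filter (fun i => i ≠ i' ∧ i ≠ l), (if i = l then 1 else z i) * algebraMap K S ((Pi.single i 1 - (ℓ i / ℓ i') • Pi.single i' 1 : Fin n → K) i') =
        -(algebraMap K S (ℓ i / ℓ i') * z i) := fun i hi => by
      obtain ⟨h1, h2⟩ := (mem_filter.1 hi).2
      simp only [Pi.sub_apply, Pi.smul_apply, Pi.single_eq_same, Pi.single_eq_of_ne (Ne.symm h1), if_neg h2, zero_sub, smul_eq_mul, mul_one, map_neg]
      ring
    rw [e2, sum_insert (by simp), sum_congr rfl e3, sum_neg_distrib]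
    simp only [Pi.sub_apply, Pi.smul_apply, Pi.single_eq_same, Pi.single_eq_of_ne hjl, if_true, zero_sub, smul_eq_mul, mul_one, map_neg, map_one]
    ring
  · rw [sum_eq_single i']
    · simp [h]
    · intro i _ hi; simp [Ne.symm hi, h]
    · simp [h]
theorem alg {d : Fin m → ℕ} {P : MvPolynomial (Fin m × Fin n) K} (hP0 : P ≠ 0) (hP : MH d P) {R : Subring K} (hPR : P ∈ CR R)
    {j l r0 : Fin n} (hjl : j ≠ l) (ℓ : Fin m → Fin n → K) (hℓ : ∀ k, ℓ k j ≠ 0) (V : Fin m → Fin n → Fin n → K) (hV0 : ∀ k, V k r0 = Pi.single j 1)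
    (hsp : ∀ k i, i ≠ j → ∃ a : Fin n → K, a r0 = 0 ∧ ∀ i', (Pi.single i 1 - (ℓ k i / ℓ k j) • Pi.single j 1 : Fin n → K) i' = ∑ r, a r * V k r i')
    {θ : ℝ} (hidx : ∀ α, coeff α (aeval (Zs V) P) ≠ 0 → θ ≤ ∑ k, (α (k, r0) : ℝ) / d k) :
    ∃ Q : MvPolynomial (Fin m) K, Q ≠ 0 ∧ Q ∈ CR R ∧ (∀ α, coeff α Q ≠ 0 → ∀ k, α k ≤ d k) ∧ (∀ w : AbsoluteValue K ℝ, nrm w 1 Q ≤ nrm w 1 P) ∧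
      Ge (fun k => (d k : ℝ)⁻¹) θ (shift (fun k => -(ℓ k l / ℓ k j)) Q) := by
  classical
  set ξ : Fin m → K := fun k => -(ℓ k l / ℓ k j) with hξ
  choose a ha0 ha using hsp
  obtain ⟨α0, hα0, hmin⟩ := exists_min_image P.support (fun α => α.sum fun x i => (i:ℝ) * qO j l x) (support_nonempty.2 hP0)
  set β0 := aO j l α0 with hβ0
  set Nn := α0.sum fun x i => (i:ℝ) * qO j l x with hNn
  have hβN : (β0.sum fun x i => (i:ℝ) * qO j l x) = Nn := by
    rw [hNn, Finsupp.sum_fintype _ _ (by simp), Finsupp.sum_fintype _ _ (by simp)]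
    refine sum_congr rfl fun x _ => ?_
    by_cases h : Oc j l x
    · rw [hβ0, aO, Finsupp.filter_apply_pos _ _ h]
    · simp [qO, h]
  have hPO : Ge (qO j l) Nn P := fun α h => hmin α (mem_support_iff.2 h)
  set g2 : Fin m × Fin n → MvPolynomial (Fin m × Fin n) (MvPolynomial (Fin m) K) := gg j l (fun k => (X k + C (ξ k) : MvPolynomial (Fin m) K)) with hg2
  set y : Fin m → MvPolynomial (Fin m × Fin n) (MvPolynomial (Fin m) K) := fun k => ∑ i ∈ univ.filter (fun i => i ≠ j ∧ i ≠ l), C (C (ℓ k i / ℓ k j)) * X (k, i) with hy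
  set gφ : Fin m × Fin n → MvPolynomial (Fin m × Fin n) (MvPolynomial (Fin m) K) := fun x => g2 x - if x.2 = j then y x.1 else 0 with hgφ
  set Q := coeff β0 (aeval (gg (K := K) j l X) P) with hQ
  have hy1 : ∀ k, Ge (qO j l) 1 (y k) := fun k => Ge.sum fun i hi => by
    have := (Ge.C (q := qO j l) (C (ℓ k i / ℓ k j) : MvPolynomial (Fin m) K)).mul (Ge.X (A := MvPolynomial (Fin m) K) (qO j l) (k, i))
    refine this.mono (le_of_eq ?_)
    have := (mem_filter.1 hi).2
    simp [qO, this]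
  have hsub : ∀ x, Ge (qO j l) (qO j l x + 1) (gφ x - g2 x) := by
    intro x
    simp only [hgφ, sub_sub_cancel_left]
    split_ifs with h
    · have : qO j l x = 0 := by simp [qO, h]
      rw [this, zero_add]
      exact fun α hα => hy1 x.1 α fun h => hα (by simp [h])
    · simpa using Ge.zero
  have hgφG : ∀ x, Ge (qO j l) (qO j l x) (gφ x) := fun x => by
    have := (gg_Ge (fun k => X k + C (ξ k)) x).add ((hsub x).mono (by linarith))
    rwa [add_sub_cancel] at this
  have hdiff := (filGe (K := K) (A := MvPolynomial (Fin m) K) (qO j l)).aeval_sub hPO hgφG (gg_Ge _) hsub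
  have hco : coeff β0 (aeval gφ P) = coeff β0 (aeval g2 P) := by
    by_contra h
    have := hdiff β0 (by rw [coeff_sub]; exact sub_ne_zero.2 h)
    rw [hβN] at this; linarith
  have hshift : coeff β0 (aeval g2 P) = shift ξ Q := by
    have : aeval g2 P = mapAlgHom (shift ξ) (aeval (gg (K := K) j l X) P) := by
      rw [comp_aeval_apply]
      congr 2; funext x
      simp only [hg2, gg, map_mul, mapAlgHom_apply, map_C]
      congr 1
      · split_ifs <;> simp [shift]
      · split_ifs <;> simp
    rw [this, mapAlgHom_apply, coeff_map]; rfl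
  have hQs : Q = ∑ α ∈ P.support.filter (fun α => aO j l α = β0), monomial (aj j α) (coeff α P) := by
    rw [hQ]
    conv_lhs => rw [P.as_sum, map_sum, coeff_sum]
    rw [sum_filter]
    refine sum_congr rfl fun α _ => ?_
    rw [g1_monomial, coeff_monomial]
  have hMHs : ∀ α ∈ P.support, ∀ k, ∑ i, α (k, i) = d k := fun α h => hP α (mem_support_iff.1 h)
  refine ⟨Q, fun h0 => ?_, ?_, fun γ hγ k => ?_, fun w => ?_, ?_⟩
  · have : coeff (aj j α0) Q = coeff α0 P := by
      rw [hQs, coeff_sum, sum_eq_single α0]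
      · simp
      · intro α hα hne
        rw [mem_filter] at hα
        rw [coeff_monomial, if_neg fun h => hne (aj_inj hjl (hMHs α hα.1) (hMHs α0 hα0) hα.2 h)]
      · intro h; exact absurd (mem_filter.2 ⟨hα0, hβ0.symm⟩) h
    rw [h0, coeff_zero] at this
    exact mem_support_iff.1 hα0 this.symm
  · rw [hQs]
    refine sum_mem fun α _ => mem_CR.2 fun γ => ?_
    rw [coeff_monomial]; split_ifs
    · exact mem_CR.1 hPR _
    · exact R.zero_mem
  · rw [hQs, coeff_sum] at hγ
    obtain ⟨α, hα, hne⟩ := exists_ne_zero_of_sum_ne_zero hγ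
    rw [coeff_monomial] at hne
    have : aj j α = γ := by by_contra h; simp [h] at hne
    rw [← this, ← hMHs α (mem_filter.1 hα).1 k]
    exact single_le_sum (f := fun i => α (k, i)) (by simp) (mem_univ j)
  · rw [hQs]
    refine (nrm_sum (by simp) _ _).trans ?_
    rw [nrm_one w P]
    refine (sum_le_sum fun α _ => ?_).trans (sum_le_sum_of_subset_of_nonneg (filter_subset _ _) fun _ _ _ => w.nonneg _)
    rw [nrm_monomial]; simp
  · rw [← hshift, ← hco]
    set W : Fin m × Fin n → MvPolynomial (Fin m × Fin n) (MvPolynomial (Fin m) K) := fun x =>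
      (if x.2 = r0 then C (X x.1) else 0) + ∑ i : {i // i ≠ j}, (if i.1 = l then 1 else X (x.1, i.1)) * C (C (a x.1 i.1 i.2 x.2)) with hW
    have hdec : aeval gφ P = aeval W (aeval (Zs V) P) := by
      rw [comp_aeval_apply]
      congr 2; funext ⟨k, i'⟩
      have := dec (S := MvPolynomial (Fin m × Fin n) (MvPolynomial (Fin m) K)) hjl (ℓ k) (V k) (hV0 k) (a k) (ha k) (C (X k)) (fun i => X (k, i)) i'
      rw [Zs, map_sum]
      simp_rw [map_mul, algHom_C, aeval_X]
      rw [hW]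
      refine Eq.trans ?_ this.symm
      simp only [hgφ, hg2, gg, hy, hξ]
      by_cases h : i' = j
      · subst h; simp [sub_eq_add_neg, MvPolynomial.algebraMap_apply]
      · by_cases hl : i' = l <;> simp [h, hl, Oc, Ne.symm hjl]
    rw [hdec]
    set q : Fin m × Fin n → ℝ := fun x => if x.2 = r0 then (d x.1 : ℝ)⁻¹ else 0 with hq
    have hge : Ge q θ (aeval (Zs V) P) := by
      intro α hα
      rw [Finsupp.sum_fintype _ _ (by simp), Fintype.sum_prod_type]
      refine (hidx α hα).trans (le_of_eq (sum_congr rfl fun k _ => ?_))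
      simp [hq, div_eq_mul_inv]
    refine (filGB (K := K) (τ := Fin m × Fin n) fun k => (d k : ℝ)⁻¹).aeval hge (fun x β => ?_) β0
    by_cases hx : x.2 = r0
    · simp only [hq, hW, if_pos hx]
      have : ∀ i : {i // i ≠ j}, a x.1 i.1 i.2 x.2 = 0 := fun i => by rw [hx]; exact ha0 _ _ _
      simp only [this, map_zero, mul_zero, sum_const_zero, add_zero, coeff_C]
      split_ifs
      · exact Ge.X _ _
      · exact Ge.zero
    · simp only [hq, if_neg hx]
      exact Ge_nn (fun k => by positivity) _
end Lau
end
end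
section
open Filter Finset
open MvPolynomial
noncomputable section
namespace Lau
variable {K : Type} [Field K] {m p : ℕ}
def lam (b : Fin p → Fin (p+1) → K) (i : Fin (p+1)) : K := (-1) ^ (i:ℕ) * ((Matrix.of b).submatrix id i.succAbove).det
lemma lam_eq (b : Fin p → Fin (p+1) → K) (z : Fin (p+1) → K) : ∑ i, lam b i * z i = (Matrix.of (Fin.cons z b : Fin (p+1) → Fin (p+1) → K)).det := by
  rw [Matrix.det_succ_row_zero]
  refine sum_congr rfl fun i _ => ?_
  have : (Matrix.of (Fin.cons z b : Fin (p+1) → Fin (p+1) → K)).submatrix Fin.succ i.succAbove = (Matrix.of b).submatrix id i.succAbove := by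
    ext a c; simp
  rw [this]; simp [lam]; ring
lemma lam_mem {R : Subring K} {b : Fin p → Fin (p+1) → K} (hb : ∀ j i, b j i ∈ R) (i) : lam b i ∈ R :=
  mul_mem (pow_mem (neg_mem R.one_mem) _) (det_mem _ fun _ _ => hb _ _)
lemma lam_span {b : Fin p → Fin (p+1) → K} (hb : LinearIndependent K b) {z : Fin (p+1) → K} (hz : ∑ i, lam b i * z i = 0) : z ∈ Submodule.span K (Set.range b) := by
  by_contra h
  have h2 : LinearIndependent K (Fin.cons z b : Fin (p+1) → Fin (p+1) → K) := linearIndependent_finCons.2 ⟨hb, h⟩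
  rw [lam_eq] at hz
  have := Matrix.linearIndependent_rows_iff_isUnit.1 (show LinearIndependent K (Matrix.of (Fin.cons z b : Fin (p+1) → Fin (p+1) → K)).row from h2)
  rw [Matrix.isUnit_iff_isUnit_det, hz] at this
  exact not_isUnit_zero this
lemma lam_ne {b : Fin p → Fin (p+1) → K} (hb : LinearIndependent K b) : ∃ i, lam b i ≠ 0 := by
  by_contra! h
  have : Submodule.span K (Set.range b) = ⊤ := by
    rw [eq_top_iff]; intro z _
    exact lam_span hb (by simp [h])
  have h2 := finrank_span_eq_card hb
  rw [this, finrank_top] at h2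
  simp at h2
lemma pick {T : Type} {𝒰 : Ultrafilter T} {h : T → ℝ} (hh : Tendsto h 𝒰 atTop) {G : T → Prop} (hG : ∀ᶠ t in 𝒰, G t) {ω : ℝ} (hω : 0 < ω) (m : ℕ) :
    ∃ t : Fin m → T, (∀ k, G (t k)) ∧ ∀ i k, i < k → 2 * h (t k) ≤ ω * h (t i) := by
  induction m with
  | zero => exact ⟨Fin.elim0, fun k => k.elim0, fun k => k.elim0⟩
  | succ m ih =>
    obtain ⟨t, h1, h2⟩ := ih
    have : ∀ᶠ t0 in 𝒰, G t0 ∧ ∀ k, 2 * h (t k) / ω ≤ h t0 := hG.and (eventually_all.2 fun k => hh.eventually_ge_atTop _)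
    obtain ⟨t0, g0, g1⟩ := this.exists
    refine ⟨Fin.cons t0 t, fun k => ?_, fun i k hik => ?_⟩
    · refine Fin.cases ?_ (fun k => ?_) k
      · exact g0
      · exact h1 k
    · obtain ⟨k, rfl⟩ := Fin.exists_succ_eq.2 (Fin.ne_zero_of_lt hik)
      rw [Fin.cons_succ]
      induction i using Fin.cases with
      | zero => rw [Fin.cons_zero]; have := g1 k; rwa [div_le_iff₀ hω, mul_comm (h t0)] at this
      | succ i => rw [Fin.cons_succ]; exact h2 i k (Fin.succ_lt_succ_iff.1 hik)
theorem large [CharZero K] (D : SD K) (L : D.GL (p+1)) (c : D.σ → Fin (p+1) → ℝ) {T : Type} {𝒰 : Ultrafilter T} {h : T → ℝ} (hh : Tendsto h 𝒰 atTop)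
    (b : T → Fin p → Fin (p+1) → K) (hint : ∀ᶠ t in 𝒰, ∀ j, D.Int (b t j)) (hind : ∀ᶠ t in 𝒰, LinearIndependent K (b t))
    (hel : ∀ j, EL 𝒰 h (fun t => D.H L c (h t) (b t j)) 0) (hg : 0 < ∑ s, ∑ i, c s i) {j l : Fin (p+1)} (hjl : j ≠ l) {ε0 : ℝ} (hε0 : 0 < ε0)
    (hht : ∀ᶠ t in 𝒰, lam (b t) j ≠ 0 ∧ ε0 * h t ≤ D.ht (-(lam (b t) l / lam (b t) j))) : False := by
  set g := ∑ s, ∑ i, c s i with hgdef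
  set cM := ∑ s, ∑ i, |c s i| with hcM
  have hcM0 : 0 ≤ cM := sum_nonneg fun s _ => sum_nonneg fun i _ => abs_nonneg _
  set n : ℝ := ((p + 1 : ℕ) : ℝ) with hn
  have hnp : 0 < n := by positivity
  obtain ⟨B, M, hup⟩ := upB L c (Pi.single j 1 : Fin (p+1) → K)
  set Λ := max (M + 1) 1 with hΛ
  have hΛ1 : 1 ≤ Λ := le_max_right _ _
  set η := min 1 (g / (16 * n * (cM + 1))) with hη
  have hη0 : 0 < η := lt_min one_pos (by positivity)
  have hη1 : η ≤ 1 := min_le_left _ _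
  have hηc : 2 * η * cM ≤ g / n / 8 := by
    have : η ≤ g / (16 * n * (cM + 1)) := min_le_right _ _
    have h2 : η * (cM + 1) ≤ g / n / 16 := by
      calc η * (cM + 1) ≤ g / (16 * n * (cM + 1)) * (cM + 1) := by gcongr
        _ = g / n / 16 := by field_simp
    nlinarith
  set ε := g / n / 16 with hε
  have hεp : 0 < ε := by positivity
  set θ := g / n / 16 / Λ with hθ
  have hθp : 0 < θ := by positivity
  have hθΛ : Λ * θ = g / n / 16 := by rw [hθ]; field_simp
  obtain ⟨m, hm, C0, hC0, haux⟩ := aux D (Nat.succ_pos p) (fun s => LinearMap.toMatrix' ((L s).symm : (Fin (p+1) → K) →ₗ[K] _)) hη0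
  have hmp : (0:ℝ) < m := by exact_mod_cast hm
  obtain ⟨ω, hω, hRL⟩ := RL D m (θ * m) (by positivity)
  set σc : ℝ := (Fintype.card D.σ : ℝ) with hσc
  set X0 : ℝ := max 1 (max (σc * Real.log (n * C0) * 2 / (g / n / 2)) ((σc * Real.log C0 + 1) * 2 * m / (ω * ε0))) with hX0
  have hG : ∀ᶠ t in 𝒰, (∀ j, D.Int (b t j)) ∧ LinearIndependent K (b t) ∧ (∀ j, D.H L c (h t) (b t j) ≤ Real.exp (ε * h t)) ∧
      (D.H L c (h t) (Pi.single j 1) ≤ Real.exp (Λ * h t)) ∧ (lam (b t) j ≠ 0 ∧ ε0 * h t ≤ D.ht (-(lam (b t) l / lam (b t) j))) ∧ X0 ≤ h t := by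
    refine hint.and (hind.and ((eventually_all.2 fun j => ?_).and (Eventually.and ?_ (hht.and (hh.eventually_ge_atTop X0)))))
    · have := hel j ε hεp; rwa [zero_add] at this
    · filter_upwards [hh.eventually_ge_atTop (max 0 B)] with t ht
      have h0 : 0 ≤ h t := (le_max_left _ _).trans ht
      refine (hup _ h0).trans ?_
      calc B * Real.exp (M * h t) ≤ Real.exp (h t) * Real.exp (M * h t) := by
            gcongr; exact (le_max_right 0 B).trans (ht.trans (by linarith [Real.add_one_le_exp (h t)]))
        _ = Real.exp ((M + 1) * h t) := by rw [← Real.exp_add]; ring_nf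
        _ ≤ _ := Real.exp_le_exp.2 (by gcongr; exact le_max_left _ _)
  obtain ⟨t, hGt, hsep⟩ := pick hh hG hω m
  have hX : ∀ k, X0 ≤ h (t k) := fun k => (hGt k).2.2.2.2.2
  have hX1 : 1 ≤ X0 := le_max_left _ _
  have hx : ∀ k, 0 < h (t k) := fun k => by linarith [hX k]
  set D0 := (∑ k, h (t k)) / η with hD0
  have hD0k : ∀ k, h (t k) ≤ η * D0 := fun k => by
    rw [hD0, mul_div_cancel₀ _ hη0.ne']
    exact single_le_sum (f := fun k => h (t k)) (fun k _ => (hx k).le) (mem_univ k)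
  have hD0p : 0 < D0 := pos_of_mul_pos_right ((hx ⟨0, hm⟩).trans_le (hD0k _)) hη0.le
  set d : Fin m → ℕ := fun k => ⌈D0 / h (t k)⌉₊ with hd
  have hd0 : ∀ k, 0 < d k := fun k => Nat.ceil_pos.2 (div_pos hD0p (hx k))
  have hd1 : ∀ k, D0 ≤ d k * h (t k) := fun k => by
    have := Nat.le_ceil (D0 / h (t k)); rwa [div_le_iff₀ (hx k)] at this
  have hd2 : ∀ k, d k * h (t k) ≤ (1 + η) * D0 := fun k => by
    have := (Nat.ceil_lt_add_one (div_pos hD0p (hx k)).le).le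
    have := mul_le_mul_of_nonneg_right this (hx k).le
    rw [add_mul, div_mul_cancel₀ _ (hx k).ne'] at this
    linarith [hD0k k]
  have hd3 : ∀ k, d k * h (t k) ≤ 2 * D0 := fun k => (hd2 k).trans (by nlinarith)
  have hdX : (∑ k, d k : ℕ) * X0 ≤ 2 * D0 * m := by
    push_cast
    rw [sum_mul]
    calc ∑ k, (d k : ℝ) * X0 ≤ ∑ k : Fin m, 2 * D0 := sum_le_sum fun k _ => (mul_le_mul_of_nonneg_left (hX k) (Nat.cast_nonneg _)).trans (hd3 k)
      _ = _ := by simp; ring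
  obtain ⟨P, hP0, hPR, hPM, hPs⟩ := haux d hd0
  set V : Fin m → Fin (p+1) → Fin (p+1) → K := fun k => Fin.cons (Pi.single j 1) (b (t k)) with hV
  have hVall : ∀ (Φ : Fin m → (Fin (p+1) → K) → Prop), (∀ k, Φ k (Pi.single j 1)) → (∀ k r, Φ k (b (t k) r)) → ∀ k r, Φ k (V k r) := by
    intro Φ h1 h2 k r
    induction r using Fin.cases with
    | zero => exact h1 k
    | succ r => exact h2 k r
  have hlogn : 0 ≤ Real.log (n * C0) := Real.log_nonneg (one_le_mul_of_one_le_of_one_le (by rw [hn]; exact_mod_cast Nat.succ_le_succ (Nat.zero_le p)) hC0)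
  have hlogC : 0 ≤ Real.log C0 := Real.log_nonneg hC0
  have hσ0 : 0 ≤ σc := Nat.cast_nonneg _
  have hvan := van (Nat.succ_pos p) L c hPM hPR hη0.le hη1 hD0p.le hC0 hd0 hd1 hd2 (fun s => (hPs s).2.1) (fun s => (hPs s).2.2) (V := V)
    (hVall (fun _ z => z ≠ 0) (fun k => by simp) fun k r => (hGt k).2.1.ne_zero r)
    (hVall (fun _ z => ∀ i, z i ∈ D.R) (fun k i => by rw [Pi.single_apply]; split_ifs; exacts [D.R.one_mem, D.R.zero_mem]) fun k r => (hGt k).1 r)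
    0 (Λ := Λ) (ε := ε) (θ := θ) (by linarith) hεp.le (fun k => (hGt k).2.2.2.1)
    (fun k r hr => by obtain ⟨r, rfl⟩ := Fin.exists_succ_eq.2 hr; exact (hGt k).2.2.1 r)
    (by
      have h1 : 2 * η * cM + 2 * Λ * θ + 2 * ε - g / n ≤ -(g / n / 2) - g / n / 8 := by rw [mul_assoc 2 Λ, hθΛ, hε]; linarith
      have h2 : σc * Real.log (n * C0) * 2 ≤ (g / n / 2) * X0 := by
        rw [mul_comm (g / n / 2), ← div_le_iff₀ (by positivity)]; exact (le_max_left _ _).trans (le_max_right _ _)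
      have h3 : σc * ((∑ k, d k : ℕ) * Real.log (n * C0)) ≤ D0 * m * (g / n / 2) := by
        have : (∑ k, d k : ℕ) * (σc * Real.log (n * C0) * 2) ≤ (∑ k, d k : ℕ) * ((g / n / 2) * X0) := mul_le_mul_of_nonneg_left h2 (Nat.cast_nonneg _)
        have h4 : (g / n / 2) * ((∑ k, d k : ℕ) * X0) ≤ (g / n / 2) * (2 * D0 * m) := mul_le_mul_of_nonneg_left hdX (by positivity)
        nlinarith
      have h5 := mul_le_mul_of_nonneg_left h1 (by positivity : 0 ≤ D0 * m)
      have h6 : 0 < D0 * m * (g / n / 8) := by positivity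
      linarith)
  obtain ⟨Q, hQ0, hQR, hQd, hQn, hQi⟩ := alg hP0 hPM hPR hjl (fun k => lam (b (t k))) (fun k => (hGt k).2.2.2.2.1.1) V (r0 := 0) (fun k => rfl) (by
    intro k i hi
    have hz : ∑ i', lam (b (t k)) i' * (Pi.single i 1 - (lam (b (t k)) i / lam (b (t k)) j) • Pi.single j 1 : Fin (p+1) → K) i' = 0 := by
      simp only [Pi.sub_apply, Pi.smul_apply, smul_eq_mul, mul_sub, sum_sub_distrib, Pi.single_apply, mul_ite, mul_one, mul_zero, sum_ite_eq', mem_univ, if_true]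
      simp [mul_div_cancel₀ _ (hGt k).2.2.2.2.1.1]
    obtain ⟨a, ha⟩ := Submodule.mem_span_range_iff_exists_fun K |>.1 (lam_span (hGt k).2.1 hz)
    refine ⟨Fin.cons 0 a, rfl, fun i' => ?_⟩
    rw [← ha, Fin.sum_univ_succ]
    simp [hV]) hvan
  refine hRL d (fun k => -(lam (b (t k)) l / lam (b (t k)) j)) Q hd0 (fun i k hik => ?_) hQ0 hQR hQd (fun k => ?_) hQi
  · have h1 := hsep i k hik
    have h2 : d i * (2 * h (t k)) ≤ ω * (d k * (2 * h (t k))) := by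
      calc d i * (2 * h (t k)) ≤ d i * (ω * h (t i)) := by gcongr
        _ = ω * (d i * h (t i)) := by ring
        _ ≤ ω * (2 * D0) := mul_le_mul_of_nonneg_left (hd3 i) hω.le
        _ ≤ ω * (d k * (2 * h (t k))) := mul_le_mul_of_nonneg_left (by linarith [hd1 k]) hω.le
    rw [← mul_assoc ω] at h2
    exact le_of_mul_le_mul_right h2 (by linarith [hx k])
  · have h1 : D.hQ Q ≤ σc * ((∑ k, d k : ℕ) * Real.log C0) := by
      unfold SD.hQ
      calc _ ≤ ∑ s : D.σ, (∑ k, d k : ℕ) * Real.log C0 := sum_le_sum fun s _ => by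
            rw [← Real.log_pow]
            exact Real.log_le_log (nrm_pos' _ hQ0) ((hQn _).trans (hPs s).1)
        _ = _ := by simp [hσc]
    have h2 : (σc * Real.log C0 + 1) * 2 * m ≤ (ω * ε0) * X0 := by
      rw [mul_comm (ω * ε0), ← div_le_iff₀ (by positivity)]; exact (le_max_right _ _).trans (le_max_right _ _)
    have h3 : ω * ε0 * D0 ≤ ω * d k * D.ht (-(lam (b (t k)) l / lam (b (t k)) j)) := by
      calc ω * ε0 * D0 ≤ ω * ε0 * (d k * h (t k)) := mul_le_mul_of_nonneg_left (hd1 k) (by positivity)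
        _ = ω * d k * (ε0 * h (t k)) := by ring
        _ ≤ _ := mul_le_mul_of_nonneg_left (hGt k).2.2.2.2.1.2 (by positivity)
    refine le_trans ?_ h3
    have h4 : (∑ k, (d k : ℝ)) * (σc * Real.log C0 + 1) * X0 ≤ (ω * ε0 * D0) * X0 := by
      push_cast at hdX
      calc _ = (σc * Real.log C0 + 1) * ((∑ k, (d k : ℝ)) * X0) := by ring
        _ ≤ (σc * Real.log C0 + 1) * (2 * D0 * m) := mul_le_mul_of_nonneg_left hdX (by positivity)
        _ = ((σc * Real.log C0 + 1) * 2 * m) * D0 := by ring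
        _ ≤ (ω * ε0 * X0) * D0 := mul_le_mul_of_nonneg_right h2 hD0p.le
        _ = _ := by ring
    have h5 := le_of_mul_le_mul_right h4 (by linarith)
    push_cast at h1 ⊢
    linarith
end Lau
end
end
section
open Filter Finset
noncomputable section
namespace Lau
variable {K : Type} [Field K] {D : SD K} {p : ℕ} {T : Type} {𝒰 : Ultrafilter T} {h : T → ℝ}
lemma ht_sum {α : Type*} (S : Finset α) (f : α → K) : D.ht (∑ k ∈ S, f k) ≤ D.ht 0 + ∑ k ∈ S, (D.ht (f k) + Real.log 2) := by
  classical
  induction S using Finset.induction_on with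
  | empty => simp
  | insert a S ha ih => rw [sum_insert ha, sum_insert ha]; linarith [D.ht_add (f a) (∑ k ∈ S, f k)]
lemma cons_bd (L : D.GL (p+1)) (c : D.σ → Fin (p+1) → ℝ) (x : ℝ) (s : D.σ) (b : Fin p → Fin (p+1) → K) (i : Fin (p+1)) :
    Real.exp (x * ∑ i, c s i) * (D.v s (∑ k, lam b k * (L s).symm (Pi.single i 1) k) * D.v s (LinearMap.det (L s : (Fin (p+1) → K) →ₗ[K] Fin (p+1) → K))) ≤ Real.exp (c s i * x) * ∏ r, D.Nv L c x s (b r) := by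
  rw [lam_eq, ← map_mul]
  have h1 : (Matrix.of (Fin.cons ((L s).symm (Pi.single i 1)) b : Fin (p+1) → Fin (p+1) → K)).det * LinearMap.det (L s : (Fin (p+1) → K) →ₗ[K] Fin (p+1) → K) =
      (Matrix.of fun r => L s ((Fin.cons ((L s).symm (Pi.single i 1)) b : Fin (p+1) → Fin (p+1) → K) r)).det := by
    rw [← LinearMap.det_toMatrix', mul_comm, ← Matrix.det_transpose (Matrix.of _), ← Matrix.det_mul, ← Matrix.det_transpose]
    congr 1; ext r k
    simp only [Matrix.transpose_apply, Matrix.mul_apply, Matrix.of_apply]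
    have := congrFun (LinearMap.toMatrix'_mulVec (L s : (Fin (p+1) → K) →ₗ[K] Fin (p+1) → K) ((Fin.cons ((L s).symm (Pi.single i 1)) b : Fin (p+1) → Fin (p+1) → K) r)) k
    simpa [Matrix.mulVec, dotProduct] using this
  rw [h1]
  have h2 := det_le_wt (D.v s) (Matrix.of fun r => L s ((Fin.cons ((L s).symm (Pi.single i 1)) b : Fin (p+1) → Fin (p+1) → K) r)) (fun i => Real.exp (c s i * x)) fun i => Real.exp_pos _
  rw [← Real.exp_sum, ← sum_mul, mul_comm _ x, Fin.prod_univ_succ] at h2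
  refine h2.trans (le_of_eq ?_)
  congr 1
  simp only [Matrix.of_apply, Fin.cons_zero, LinearEquiv.apply_symm_apply]
  rw [sum_eq_single i (fun k _ hk => by simp [Pi.single_eq_of_ne hk]) (by simp)]
  simp
theorem thmC [CharZero K] (L : D.GL (p+1)) (c : D.σ → Fin (p+1) → ℝ) (hh : Tendsto h 𝒰 atTop)
    (b : T → Fin p → Fin (p+1) → K) (hint : ∀ᶠ t in 𝒰, ∀ j, D.Int (b t j)) (hind : ∀ᶠ t in 𝒰, LinearIndependent K (b t))
    (hel : ∀ j, EL 𝒰 h (fun t => D.H L c (h t) (b t j)) 0) (hg : 0 < ∑ s, ∑ i, c s i) :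
    ∃ ℓ : Fin (p+1) → K, ℓ ≠ 0 ∧ ∀ᶠ t in 𝒰, ∀ j, ∑ i, ℓ i * b t j i = 0 := by
  classical
  set g := ∑ s, ∑ i, c s i with hgdef
  set n : ℝ := ((p + 1 : ℕ) : ℝ) with hn
  have hnp : 0 < n := by positivity
  set σc : ℝ := (Fintype.card D.σ : ℝ) with hσc
  have hσp : 0 < σc := by rw [hσc]; exact_mod_cast Fintype.card_pos_iff.2 ⟨D.s0⟩
  set ε0 := g / (8 * n * σc) with hε0
  have hε0p : 0 < ε0 := by positivity
  obtain ⟨j0, hj0⟩ := Ultrafilter.eventually_exists_iff (P := fun j t => lam (b t) j ≠ 0) |>.1 (hind.mono fun t ht => lam_ne ht)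
  have hsm : ∀ i, ∀ᶠ t in 𝒰, D.ht (-(lam (b t) i / lam (b t) j0)) ≤ ε0 * h t + D.ht (-1) := by
    intro i
    by_cases hi : j0 = i
    · subst hi
      filter_upwards [hj0, hh.eventually_ge_atTop 0] with t ht h0
      rw [div_self ht]; linarith [mul_nonneg hε0p.le h0]
    · have : ¬ ∀ᶠ t in 𝒰, lam (b t) j0 ≠ 0 ∧ ε0 * h t ≤ D.ht (-(lam (b t) i / lam (b t) j0)) := fun hc =>
        large D L c hh b hint hind hel hg hi hε0p hc
      rw [← Ultrafilter.eventually_not] at this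
      filter_upwards [this, hj0] with t ht h0
      have : ¬ ε0 * h t ≤ D.ht (-(lam (b t) i / lam (b t) j0)) := fun hc => ht ⟨h0, hc⟩
      linarith [D.ht_nonneg (-1)]
  set a : T → D.σ → Fin (p+1) → K := fun t s i => ∑ k, lam (b t) k * (L s).symm (Pi.single i 1) k with ha
  have hlow : ∀ᶠ t in 𝒰, ∀ s i, a t s i ≠ 0 → D.v s (lam (b t) j0) * Real.exp (-(2 * n * ε0 * h t)) ≤ D.v s (a t s i) := by
    refine eventually_all.2 fun s => eventually_all.2 fun i => ?_
    filter_upwards [eventually_all.2 hsm, hj0, hh.eventually_ge_atTop ((D.ht 0 + ∑ k : Fin (p+1), (D.ht (-1) + D.ht (-(L s).symm (Pi.single i 1) k) + Real.log 2)) / (n * ε0))] with t h1 h2 h3 h4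
    rw [div_le_iff₀ (by positivity)] at h3
    have h5 : a t s i / lam (b t) j0 = ∑ k, (-(lam (b t) k / lam (b t) j0)) * (-(L s).symm (Pi.single i 1) k) := by
      rw [ha, sum_div]; refine sum_congr rfl fun k _ => by ring
    have h6 : D.ht (a t s i / lam (b t) j0) ≤ 2 * n * ε0 * h t := by
      rw [h5]
      refine (ht_sum _ _).trans ?_
      have : ∑ k : Fin (p+1), (D.ht (-(lam (b t) k / lam (b t) j0) * (-(L s).symm (Pi.single i 1) k)) + Real.log 2) ≤
          ∑ k : Fin (p+1), (ε0 * h t + (D.ht (-1) + D.ht (-(L s).symm (Pi.single i 1) k) + Real.log 2)) := sum_le_sum fun k _ => by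
        linarith [D.ht_mul (-(lam (b t) k / lam (b t) j0)) (-(L s).symm (Pi.single i 1) k), h1 k]
      rw [sum_add_distrib (f := fun _ => ε0 * h t), sum_const, card_univ, Fintype.card_fin, nsmul_eq_mul, ← hn] at this
      linarith
    have h7 := (abs_le.1 (D.ht_abs s _ (div_ne_zero h4 h2))).1
    have h8 : Real.exp (-(2 * n * ε0 * h t)) ≤ D.v s (a t s i / lam (b t) j0) := by
      rw [← Real.le_log_iff_exp_le ((D.v s).pos (div_ne_zero h4 h2))]; linarith
    calc _ ≤ D.v s (lam (b t) j0) * D.v s (a t s i / lam (b t) j0) := mul_le_mul_of_nonneg_left h8 ((D.v s).nonneg _)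
      _ = _ := by rw [← map_mul, mul_div_cancel₀ _ h2]
  set Z : D.σ → Fin (p+1) → Prop := fun s i => ∀ᶠ t in 𝒰, a t s i = 0 with hZ
  have hpat : ∀ᶠ t in 𝒰, ∀ s i, a t s i = 0 ↔ Z s i := by
    refine eventually_all.2 fun s => eventually_all.2 fun i => ?_
    by_cases hz : Z s i
    · filter_upwards [show ∀ᶠ t in 𝒰, a t s i = 0 from hz] with t ht; simp [ht, hz]
    · filter_upwards [Ultrafilter.eventually_not.2 hz] with t ht; simp [ht, hz]
  obtain ⟨t', hp', hj', hi'⟩ := (hpat.and (hj0.and hint)).exists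
  set κ : D.σ → ℝ := fun s => D.v s (LinearMap.det (L s : (Fin (p+1) → K) →ₗ[K] Fin (p+1) → K)) with hκ
  have hκp : 0 < ∏ s, κ s := prod_pos fun s _ => (D.v s).pos (LinearEquiv.isUnit_det' _).ne_zero
  set A : D.σ → ℝ := fun s => ∑ i, D.v s (a t' s i) with hA
  have hexp : Tendsto (fun t => (∏ s, κ s) * Real.exp (g / 2 * h t)) 𝒰 atTop :=
    Tendsto.const_mul_atTop hκp (Real.tendsto_exp_atTop.comp (hh.const_mul_atTop (by positivity)))
  refine ⟨lam (b t'), fun h0 => hj' (congrFun h0 j0), ?_⟩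
  filter_upwards [hlow, hpat, hj0, hint, eventually_all.2 fun j => hel j (g / (4 * n)) (by positivity), hexp.eventually_gt_atTop (∏ s, A s)] with t h1 h2 h3 h4 h5 h6 r
  by_contra hne
  have hR : ∀ b' : Fin (p+1) → K, D.Int b' → ∑ i, lam (b t') i * b' i ∈ D.R := fun b' hb' => sum_mem fun i _ => mul_mem (lam_mem hi' i) (hb' i)
  have hge := D.prod_ge _ (hR _ (h4 r)) hne
  have hge2 := D.prod_ge _ (lam_mem h4 j0) h3
  have hs : ∀ s, D.v s (∑ i, lam (b t') i * b t r i) * (D.v s (lam (b t) j0) * κ s * Real.exp (h t * ∑ i, c s i - 2 * n * ε0 * h t)) ≤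
      A s * D.Nv L c (h t) s (b t r) * ∏ r', D.Nv L c (h t) s (b t r') := by
    intro s
    set X := D.v s (lam (b t) j0) * κ s * Real.exp (h t * ∑ i, c s i - 2 * n * ε0 * h t) with hX
    have hX0 : 0 ≤ X := by rw [hX]; exact mul_nonneg (mul_nonneg ((D.v s).nonneg _) ((D.v s).nonneg _)) (Real.exp_pos _).le
    set Pp := ∏ r', D.Nv L c (h t) s (b t r') with hPp
    have hPp0 : 0 ≤ Pp := prod_nonneg fun _ _ => Nv_nonneg _ _
    have e1 : ∑ i, lam (b t') i * b t r i = ∑ i, L s (b t r) i * a t' s i := by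
      have : b t r = ∑ i, L s (b t r) i • (L s).symm (Pi.single i 1) := by
        apply (L s).injective
        rw [map_sum]; simp only [map_smul, LinearEquiv.apply_symm_apply]
        exact pi_eq_sum_univ' _
      conv_lhs => rw [this]
      simp only [Finset.sum_apply, Pi.smul_apply, smul_eq_mul, mul_sum, ha]
      rw [sum_comm]
      refine sum_congr rfl fun i _ => sum_congr rfl fun k _ => by ring
    rw [e1]
    calc _ ≤ (∑ i, D.v s (L s (b t r) i) * D.v s (a t' s i)) * X := by
          refine mul_le_mul_of_nonneg_right ((av_sum _ _ _).trans (le_of_eq (sum_congr rfl fun i _ => map_mul _ _ _))) hX0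
      _ = ∑ i, D.v s (L s (b t r) i) * D.v s (a t' s i) * X := by rw [sum_mul]
      _ ≤ ∑ i, A s * (Real.exp (c s i * h t) * D.v s (L s (b t r) i)) * Pp := sum_le_sum fun i _ => by
          by_cases h0 : a t' s i = 0
          · rw [h0, map_zero, mul_zero, zero_mul]
            exact mul_nonneg (mul_nonneg (sum_nonneg fun _ _ => (D.v s).nonneg _) (mul_nonneg (Real.exp_pos _).le ((D.v s).nonneg _))) hPp0
          have h7 : a t s i ≠ 0 := fun hc => h0 ((hp' s i).2 ((h2 s i).1 hc))
          have h8 : X ≤ Real.exp (c s i * h t) * Pp := by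
            refine le_trans ?_ (cons_bd L c (h t) s (b t) i)
            rw [hX, sub_eq_add_neg, Real.exp_add]
            calc _ = Real.exp (h t * ∑ i, c s i) * ((D.v s (lam (b t) j0) * Real.exp (-(2 * n * ε0 * h t))) * κ s) := by ring
              _ ≤ _ := mul_le_mul_of_nonneg_left (mul_le_mul_of_nonneg_right (h1 s i h7) ((D.v s).nonneg _)) (Real.exp_pos _).le
          have h9 : D.v s (a t' s i) ≤ A s := single_le_sum (f := fun i => D.v s (a t' s i)) (fun _ _ => (D.v s).nonneg _) (mem_univ i)
          calc _ ≤ D.v s (L s (b t r) i) * A s * (Real.exp (c s i * h t) * Pp) :=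
                mul_le_mul (mul_le_mul_of_nonneg_left h9 ((D.v s).nonneg _)) h8 hX0 (mul_nonneg ((D.v s).nonneg _) (sum_nonneg fun _ _ => (D.v s).nonneg _))
            _ = _ := by ring
      _ = _ := by rw [← sum_mul, ← mul_sum]; rfl
  have hprod := prod_le_prod (s := univ) (fun s _ => mul_nonneg ((D.v s).nonneg _) (mul_nonneg (mul_nonneg ((D.v s).nonneg _) ((D.v s).nonneg _)) (Real.exp_pos _).le)) fun s _ => hs s
  simp only [prod_mul_distrib] at hprod
  rw [← Real.exp_sum, sum_sub_distrib, ← mul_sum, ← hgdef, sum_const, card_univ, nsmul_eq_mul, ← hσc, Finset.prod_comm] at hprod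
  have e2 : h t * g - σc * (2 * n * ε0 * h t) = g * (3/4) * h t := by rw [hε0]; field_simp; ring
  rw [e2] at hprod
  have h7 : ∏ r', ∏ s, D.Nv L c (h t) s (b t r') ≤ Real.exp (p * (g / (4 * n) * h t)) := by
    calc _ ≤ ∏ r' : Fin p, Real.exp (g / (4 * n) * h t) := prod_le_prod (fun r' _ => H_nonneg _) fun r' _ => by simpa using h5 r'
      _ = _ := by simp [← Real.exp_nat_mul]
  have h8 : ∏ s, D.Nv L c (h t) s (b t r) ≤ Real.exp (g / (4 * n) * h t) := by have := h5 r; rwa [zero_add] at this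
  have hA0 : 0 ≤ ∏ s, A s := prod_nonneg fun s _ => sum_nonneg fun _ _ => (D.v s).nonneg _
  have h9 : (∏ s, κ s) * Real.exp (g * (3/4) * h t) ≤ (∏ s, A s) * Real.exp (g / 4 * h t) := by
    calc (∏ s, κ s) * Real.exp (g * (3/4) * h t) ≤ (∏ s, D.v s (∑ i, lam (b t') i * b t r i)) * ((∏ s, D.v s (lam (b t) j0)) * (∏ s, κ s) * Real.exp (g * (3/4) * h t)) := by
          have : 1 ≤ (∏ s, D.v s (∑ i, lam (b t') i * b t r i)) * (∏ s, D.v s (lam (b t) j0)) := one_le_mul_of_one_le_of_one_le hge hge2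
          have := mul_le_mul_of_nonneg_right this (mul_nonneg hκp.le (Real.exp_pos (g * (3/4) * h t)).le)
          linarith
      _ ≤ _ := hprod
      _ ≤ (∏ s, A s) * Real.exp (g / (4 * n) * h t) * Real.exp (p * (g / (4 * n) * h t)) :=
          mul_le_mul (mul_le_mul_of_nonneg_left h8 hA0) h7 (prod_nonneg fun _ _ => H_nonneg _) (mul_nonneg hA0 (Real.exp_pos _).le)
      _ = _ := by
          rw [mul_assoc, ← Real.exp_add]; congr 2
          have : (p:ℝ) = n - 1 := by rw [hn]; push_cast; ring
          rw [this]; field_simp; ring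
  have e3 : Real.exp (g * (3/4) * h t) = Real.exp (g / 2 * h t) * Real.exp (g / 4 * h t) := by rw [← Real.exp_add]; ring_nf
  rw [e3, ← mul_assoc] at h9
  exact absurd (le_of_mul_le_mul_right h9 (Real.exp_pos _)) (not_le.2 h6)
end Lau
end
end
section
open Filter Finset
noncomputable section
namespace Lau
variable {K : Type} [Field K] {D : SD K} {n p : ℕ} {T : Type} {𝒰 : Ultrafilter T} {h : T → ℝ}
lemma flag_step_not {b : Fin n → Fin n → K} (hb : LinearIndependent K b) {z : Fin n → K} {j : Fin n} (h1 : z ∈ flag b (j + 1)) (h2 : z ∉ flag b j) :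
    z ∉ Submodule.span K (b '' {i | i ≠ j}) := by
  intro h3
  set B := basisOfLinearIndependentOfCardEqFinrank' b hb (by simp) with hB
  have hBb : ⇑B = b := coe_basisOfLinearIndependentOfCardEqFinrank' _ _ _
  unfold flag at h1 h2
  rw [← hBb, Module.Basis.mem_span_image] at h1 h2 h3
  refine h2 fun i hi => ?_
  have a1 := h1 hi
  have a2 := h3 hi
  simp only [Set.mem_ofPred_eq, ne_eq, Fin.ext_iff] at a1 a2 ⊢
  omega
theorem lemT [CharZero K] (L : D.GL (p+1)) (c : D.σ → Fin (p+1) → ℝ) (hh : Tendsto h 𝒰 atTop) {b : T → Fin (p+1) → Fin (p+1) → K} {μ : Fin (p+1) → ℝ}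
    (ht : Tight 𝒰 h L c b μ) (hμ : Monotone μ) {m : ℝ} (hm : ∀ j, j ≠ Fin.last p → μ j ≤ m) (hl : m < μ (Fin.last p)) :
    ∃ ℓ : Fin (p+1) → K, ℓ ≠ 0 ∧ ∀ᶠ t in 𝒰, ∀ j, j ≠ Fin.last p → ∑ i, ℓ i * b t j i = 0 := by
  obtain ⟨c', hsum, hfl⟩ := flatten L c hh b (fun j => -min (μ j) m) (fun i j hij => neg_le_neg (min_le_min_right _ (hμ hij)))
  obtain ⟨b', μ', -, ht'⟩ := exists_tight p.succ_pos L c' hh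
  set g := μ (Fin.last p) - m with hg
  have hg0 : 0 < g := sub_pos.2 hl
  have hc' : ∑ s, ∑ i, c' s i = g := by
    rw [hsum, ← ht.sum, ← sum_add_distrib, Fin.sum_univ_castSucc, sum_eq_zero, zero_add, min_eq_right hl.le]; · rfl
    intro j _
    rw [min_eq_left (hm _ (Fin.castSucc_lt_last j).ne)]; ring
  have hst : ∀ k, ∃ j : Fin (p+1), ∀ᶠ t in 𝒰, b' t k ∈ flag (b t) (j + 1) ∧ b' t k ∉ flag (b t) j := fun k => by
    refine Ultrafilter.eventually_exists_iff (P := fun j t => b' t k ∈ flag (b t) ((j : Fin (p+1)) + 1) ∧ b' t k ∉ flag (b t) j) |>.1 ?_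
    filter_upwards [ht.ind, ht'.ind] with t h1 h2
    exact exists_flag_step (by rw [flag_n h1]; trivial) (h2.ne_zero k)
  choose j hj using hst
  have hlow : ∀ k, μ (j k) - min (μ (j k)) m ≤ μ' k := by
    intro k
    have := ht.low hh (fun t => b' t k) (ht'.int.mono fun t h1 => h1 k) (j k) (by
      filter_upwards [hj k, ht.ind] with t h1 h2 using flag_step_not h2 h1.1 h1.2) (ν := min (μ (j k)) m + μ' k) (by
      have h1 := ((EL.exp hh (min (μ (j k)) m)).mul (ht'.el k) fun t => H_nonneg _).cmul hh (fun t => mul_nonneg (Real.exp_pos _).le (H_nonneg _)) (2 ^ (p+1))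
      refine h1.mono hh le_rfl ?_
      filter_upwards [hfl, hj k] with t h2 h3
      have h4 := mul_le_mul_of_nonneg_left (h2 (j k) _ h3.1) (Real.exp_pos (min (μ (j k)) m * h t)).le
      rw [← mul_assoc, ← Real.exp_add] at h4
      simp only [neg_mul, add_neg_cancel, Real.exp_zero, one_mul] at h4
      linarith)
    linarith
  have hnn : ∀ k, 0 ≤ μ' k := fun k => (sub_nonneg.2 (min_le_left _ _)).trans (hlow k)
  have hex : ∃ k0, j k0 = Fin.last p := by
    by_contra! hno
    obtain ⟨t, h1, h2⟩ := ((eventually_all.2 hj).and ht'.ind).exists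
    have h3 : Submodule.span K (Set.range (b' t)) ≤ flag (b t) p := Submodule.span_le.2 (by
      rintro _ ⟨k, rfl⟩
      refine flag_mono _ ?_ (h1 k).1
      have := hno k
      rw [ne_eq, Fin.ext_iff, Fin.val_last] at this
      have := (j k).2; omega)
    have h4 := Submodule.finrank_mono h3
    rw [finrank_span_eq_card h2, Fintype.card_fin] at h4
    have := flag_rank (b t) p
    exact absurd (h4.trans this) (by omega)
  obtain ⟨k0, hk0⟩ := hex
  have hk0' : g ≤ μ' k0 := by have := hlow k0; rwa [hk0, min_eq_right hl.le] at this
  have hz : ∀ k, k ≠ k0 → μ' k ≤ 0 := by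
    intro k hk
    have h1 := ht'.sum
    rw [hc', ← add_sum_erase _ _ (mem_univ k0)] at h1
    have h2 := single_le_sum (f := μ') (s := univ.erase k0) (fun i _ => hnn i) (mem_erase.2 ⟨hk, mem_univ k⟩)
    linarith
  have hjk : ∀ k, k ≠ k0 → j k ≠ Fin.last p := fun k hk hc => by
    have := hlow k; rw [hc, min_eq_right hl.le] at this; linarith [hz k hk]
  have hind : ∀ᶠ t in 𝒰, LinearIndependent K fun r => b' t (k0.succAbove r) := ht'.ind.mono fun t h1 => h1.comp _ Fin.succAbove_right_injective
  obtain ⟨ℓ, hℓ, hk⟩ := thmC L c' hh (fun t r => b' t (k0.succAbove r)) (ht'.int.mono fun t h1 r => h1 _) hind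
    (fun r => (ht'.el _).mono hh (hz _ (Fin.succAbove_ne _ _)) (Eventually.of_forall fun t => le_rfl)) (hc' ▸ hg0)
  refine ⟨ℓ, hℓ, ?_⟩
  filter_upwards [hk, hind, eventually_all.2 hj] with t h1 h2 h3 i hi
  have h4 : Submodule.span K (Set.range fun r => b' t (k0.succAbove r)) = flag (b t) p := by
    refine Submodule.eq_of_le_of_finrank_le (Submodule.span_le.2 ?_) ?_
    · rintro _ ⟨r, rfl⟩
      refine flag_mono _ ?_ (h3 _).1
      have := hjk _ (Fin.succAbove_ne k0 r)
      rw [ne_eq, Fin.ext_iff, Fin.val_last] at this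
      have := (j (k0.succAbove r)).2; omega
    · rw [finrank_span_eq_card h2, Fintype.card_fin]; exact flag_rank _ _
  have h5 : b t i ∈ flag (b t) p := Submodule.subset_span ⟨i, by
    rw [ne_eq, Fin.ext_iff, Fin.val_last] at hi
    have := i.2
    simp only [Set.mem_ofPred_eq]; omega, rfl⟩
  rw [← h4] at h5
  have h6 : Submodule.span K (Set.range fun r => b' t (k0.succAbove r)) ≤ LinearMap.ker (∑ i, ℓ i • LinearMap.proj i : (Fin (p+1) → K) →ₗ[K] K) := Submodule.span_le.2 (by
    rintro _ ⟨r, rfl⟩; simpa using h1 r)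
  simpa using h6 h5
end Lau
end
end
section
open Filter Finset
noncomputable section
namespace Lau
variable {K : Type} [Field K] {D : SD K} {n q N : ℕ} {T : Type} {𝒰 : Ultrafilter T} {h : T → ℝ}
abbrev PC (n q : ℕ) := Set.powersetCard (Fin n) q
def em (I : PC n q) : Fin q ↪o Fin n := Set.powersetCard.ofFinEmbEquiv.symm I
lemma em_sum (I : PC n q) (f : Fin n → ℝ) : ∑ a, f (em I a) = ∑ i ∈ I.1, f i := by
  have : I.1 = univ.map (em I).toEmbedding := by
    ext i
    have := Set.powersetCard.mem_range_ofFinEmbEquiv_symm_iff_mem I i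
    rw [Set.powersetCard.mem_coe_iff, ← this]; simp [em]
  rw [this, sum_map]; rfl
lemma PC_sum (n q : ℕ) (hq : 0 < q) : ∃ C : ℝ, ∀ f : Fin n → ℝ, ∑ I : PC n q, ∑ a, f (em I a) = C * ∑ i, f i := by
  classical
  refine ⟨((n - 1).choose (q - 1) : ℕ), fun f => ?_⟩
  simp_rw [em_sum]
  rw [← sum_subtype (Finset.powersetCard q univ) (p := fun x => x ∈ Set.powersetCard (Fin n) q) (fun x => by simp [Set.powersetCard]) (fun I => ∑ i ∈ I, f i)]
  have : ∀ I : Finset (Fin n), ∑ i ∈ I, f i = ∑ i, if i ∈ I then f i else 0 := fun I => by simp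
  simp_rw [this]
  rw [sum_comm, mul_sum]
  refine sum_congr rfl fun i _ => ?_
  rw [← sum_filter, sum_const, nsmul_eq_mul]
  have := card_filter_powersetCard_subset {i} univ q (subset_univ _) (by rw [card_singleton]; exact hq)
  simp only [singleton_subset_iff, card_univ, Fintype.card_fin, card_singleton] at this
  rw [this]; simp
def xe (e : Fin N ≃ PC n q) : (⋀[K]^q (Fin n → K)) ≃ₗ[K] (Fin N → K) := (((Pi.basisFun K (Fin n)).exteriorPower q).reindex e.symm).equivFun
lemma xe_apply (e : Fin N ≃ PC n q) (w : Fin q → Fin n → K) (k : Fin N) : xe e (exteriorPower.ιMulti K q w) k = (Matrix.of fun i j => w i (em (e k) j)).det := by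
  unfold xe
  rw [Module.Basis.equivFun_apply, Module.Basis.repr_reindex_apply, exteriorPower.basis_repr_apply, exteriorPower.ιMultiDual_apply_ιMulti]
  rfl
def xm (f : (Fin n → K) ≃ₗ[K] (Fin n → K)) : (⋀[K]^q (Fin n → K)) ≃ₗ[K] (⋀[K]^q (Fin n → K)) :=
  LinearEquiv.ofLinearMap (exteriorPower.map q f.toLinearMap) (exteriorPower.map q f.symm.toLinearMap)
    (by rw [← exteriorPower.map_comp]; simp) (by rw [← exteriorPower.map_comp]; simp)
def xL (e : Fin N ≃ PC n q) (L : D.GL n) : D.GL N := fun s => (xe e).symm.trans ((xm (L s)).trans (xe e))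
def xc (e : Fin N ≃ PC n q) (c : D.σ → Fin n → ℝ) : D.σ → Fin N → ℝ := fun s k => ∑ a, c s (em (e k) a)
lemma xL_apply (e : Fin N ≃ PC n q) (L : D.GL n) (s) (w : Fin q → Fin n → K) (k : Fin N) :
    xL e L s (xe e (exteriorPower.ιMulti K q w)) k = (Matrix.of fun i j => L s (w i) (em (e k) j)).det := by
  have : xL e L s (xe e (exteriorPower.ιMulti K q w)) = xe e (exteriorPower.ιMulti K q fun i => L s (w i)) := by
    simp only [xL, LinearEquiv.trans_apply, LinearEquiv.symm_apply_apply]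
    congr 1
    exact exteriorPower.map_apply_ιMulti _ _
  rw [this, xe_apply]
lemma xNv (e : Fin N ≃ PC n q) (L : D.GL n) (c : D.σ → Fin n → ℝ) (x : ℝ) (s) (w : Fin q → Fin n → K) :
    D.Nv (xL e L) (xc e c) x s (xe e (exteriorPower.ιMulti K q w)) ≤ N * ∏ a, D.Nv L c x s (w a) := by
  unfold SD.Nv
  have : ∀ k ∈ (univ : Finset (Fin N)), Real.exp (xc e c s k * x) * D.v s (xL e L s (xe e (exteriorPower.ιMulti K q w)) k) ≤ ∏ a, ∑ i, Real.exp (c s i * x) * D.v s (L s (w a) i) := by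
    intro k _
    rw [xL_apply]
    have h1 := det_le_wt (D.v s) (Matrix.of fun i j => L s (w i) (em (e k) j)) (fun j => Real.exp (c s (em (e k) j) * x)) fun i => Real.exp_pos _
    rw [← Real.exp_sum, ← sum_mul] at h1
    refine h1.trans (prod_le_prod (fun a _ => sum_nonneg fun i _ => mul_nonneg (Real.exp_pos _).le ((D.v s).nonneg _)) fun a _ => ?_)
    refine le_of_eq_of_le (sum_map univ (em (e k)).toEmbedding fun i => Real.exp (c s i * x) * D.v s (L s (w a) i)).symm ?_
    exact sum_le_sum_of_subset_of_nonneg (subset_univ _) fun i _ _ => mul_nonneg (Real.exp_pos _).le ((D.v s).nonneg _)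
  refine (sum_le_sum this).trans ?_
  simp
lemma xTight (hq : 0 < q) (e : Fin N ≃ PC n q) {L : D.GL n} {c : D.σ → Fin n → ℝ} (hh : Tendsto h 𝒰 atTop) {b : T → Fin n → Fin n → K} {μ : Fin n → ℝ} (ht : Tight 𝒰 h L c b μ) :
    Tight 𝒰 h (xL e L) (xc e c) (fun t k => xe e (exteriorPower.ιMulti_family K q (b t) (e k))) (fun k => ∑ a, μ (em (e k) a)) where
  int := ht.int.mono fun t h1 k i => by
    unfold exteriorPower.ιMulti_family
    rw [xe_apply]; exact det_mem _ fun _ _ => h1 _ _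
  ind := ht.ind.mono fun t h1 => ((exteriorPower.ιMulti_family_linearIndependent_field q h1).comp _ e.injective).map' (xe e).toLinearMap (xe e).ker
  el := fun k => by
    have h1 := (EL.prod hh univ (f := fun a t => D.H L c (h t) (b t (em (e k) a))) (m := fun a => μ (em (e k) a)) (fun _ _ => H_nonneg _) fun a _ => ht.el _).cmul hh
      (fun t => prod_nonneg fun _ _ => H_nonneg _) (N ^ Fintype.card D.σ)
    refine h1.mono hh le_rfl (Eventually.of_forall fun t => ?_)
    unfold SD.H
    calc _ ≤ ∏ s, ((N:ℝ) * ∏ a, D.Nv L c (h t) s (b t (em (e k) a))) := prod_le_prod (fun s _ => Nv_nonneg _ _) fun s _ => xNv e L c (h t) s _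
      _ = _ := by rw [prod_mul_distrib, Finset.prod_comm]; simp
  sum := by
    obtain ⟨C, hC⟩ := PC_sum n q hq
    unfold xc
    rw [Equiv.sum_comp e (fun I => ∑ a, μ (em I a)), hC, ht.sum, mul_sum]
    refine sum_congr rfl fun s _ => ?_
    rw [Equiv.sum_comp e (fun I => ∑ a, c s (em I a)), hC]
theorem thmE [CharZero K] (L : D.GL n) (c : D.σ → Fin n → ℝ) (hh : Tendsto h 𝒰 atTop) (z : T → Fin n → K) (hz : ∀ᶠ t in 𝒰, D.Int (z t))
    (hz0 : ∀ᶠ t in 𝒰, z t ≠ 0) {ν : ℝ} (hel : EL 𝒰 h (fun t => D.H L c (h t) (z t)) ν) (hν : n * ν < ∑ s, ∑ i, c s i) :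
    ∃ W : Submodule K (Fin n → K), W ≠ ⊤ ∧ ∀ᶠ t in 𝒰, z t ∈ W := by
  classical
  have hn : 0 < n := by
    rcases Nat.eq_zero_or_pos n with rfl | h0
    · obtain ⟨t, ht⟩ := hz0.exists; exact absurd (Subsingleton.elim _ _) ht
    · exact h0
  obtain ⟨b, μ, -, ht⟩ := exists_tight hn L c hh
  set I0 : Finset (Fin n) := univ.filter fun j => ν < μ j with hI0
  have hI0m : ∀ j, j ∈ I0 ↔ ν < μ j := fun j => by simp [hI0]
  obtain ⟨r, hr⟩ : ∃ r, I0.card = r + 1 := by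
    refine Nat.exists_eq_add_one.2 (card_pos.2 ?_)
    by_contra hne
    rw [not_nonempty_iff_eq_empty] at hne
    have h1 : ∑ j, μ j ≤ ∑ j : Fin n, ν := sum_le_sum fun j _ => by
      by_contra hc; have := (hI0m j).2 (not_le.1 hc); rw [hne] at this; simp at this
    rw [ht.sum] at h1; simp at h1; linarith
  set J0 : PC n (r+1) := ⟨I0, hr⟩ with hJ0
  obtain ⟨p, hp⟩ : ∃ p, Fintype.card (PC n (r+1)) = p + 1 := Nat.exists_eq_add_one.2 (Fintype.card_pos_iff.2 ⟨J0⟩)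
  set e0 : Fin (p+1) ≃ PC n (r+1) := (Fintype.equivFinOfCardEq hp).symm
  set e := (Tuple.sort fun k => ∑ a, μ (em (e0 k) a)).trans e0 with he
  have hlt : ∀ I : PC n (r+1), I ≠ J0 → ∑ a, μ (em I a) < ∑ a, μ (em J0 a) := by
    intro I hI
    have h2 : ∀ I : PC n (r+1), ∑ a, μ (em I a) = (r+1) * ν + ∑ i ∈ I.1, (μ i - ν) := fun I => by
      rw [em_sum, sum_sub_distrib, sum_const, show I.1.card = r + 1 from I.2]; simp
    rw [h2, h2]
    have h3 : ∑ i ∈ I.1, (μ i - ν) ≤ ∑ i ∈ I.1 ∩ I0, (μ i - ν) := by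
      rw [← sum_inter_add_sum_sdiff I.1 I0]
      have : ∑ i ∈ I.1 \ I0, (μ i - ν) ≤ 0 := sum_nonpos fun i hi => by
        have := (mem_sdiff.1 hi).2; rw [hI0m] at this; linarith
      linarith
    have h4 : ¬ I0 ⊆ I.1 := fun hc => hI (Subtype.ext (eq_of_subset_of_card_le hc (by rw [hr]; exact I.2.le)).symm)
    obtain ⟨i, hi, hi'⟩ := not_subset.1 h4
    have h5 : ∑ i ∈ I.1 ∩ I0, (μ i - ν) < ∑ i ∈ I0, (μ i - ν) := sum_lt_sum_of_subset inter_subset_right hi (fun hc => hi' (mem_inter.1 hc).1)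
      (sub_pos.2 ((hI0m i).1 hi)) fun j hj _ => (sub_pos.2 ((hI0m j).1 hj)).le
    have : ∑ i ∈ J0.1, (μ i - ν) = ∑ i ∈ I0, (μ i - ν) := rfl
    linarith
  have hmono : Monotone fun k => ∑ a, μ (em (e k) a) := Tuple.monotone_sort fun k => ∑ a, μ (em (e0 k) a)
  have hlast : e (Fin.last p) = J0 := by
    by_contra hc
    have h1 := hlt _ hc
    have h2 := hmono (Fin.le_last (e.symm J0))
    simp only [Equiv.apply_symm_apply] at h2
    linarith
  have hm : ∃ m, (∀ k, k ≠ Fin.last p → ∑ a, μ (em (e k) a) ≤ m) ∧ m < ∑ a, μ (em (e (Fin.last p)) a) := by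
    have h1 : ∀ k, k ≠ Fin.last p → ∑ a, μ (em (e k) a) < ∑ a, μ (em (e (Fin.last p)) a) := fun k hk => by
      rw [hlast]; exact hlt _ fun hc => hk (e.injective (hc.trans hlast.symm))
    rcases (univ.erase (Fin.last p)).eq_empty_or_nonempty with h0 | h0
    · refine ⟨_, fun k hk => ?_, sub_one_lt _⟩
      have : k ∈ univ.erase (Fin.last p) := mem_erase.2 ⟨hk, mem_univ _⟩
      rw [h0] at this; simp at this
    · obtain ⟨k, hk, hk'⟩ := exists_max_image _ (fun k => ∑ a, μ (em (e k) a)) h0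
      exact ⟨_, fun k' hk2 => hk' k' (mem_erase.2 ⟨hk2, mem_univ _⟩), h1 k (mem_erase.1 hk).1⟩
  obtain ⟨m, hm1, hm2⟩ := hm
  obtain ⟨ℓ, hℓ, hk⟩ := lemT _ _ hh (xTight r.succ_pos e hh ht) hmono hm1 hm2
  set f : (Fin (p+1) → K) →ₗ[K] K := ∑ i, ℓ i • LinearMap.proj i with hf
  set A := (f ∘ₗ (xe e).toLinearMap).compAlternatingMap (exteriorPower.ιMulti K (r+1) (M := Fin n → K)) with hA
  refine ⟨LinearMap.ker A.curryLeft, fun htop => hℓ ?_, ?_⟩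
  · have h1 : f ∘ₗ (xe e).toLinearMap = 0 := by
      refine exteriorPower.linearMap_ext (AlternatingMap.ext fun w => ?_)
      have : w 0 ∈ LinearMap.ker A.curryLeft := by rw [htop]; trivial
      have h2 := congrArg (fun B => B (Fin.tail w)) (LinearMap.mem_ker.1 this)
      simp only [AlternatingMap.curryLeft_apply_apply, AlternatingMap.zero_apply] at h2
      rw [show Matrix.vecCons (w 0) (Fin.tail w) = w from Fin.cons_self_tail w] at h2
      exact h2
    funext i
    have h2 := LinearMap.congr_fun h1 ((xe e).symm (Pi.single i 1))
    simpa [hf, Pi.single_apply] using h2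
  · have h1 : ∀ j ∈ I0, ∀ᶠ t in 𝒰, z t ∈ Submodule.span K (b t '' {i | i ≠ j}) := fun j hj => by
      by_contra hc
      rw [← Ultrafilter.eventually_not] at hc
      exact absurd ((hI0m j).1 hj) (not_lt.2 (ht.low hh z hz j hc hel))
    filter_upwards [hk, ht.ind, (eventually_all_finset I0).2 h1] with t h2 h3 h4
    rw [LinearMap.mem_ker]
    ext w
    set B := basisOfLinearIndependentOfCardEqFinrank' (b t) h3 (by simp) with hB
    have hBb : ⇑B = b t := coe_basisOfLinearIndependentOfCardEqFinrank' _ _ _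
    have h5 : (B.exteriorPower (r+1)).repr (exteriorPower.ιMulti K (r+1) (Matrix.vecCons (z t) w)) J0 = 0 := by
      rw [exteriorPower.basis_repr_apply, exteriorPower.ιMultiDual_apply_ιMulti]
      refine Matrix.det_eq_zero_of_row_eq_zero 0 fun j => ?_
      have h6 : em J0 j ∈ I0 := (Set.powersetCard.mem_range_ofFinEmbEquiv_symm_iff_mem J0 _).1 ⟨j, rfl⟩
      have h7 := h4 _ h6
      rw [← hBb, Module.Basis.mem_span_image] at h7
      have h8 : em J0 j ∉ (B.repr (z t)).support := fun hc => h7 hc rfl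
      rw [Finsupp.notMem_support_iff] at h8
      exact h8
    rw [AlternatingMap.curryLeft_apply_apply, AlternatingMap.zero_apply, hA, LinearMap.compAlternatingMap_apply, ← (B.exteriorPower (r+1)).sum_repr (exteriorPower.ιMulti K (r+1) (Matrix.vecCons (z t) w)), map_sum]
    refine sum_eq_zero fun I _ => ?_
    rw [map_smul]
    by_cases hI : I = J0
    · rw [hI, h5, zero_smul]
    · have h9 := h2 (e.symm I) fun hc => hI (by rw [← hlast, ← hc, Equiv.apply_symm_apply])
      rw [Equiv.apply_symm_apply] at h9
      rw [exteriorPower.basis_apply, hBb]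
      have : (f ∘ₗ (xe e).toLinearMap) (exteriorPower.ιMulti_family K (r+1) (b t) I) = 0 := by simpa [hf] using h9
      rw [this, smul_zero]
end Lau
end
end
section
open Filter Finset
noncomputable section
namespace Lau
variable {K : Type} [Field K] {D : SD K} {T : Type} {𝒰 : Ultrafilter T}
def SD.U (D : SD K) (a : K) : Prop := a ≠ 0 ∧ a ∈ D.R ∧ a⁻¹ ∈ D.R
lemma SD.U.div {a b : K} (ha : D.U a) (hb : D.U b) : D.U (a / b) := by
  refine ⟨div_ne_zero ha.1 hb.1, ?_, ?_⟩
  · rw [div_eq_mul_inv]; exact mul_mem ha.2.1 hb.2.2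
  · rw [inv_div, div_eq_mul_inv]; exact mul_mem hb.2.1 ha.2.2
lemma SD.U.log_sum {a : K} (ha : D.U a) : ∑ s, Real.log (D.v s a) = 0 := by
  rw [← Real.log_prod (fun s _ => ((D.v s).pos ha.1).ne')]
  have h1 := D.prod_ge _ ha.2.1 ha.1
  have h2 := D.prod_ge _ ha.2.2 (inv_ne_zero ha.1)
  simp only [map_inv₀, prod_inv_distrib] at h2
  have h3 := inv_le_one_of_one_le₀ h2
  rw [inv_inv] at h3
  rw [le_antisymm h3 h1, Real.log_one]
lemma bdd_lim {f : T → ℝ} (hf : ∀ᶠ t in 𝒰, |f t| ≤ 1) : ∃ c, Tendsto f 𝒰 (nhds c) := by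
  obtain ⟨c, -, hc⟩ := (isCompact_Icc (a := (-1:ℝ)) (b := 1)).ultrafilter_le_nhds (𝒰.map f) (by
    rw [Filter.le_principal_iff]
    exact hf.mono fun t ht => abs_le.1 ht)
  exact ⟨c, hc⟩
theorem unitW [CharZero K] (hN : ∀ B : ℝ, {a : K | D.U a ∧ ∀ s, D.v s a ≤ B}.Finite) (n : ℕ) : ∀ (a : Fin n → K), (∀ i, a i ≠ 0) → ∀ (x : T → Fin n → K), (∀ t i, D.U (x t i)) →
    0 < n → (∀ᶠ t in 𝒰, ∑ i, a i * x t i = 0) → ∃ i j, i ≠ j ∧ ∃ r : K, ∀ᶠ t in 𝒰, x t i = r * x t j := by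
  classical
  induction n using Nat.strong_induction_on with
  | _ n ih =>
  intro a ha x hx hn hs
  obtain ⟨m, rfl⟩ := Nat.exists_eq_add_one.2 hn
  rcases Nat.eq_zero_or_pos m with rfl | hm
  · obtain ⟨t, ht⟩ := hs.exists
    simp at ht
    exact absurd ht (by simp [ha 0, (hx t 0).1])
  set y : T → Fin (m+1) → K := fun t i => x t i / x t (Fin.last m) with hy
  have hyU : ∀ t i, D.U (y t i) := fun t i => (hx t i).div (hx t _)
  have hyl : ∀ t, y t (Fin.last m) = 1 := fun t => div_self (hx t _).1
  have hxy : ∀ t i, x t i = y t i * x t (Fin.last m) := fun t i => (div_mul_cancel₀ _ (hx t _).1).symm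
  have hys : ∀ᶠ t in 𝒰, ∑ i, a i * y t i = 0 := hs.mono fun t ht => by
    simp only [hy, ← mul_div_assoc, ← sum_div, ht, zero_div]
  have hmax : ∀ s, ∃ i0, ∀ᶠ t in 𝒰, ∀ i, D.v s (y t i) ≤ D.v s (y t i0) := fun s => by
    refine Ultrafilter.eventually_exists_iff (P := fun i0 t => ∀ i, D.v s (y t i) ≤ D.v s (y t i0)) |>.1 (Eventually.of_forall fun t => ?_)
    obtain ⟨i0, -, h0⟩ := exists_max_image univ (fun i => D.v s (y t i)) univ_nonempty
    exact ⟨i0, fun i => h0 i (mem_univ i)⟩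
  choose i0 hi0 using hmax
  set l : T → D.σ → Fin (m+1) → ℝ := fun t s i => Real.log (D.v s (y t i)) with hl
  set h : T → ℝ := fun t => ∑ s, l t s (i0 s) with hh
  have hvp : ∀ t s i, 0 < D.v s (y t i) := fun t s i => (D.v s).pos (hyU t i).1
  have hvl : ∀ t s i, D.v s (y t i) = Real.exp (l t s i) := fun t s i => (Real.exp_log (hvp t s i)).symm
  have hll : ∀ t s, l t s (Fin.last m) = 0 := fun t s => by simp [hl, hyl]
  have hbd : ∀ᶠ t in 𝒰, ∀ s i, |l t s i| ≤ h t := by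
    filter_upwards [eventually_all.2 hi0] with t ht
    have h1 : ∀ s i, l t s i ≤ l t s (i0 s) := fun s i => Real.log_le_log (hvp t s i) (ht s i)
    have h2 : ∀ s, 0 ≤ l t s (i0 s) := fun s => by rw [← hll t s]; exact h1 s _
    intro s i
    rw [abs_le]
    constructor
    · have h3 := (hyU t i).log_sum
      rw [← add_sum_erase _ _ (mem_univ s)] at h3
      have h4 : ∑ s' ∈ univ.erase s, l t s' i ≤ h t := (sum_le_sum fun s' _ => h1 s' i).trans (sum_le_sum_of_subset_of_nonneg (subset_univ _) fun s' _ _ => h2 s')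
      simp only [hl] at h4 ⊢
      linarith
    · exact (h1 s i).trans (single_le_sum (f := fun s => l t s (i0 s)) (fun s _ => h2 s) (mem_univ s))
  by_cases hB : ∃ B, ∀ᶠ t in 𝒰, h t ≤ B
  · obtain ⟨B, hB⟩ := hB
    have hfin := hN (Real.exp B)
    have h1 : ∀ᶠ t in 𝒰, ∃ r : {a : K | D.U a ∧ ∀ s, D.v s a ≤ Real.exp B}, y t 0 = r := by
      filter_upwards [hB, hbd] with t h1 h2
      refine ⟨⟨y t 0, hyU t 0, fun s => ?_⟩, rfl⟩
      rw [hvl]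
      exact Real.exp_le_exp.2 ((le_abs_self _).trans ((h2 s 0).trans h1))
    have := hfin.to_subtype
    obtain ⟨r, hr⟩ := Ultrafilter.eventually_exists_iff.1 h1
    refine ⟨0, Fin.last m, ?_, r, hr.mono fun t ht => by rw [← ht]; exact hxy t 0⟩
    intro hc; have := congrArg Fin.val hc; simp at this; omega
  have hht : Tendsto h 𝒰 atTop := by
    rw [tendsto_atTop]
    intro B
    by_contra hc
    rw [← Ultrafilter.eventually_not] at hc
    exact hB ⟨B, hc.mono fun t ht => (not_le.1 ht).le⟩
  have hpos := hht.eventually_gt_atTop 0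
  have hlim : ∀ s i, ∃ c, Tendsto (fun t => -l t s i / h t) 𝒰 (nhds c) := fun s i => bdd_lim (by
    filter_upwards [hbd, hpos] with t h1 h2
    rw [abs_div, abs_neg, abs_of_pos h2, div_le_one h2]; exact h1 s i)
  choose C hC using hlim
  set φ : Fin (m+1) → (Fin m → K) →ₗ[K] K := Fin.snoc (fun k => LinearMap.proj k) (-((a (Fin.last m))⁻¹ • ∑ k : Fin m, a k.castSucc • LinearMap.proj k)) with hφ
  have hφc : ∀ (k : Fin m) z, φ k.castSucc z = z k := fun k z => by simp [hφ]
  have hφl : ∀ z : Fin m → K, φ (Fin.last m) z = -((a (Fin.last m))⁻¹ * ∑ k : Fin m, a k.castSucc * z k) := fun z => by simp [hφ]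
  have hφr : ∀ z : Fin m → K, ∑ i, a i * φ i z = 0 := fun z => by
    rw [Fin.sum_univ_castSucc, hφl]
    simp only [hφc]
    field_simp [ha (Fin.last m)]; ring
  have hinj : ∀ i : Fin (m+1), Function.Injective (LinearMap.pi fun k => φ (i.succAbove k)) := fun i => by
    rw [← LinearMap.ker_eq_bot, LinearMap.ker_eq_bot']
    intro z hz
    have h1 : ∀ k, φ (i.succAbove k) z = 0 := fun k => congrFun hz k
    have h2 : φ i z = 0 := by
      have := hφr z
      rw [Fin.sum_univ_succAbove _ i] at this
      simp only [h1, mul_zero, sum_const_zero, add_zero] at this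
      exact (mul_eq_zero.1 this).resolve_left (ha i)
    funext k
    have h3 : ∀ j, φ j z = 0 := fun j => by
      by_cases hj : j = i
      · rw [hj, h2]
      · obtain ⟨k, rfl⟩ := Fin.exists_succAbove_eq hj; exact h1 k
    rw [← hφc k z, h3]; rfl
  set L : D.GL m := fun s => LinearEquiv.ofInjectiveEndo _ (hinj (i0 s)) with hL
  set c : D.σ → Fin m → ℝ := fun s k => C s ((i0 s).succAbove k) with hc
  set z : T → Fin m → K := fun t k => y t k.castSucc with hz
  have hφz : ∀ᶠ t in 𝒰, ∀ i, φ i (z t) = y t i := by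
    filter_upwards [hys] with t ht i
    induction i using Fin.lastCases with
    | last =>
      rw [Fin.sum_univ_castSucc] at ht
      rw [hφl, eq_neg_of_add_eq_zero_left ht]
      field_simp [ha (Fin.last m)]
    | cast k => rw [hφc]
  have hLz : ∀ᶠ t in 𝒰, ∀ s k, L s (z t) k = y t ((i0 s).succAbove k) := hφz.mono fun t ht s k => ht _
  have hc1 : ∑ s, ∑ i, c s i = 1 := by
    have h1 : Tendsto (fun t => ∑ s, ∑ k, -l t s ((i0 s).succAbove k) / h t) 𝒰 (nhds (∑ s, ∑ i, c s i)) :=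
      tendsto_finsetSum _ fun s _ => tendsto_finsetSum _ fun k _ => hC s _
    refine tendsto_nhds_unique h1 (tendsto_const_nhds.congr' ?_)
    filter_upwards [hpos] with t ht
    have h2 : ∑ s, ∑ i, l t s i = 0 := by rw [sum_comm]; exact sum_eq_zero fun i _ => (hyU t i).log_sum
    have h3 : ∑ s, ∑ k, -l t s ((i0 s).succAbove k) = h t := by
      have h4 : ∀ s, ∑ i, l t s i = l t s (i0 s) + ∑ k, l t s ((i0 s).succAbove k) := fun s => Fin.sum_univ_succAbove _ _
      simp only [h4, sum_add_distrib] at h2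
      simp only [sum_neg_distrib, hh]
      linarith
    simp only [← sum_div, h3, div_self ht.ne']
  have hmp : (0:ℝ) < m := by exact_mod_cast hm
  set σc : ℝ := (Fintype.card D.σ : ℝ) with hσc
  have hσp : 0 < σc := by rw [hσc]; exact_mod_cast Fintype.card_pos_iff.2 ⟨D.s0⟩
  set ε := 1 / (2 * m * σc) with hε
  have hεp : 0 < ε := by positivity
  have hel : EL 𝒰 h (fun t => D.H L c (h t) (z t)) (σc * ε) := by
    refine ((EL.exp hht (σc * ε)).cmul hht (fun t => (Real.exp_pos _).le) (m ^ Fintype.card D.σ)).mono hht le_rfl ?_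
    filter_upwards [hLz, hpos, eventually_all.2 fun s => eventually_all.2 fun i => (hC s i).eventually (lt_mem_nhds (sub_lt_self _ hεp))] with t h1 h2 h3
    have h4 : ∀ s, D.Nv L c (h t) s (z t) ≤ m * Real.exp (ε * h t) := fun s => by
      unfold SD.Nv
      calc _ ≤ ∑ k : Fin m, Real.exp (ε * h t) := sum_le_sum fun k _ => by
            rw [h1, hvl, ← Real.exp_add]
            refine Real.exp_le_exp.2 ?_
            have := h3 s ((i0 s).succAbove k)
            rw [lt_div_iff₀ h2] at this
            simp only [hc]; linarith
        _ = _ := by simp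
    calc D.H L c (h t) (z t) ≤ ∏ s : D.σ, m * Real.exp (ε * h t) := prod_le_prod (fun s _ => Nv_nonneg _ _) fun s _ => h4 s
      _ = _ := by rw [prod_const, mul_pow, ← Real.exp_nat_mul, card_univ, ← hσc, mul_assoc]
  obtain ⟨W, hW, hzW⟩ := thmE L c hht z (Eventually.of_forall fun t k => (hyU t _).2.1) (Eventually.of_forall fun t h0 => (hyU t (Fin.castSucc ⟨0, hm⟩)).1 (congrFun h0 ⟨0, hm⟩)) hel
    (by rw [hc1, hε]; field_simp; norm_num)
  obtain ⟨f, hf0, hfW⟩ := Submodule.exists_le_ker_of_lt_top W (lt_top_iff_ne_top.2 hW)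
  set a' : Fin m → K := fun k => f (Pi.single k 1) with ha'
  have hfz : ∀ z, f z = ∑ k, a' k * z k := fun z => by
    conv_lhs => rw [pi_eq_sum_univ' z]
    simp only [map_sum, map_smul, smul_eq_mul, ha', mul_comm]
  set S := univ.filter fun k => a' k ≠ 0 with hS
  have hS0 : 0 < S.card := card_pos.2 (by
    by_contra hne
    rw [not_nonempty_iff_eq_empty, filter_eq_empty_iff] at hne
    refine hf0 (LinearMap.ext fun z => ?_)
    rw [hfz]
    exact sum_eq_zero fun k _ => by rw [not_not.1 (hne (mem_univ k)), zero_mul])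
  have hS1 : S.card < m + 1 := by have := card_le_univ S; simp at this; omega
  set e := S.equivFin.symm with he
  obtain ⟨i, j, hij, r, hr⟩ := ih S.card hS1 (fun k => a' (e k)) (fun k => (mem_filter.1 (e k).2).2) (fun t k => y t (e k : Fin m).castSucc) (fun t k => hyU t _) hS0 (by
    filter_upwards [hzW] with t ht
    have h1 := hfz (z t)
    rw [LinearMap.mem_ker.1 (hfW ht)] at h1
    rw [Equiv.sum_comp e (fun k : S => a' k * y t (k : Fin m).castSucc), sum_coe_sort S (fun k => a' k * y t k.castSucc), h1, hS, sum_filter]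
    refine sum_congr rfl fun k _ => ?_
    by_cases h0 : a' k = 0 <;> simp [h0, hz])
  refine ⟨_, _, fun hc => hij (e.injective (Subtype.ext (Fin.castSucc_injective _ hc))), r, hr.mono fun t ht => ?_⟩
  rw [hxy, ht, hxy t (Fin.castSucc (e j : Fin m)), mul_assoc]
end Lau
end
end
section
open Filter Finset NumberField Height
noncomputable section
namespace Lau
def rp {K : Type} [Field K] (w : AbsoluteValue K ℝ) (r : ℝ) (h0 : 0 < r) (h1 : r ≤ 1) : AbsoluteValue K ℝ where
  toFun a := w a ^ r
  map_mul' a b := by rw [map_mul, Real.mul_rpow (w.nonneg _) (w.nonneg _)]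
  nonneg' a := Real.rpow_nonneg (w.nonneg a) r
  eq_zero' a := by simp [Real.rpow_eq_zero (w.nonneg a) h0.ne']
  add_le' a b := (Real.rpow_le_rpow (w.nonneg _) (w.add_le _ _) h0.le).trans (Real.rpow_add_le_add_rpow (w.nonneg _) (w.nonneg _) h0.le h1)
variable (K : Type) [Field K] [NumberField K] (S : Finset (FinitePlace K))
abbrev Sg := InfinitePlace K ⊕ S
def nv : Sg K S → AbsoluteValue K ℝ := Sum.elim (fun w => w.1) (fun p => p.1.1)
def me : Sg K S → ℝ := Sum.elim (fun _ => 2) (fun _ => 1)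
def dg : ℝ := Module.finrank ℚ K
lemma dg_ge : 1 ≤ dg K := by unfold dg; exact_mod_cast Module.finrank_pos (R := ℚ) (M := K)
variable {K S}
lemma me_ge (s : Sg K S) : 1 ≤ me K S s ∧ me K S s ≤ 2 := by rcases s with w | p <;> simp [me]
lemma ex_pos (s : Sg K S) : 0 < me K S s / (2 * dg K) :=
  div_pos (by linarith [(me_ge s).1]) (by linarith [dg_ge K])
lemma ex_le (s : Sg K S) : me K S s / (2 * dg K) ≤ 1 := by
  rw [div_le_one (by linarith [dg_ge K])]; linarith [dg_ge K, (me_ge s).2]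
variable (K S) in
def vS (s : Sg K S) : AbsoluteValue K ℝ := rp (nv K S s) (me K S s / (2 * dg K)) (ex_pos s) (ex_le s)
lemma vS_def (s : Sg K S) (a : K) : vS K S s a = nv K S s a ^ (me K S s / (2 * dg K)) := rfl
lemma log_vS (s : Sg K S) (a : K) : Real.log (vS K S s a) = me K S s / (2 * dg K) * Real.log (nv K S s a) := by
  by_cases ha : a = 0
  · simp [ha]
  · rw [vS_def, Real.log_rpow ((nv K S s).pos ha)]
lemma places [IsTotallyComplex K] (S : Finset (FinitePlace K)) (ξ : K) {c : K} (hc : c ≠ 0) : ∃ F, S ⊆ F ∧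
    logHeight₁ ξ = ∑ w : InfinitePlace K, 2 * Real.posLog (w ξ) + ∑ p ∈ F, Real.posLog (p ξ) ∧
    ∑ w : InfinitePlace K, 2 * Real.log (w c) + ∑ p ∈ F, Real.log (p c) = 0 := by
  classical
  have h2 := FinitePlace.hasFiniteMulSupport hc
  have h1 : (Function.support fun p : FinitePlace K => Real.posLog (p ξ)).Finite := by
    by_cases h : ξ = 0
    · simp [h]
    · exact (FinitePlace.hasFiniteMulSupport h).subset fun p hp h1 => hp (by simp [h1])
  refine ⟨S ∪ h1.toFinset ∪ Set.Finite.toFinset h2, fun p hp => by simp [hp], ?_, ?_⟩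
  · rw [NumberField.logHeight₁_eq, finsum_eq_sum_of_support_subset (s := S ∪ h1.toFinset ∪ Set.Finite.toFinset h2) _ (fun p hp => mem_union_left _ (mem_union_right _ (h1.mem_toFinset.2 hp)))]
    simp [IsTotallyComplex.mult_eq]
  · have h := congrArg Real.log (prod_abs_eq_one hc)
    rw [finprod_eq_prod_of_mulSupport_subset (s := S ∪ h1.toFinset ∪ Set.Finite.toFinset h2) _ (fun p hp => mem_union_right _ ((Set.Finite.mem_toFinset h2).2 hp)), Real.log_one, Real.log_mul, Real.log_prod, Real.log_prod] at h
    · simpa [IsTotallyComplex.mult_eq] using h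
    · exact fun p _ => (map_ne_zero p).2 hc
    · exact fun w _ => pow_ne_zero _ ((map_ne_zero w).2 hc)
    · exact prod_ne_zero_iff.2 fun w _ => pow_ne_zero _ ((map_ne_zero w).2 hc)
    · exact prod_ne_zero_iff.2 fun p _ => (map_ne_zero p).2 hc
lemma sum_Sg (f : Sg K S → ℝ) : ∑ s, f s = ∑ w, f (Sum.inl w) + ∑ p : S, f (Sum.inr p) := Fintype.sum_sum_type f
lemma posLog_le_ht [IsTotallyComplex K] (s : Sg K S) (a : K) : me K S s * Real.posLog (nv K S s a) ≤ logHeight₁ a := by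
  obtain ⟨F, hF, h1, -⟩ := places S a (one_ne_zero (α := K))
  have h2 : 0 ≤ ∑ w : InfinitePlace K, 2 * Real.posLog (w a) := sum_nonneg fun _ _ => mul_nonneg zero_le_two Real.posLog_nonneg
  have h3 : 0 ≤ ∑ p ∈ F, Real.posLog (p a) := sum_nonneg fun _ _ => Real.posLog_nonneg
  rw [h1]
  rcases s with w | p
  · have := single_le_sum (f := fun w : InfinitePlace K => 2 * Real.posLog (w a)) (fun _ _ => mul_nonneg zero_le_two Real.posLog_nonneg) (mem_univ w)
    exact this.trans (by linarith)
  · have := single_le_sum (f := fun p : FinitePlace K => Real.posLog (p a)) (fun _ _ => Real.posLog_nonneg) (hF p.2)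
    exact (one_mul _).le.trans (this.trans (by linarith))
lemma ht_le [IsTotallyComplex K] {a : K} (ha : ∀ p : FinitePlace K, p ∉ S → p a ≤ 1) : logHeight₁ a ≤ ∑ s, me K S s * Real.posLog (nv K S s a) := by
  obtain ⟨F, hF, h1, -⟩ := places S a (one_ne_zero (α := K))
  rw [h1, sum_Sg, ← sum_subset hF, ← sum_coe_sort S]
  · exact le_of_eq (by congr 1; exact sum_congr rfl fun p _ => (one_mul _).symm)
  · intro p _ hp
    rw [Real.posLog_eq_zero_iff, abs_of_nonneg (apply_nonneg p a)]; exact ha p hp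
open Polynomial in
lemma rothA (w : InfinitePlace K) (g : K[X]) (hg : g ≠ 0) (ξ : K) (e : ℕ) (h : (X - C ξ) ^ e ∣ g) :
    e * Real.posLog (w ξ) + Real.log (w g.leadingCoeff) ≤ Real.log (∑ i ∈ g.support, w (g.coeff i)) := by
  obtain ⟨q, rfl⟩ := h
  have hq : q ≠ 0 := right_ne_zero_of_mul hg
  have hl : ((X - C ξ) ^ e * q).leadingCoeff = q.leadingCoeff := by simp [((monic_X_sub_C ξ).pow e).leadingCoeff]
  have hw : ∀ a, w a = ‖w.embedding a‖ := fun a => (w.norm_embedding_eq a).symm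
  have h1 := mahlerMeasure_le_sum_norm_coeff ((((X - C ξ) ^ e * q)).map w.embedding)
  have h2 : ((((X - C ξ) ^ e * q)).map w.embedding).sum (fun _ a => ‖a‖) = ∑ i ∈ ((X - C ξ) ^ e * q).support, w (((X - C ξ) ^ e * q).coeff i) := by
    rw [Polynomial.sum, Polynomial.support_map_of_injective _ w.embedding.injective]
    exact sum_congr rfl fun i _ => by rw [coeff_map, hw]
  have h3 : max 1 (w ξ) ^ e * w q.leadingCoeff ≤ ((((X - C ξ) ^ e * q)).map w.embedding).mahlerMeasure := by
    have h4 : ∀ k : ℕ, ((X - C (w.embedding ξ)) ^ k).mahlerMeasure = max 1 (w ξ) ^ k := fun k => by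
      induction k with
      | zero => simp
      | succ k ih => rw [pow_succ, mahlerMeasure_mul, ih, mahlerMeasure_X_sub_C, ← hw, pow_succ]
    rw [Polynomial.map_mul, Polynomial.map_pow, Polynomial.map_sub, map_X, map_C, mahlerMeasure_mul, h4]
    refine mul_le_mul_of_nonneg_left ?_ (by positivity)
    have := leadingCoeff_le_mahlerMeasure (q.map w.embedding)
    rwa [leadingCoeff_map, ← hw] at this
  have h5 : 0 < w q.leadingCoeff := InfinitePlace.pos_iff.2 (leadingCoeff_ne_zero.2 hq)
  have h6 := Real.log_le_log (by positivity) (h3.trans (h1.trans h2.le))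
  rwa [Real.log_mul (by positivity) h5.ne', Real.log_pow, ← hl, ← Real.posLog_eq_log_max_one (apply_nonneg w ξ)] at h6
open Polynomial in
lemma rothB (p : FinitePlace K) (g : K[X]) (hg : g ≠ 0) (ξ : K) (e : ℕ) (h : (X - C ξ) ^ e ∣ g) :
    ∃ i ∈ g.support, e * Real.posLog (p ξ) + Real.log (p g.leadingCoeff) ≤ Real.log (p (g.coeff i)) := by
  obtain ⟨q, rfl⟩ := h
  have hq : q ≠ 0 := right_ne_zero_of_mul hg
  have hl : ((X - C ξ) ^ e * q).leadingCoeff = q.leadingCoeff := by simp [((monic_X_sub_C ξ).pow e).leadingCoeff]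
  have hna : IsNonarchimedean p.1 := fun a b => FinitePlace.add_le p a b
  have h0 : 0 < p q.leadingCoeff := FinitePlace.pos_iff.2 (leadingCoeff_ne_zero.2 hq)
  obtain ⟨i, hi⟩ := exists_eq_gaussNorm p.1 1 ((X - C ξ) ^ e * q)
  have h1 : max 1 (p ξ) ≤ (X - C ξ).gaussNorm p.1 1 := by
    refine max_le ?_ ?_
    · have h2 := le_gaussNorm p.1 (X - C ξ) (c := 1) zero_le_one 1
      rwa [coeff_sub, coeff_X_one, coeff_C_succ, sub_zero, map_one, one_pow, mul_one] at h2
    · have h2 := le_gaussNorm p.1 (X - C ξ) (c := 1) zero_le_one 0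
      rwa [coeff_sub, coeff_X_zero, coeff_C_zero, zero_sub, AbsoluteValue.map_neg, pow_zero, mul_one] at h2
  have h4 : ∀ k : ℕ, max 1 (p ξ) ^ k ≤ ((X - C ξ) ^ k).gaussNorm p.1 1 := fun k => by
    induction k with
    | zero => rw [pow_zero, pow_zero, ← C_1, gaussNorm_C]; simp
    | succ k ih => rw [pow_succ, pow_succ, gaussNorm_mul hna one_pos]; exact mul_le_mul ih h1 (by positivity) (gaussNorm_nonneg _ _ zero_le_one)
  have h5 : p q.leadingCoeff ≤ q.gaussNorm p.1 1 := by
    have h2 := le_gaussNorm p.1 q (c := 1) zero_le_one q.natDegree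
    rwa [one_pow, mul_one] at h2
  rw [gaussNorm_mul hna one_pos, one_pow, mul_one] at hi
  have h6 : max 1 (p ξ) ^ e * p q.leadingCoeff ≤ p (((X - C ξ) ^ e * q).coeff i) := by
    refine le_trans ?_ hi.le
    exact mul_le_mul (h4 e) h5 h0.le ((by positivity : (0:ℝ) ≤ max 1 (p ξ) ^ e).trans (h4 e))
  have h7 : 0 < max 1 (p ξ) ^ e * p q.leadingCoeff := by positivity
  refine ⟨i, mem_support_iff.2 (FinitePlace.pos_iff.1 (h7.trans_le h6)), ?_⟩
  have h8 := Real.log_le_log h7 h6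
  rwa [Real.log_mul (by positivity) h0.ne', Real.log_pow, ← hl, ← Real.posLog_eq_log_max_one (apply_nonneg p ξ)] at h8
lemma rpow_sum_le {ι : Type*} (F : Finset ι) (f : ι → ℝ) (hf : ∀ i, 0 ≤ f i) {r : ℝ} (h0 : 0 < r) (h1 : r ≤ 1) : (∑ i ∈ F, f i) ^ r ≤ ∑ i ∈ F, f i ^ r := by
  classical
  induction F using Finset.induction_on with
  | empty => simp [Real.zero_rpow h0.ne']
  | insert a F ha ih =>
    rw [sum_insert ha, sum_insert ha]
    exact (Real.rpow_add_le_add_rpow (hf a) (sum_nonneg fun i _ => hf i) h0.le h1).trans (by linarith)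
open Polynomial in
lemma rothC [IsTotallyComplex K] (g : K[X]) (hg : g ≠ 0) (hR : ∀ i, ∀ p : FinitePlace K, p ∉ S → p (g.coeff i) ≤ 1) (ξ : K) (e : ℕ) (h : (X - C ξ) ^ e ∣ g) :
    e * (1 / (2 * dg K) * logHeight₁ ξ) ≤ ∑ s, Real.log (∑ i ∈ g.support, vS K S s (g.coeff i)) := by
  have hd := dg_ge K
  obtain ⟨F, hF, h1, h2⟩ := places S ξ (leadingCoeff_ne_zero.2 hg)
  have h3 : ∀ p ∈ F, p ∉ S → e * Real.posLog (p ξ) + Real.log (p g.leadingCoeff) ≤ 0 := fun p _ hp => by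
    obtain ⟨i, -, hi⟩ := rothB p g hg ξ e h
    exact hi.trans (Real.log_nonpos (apply_nonneg p _) (hR i p hp))
  have h4 : ∀ s : Sg K S, 1 / (2 * dg K) * (me K S s * (e * Real.posLog (nv K S s ξ) + Real.log (nv K S s g.leadingCoeff))) ≤ Real.log (∑ i ∈ g.support, vS K S s (g.coeff i)) := fun s => by
    have hm := (me_ge s).1
    rcases s with w | p
    · refine le_trans ?_ (Real.log_le_log ?_ (rpow_sum_le g.support (fun i => w (g.coeff i)) (fun i => apply_nonneg w _) (ex_pos (S := S) (Sum.inl w)) (ex_le (Sum.inl w))))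
      · rw [Real.log_rpow]
        · rw [← mul_assoc, one_div_mul_eq_div]
          exact mul_le_mul_of_nonneg_left (rothA w g hg ξ e h) (ex_pos _).le
        · exact sum_pos (fun i hi => InfinitePlace.pos_iff.2 (mem_support_iff.1 hi)) (nonempty_support_iff.2 hg)
      · exact Real.rpow_pos_of_pos (sum_pos (fun i hi => InfinitePlace.pos_iff.2 (mem_support_iff.1 hi)) (nonempty_support_iff.2 hg)) _
    · obtain ⟨i, his, hi⟩ := rothB p.1 g hg ξ e h
      have h5 : Real.log (vS K S (Sum.inr p) (g.coeff i)) ≤ Real.log (∑ i ∈ g.support, vS K S (Sum.inr p) (g.coeff i)) :=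
        Real.log_le_log (AbsoluteValue.pos _ (mem_support_iff.1 his)) (single_le_sum (f := fun i => vS K S (Sum.inr p) (g.coeff i)) (fun _ _ => AbsoluteValue.nonneg _ _) his)
      refine le_trans ?_ h5
      rw [log_vS, ← mul_assoc, one_div_mul_eq_div]
      exact mul_le_mul_of_nonneg_left hi (ex_pos _).le
  refine le_trans ?_ (sum_le_sum fun s _ => h4 s)
  rw [← mul_sum, mul_left_comm]
  refine mul_le_mul_of_nonneg_left ?_ (by positivity)
  rw [sum_Sg]
  have h6 : ∑ p ∈ F, (e * Real.posLog (p ξ) + Real.log (p g.leadingCoeff)) ≤ ∑ p : S, (e * Real.posLog (p.1 ξ) + Real.log (p.1 g.leadingCoeff)) := by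
    classical
    rw [sum_coe_sort S (fun p => e * Real.posLog (p ξ) + Real.log (p g.leadingCoeff)), ← sum_sdiff hF]
    have := sum_nonpos (s := F \ S) fun p hp => h3 p (mem_sdiff.1 hp).1 (mem_sdiff.1 hp).2
    linarith
  have h7 : ∑ p : S, (e * Real.posLog (p.1 ξ) + Real.log (p.1 g.leadingCoeff)) = ∑ p : S, me K S (Sum.inr p) * (e * Real.posLog (nv K S (Sum.inr p) ξ) + Real.log (nv K S (Sum.inr p) g.leadingCoeff)) :=
    sum_congr rfl fun p _ => (one_mul _).symm
  have h8 : ∑ w : InfinitePlace K, me K S (Sum.inl w) * (e * Real.posLog (nv K S (Sum.inl w) ξ) + Real.log (nv K S (Sum.inl w) g.leadingCoeff)) = e * ∑ w : InfinitePlace K, 2 * Real.posLog (w ξ) + ∑ w : InfinitePlace K, 2 * Real.log (w g.leadingCoeff) := by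
    rw [mul_sum, ← sum_add_distrib]
    exact sum_congr rfl fun w _ => by show 2 * (_ * Real.posLog (w ξ) + Real.log (w _)) = _; ring
  rw [sum_add_distrib, ← mul_sum] at h6
  rw [← h7, h8, h1]
  linarith
end Lau
end
end
section
open Filter Finset NumberField Height
noncomputable section
namespace Lau
variable {K : Type} [Field K] [NumberField K] {S : Finset (FinitePlace K)}
lemma fp_le_one (p : FinitePlace K) {x : K} (hx : IsIntegral ℤ x) : p x ≤ 1 := by
  rw [← FinitePlace.norm_embedding_eq]
  exact FinitePlace.norm_le_one K p.maximalIdeal (⟨x, hx⟩ : 𝓞 K)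
lemma cellA (w : InfinitePlace K) {X : Type} (u : X → K) {B τ : ℝ} (hτ : 0 < τ) (hB : τ ≤ B) (hu : ∀ x, w (u x) ≤ B) :
    ∃ k : ℕ, ∃ F : X → Fin k, (k : ℝ) ≤ (8 * B / τ) ^ 2 ∧ ∀ x y, F x = F y → w (u x - u y) ≤ τ := by
  set I : Finset ℤ := Icc ⌊-(2 * B / τ)⌋ ⌊2 * B / τ⌋ with hI
  have hn : ∀ x, ‖w.embedding (u x)‖ ≤ B := fun x => (w.norm_embedding_eq _).le.trans (hu x)
  have hm : ∀ r : ℝ, |r| ≤ B → ⌊2 * r / τ⌋ ∈ I := fun r hr => by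
    rw [abs_le] at hr
    rw [hI, mem_Icc]
    refine ⟨Int.floor_le_floor ?_, Int.floor_le_floor ?_⟩
    · rw [← neg_div]; gcongr; linarith
    · gcongr; linarith
  have hcl : ∀ r r' : ℝ, ⌊2 * r / τ⌋ = ⌊2 * r' / τ⌋ → |r - r'| ≤ τ / 2 := fun r r' h => by
    have h1 := Int.abs_sub_lt_one_of_floor_eq_floor h
    rw [← sub_div, ← mul_sub, abs_div, abs_mul, abs_two, abs_of_pos hτ, div_lt_one hτ] at h1
    linarith
  have hk : (I.card : ℝ) ≤ 8 * B / τ := by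
    have h1 : 1 ≤ B / τ := (one_le_div hτ).2 hB
    have h2 := Int.floor_le (2 * B / τ)
    have h3 := Int.sub_one_lt_floor (-(2 * B / τ))
    have h4 : ⌊-(2 * B / τ)⌋ ≤ ⌊2 * B / τ⌋ := Int.floor_le_floor (by rw [mul_div_assoc]; linarith)
    have h5 : 2 * B / τ = 2 * (B / τ) := mul_div_assoc _ _ _
    have h6 : 8 * B / τ = 8 * (B / τ) := mul_div_assoc _ _ _
    rw [hI, Int.card_Icc, ← Int.cast_natCast, Int.toNat_of_nonneg (by linarith)]
    push_cast
    linarith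
  let G : X → I × I := fun x => (⟨_, hm _ ((Complex.abs_re_le_norm _).trans (hn x))⟩, ⟨_, hm _ ((Complex.abs_im_le_norm _).trans (hn x))⟩)
  refine ⟨_, fun x => Fintype.equivFin _ (G x), ?_, fun x y h => ?_⟩
  · rw [Fintype.card_prod, Fintype.card_coe, Nat.cast_mul, ← sq]; gcongr
  · have h1 := (Fintype.equivFin _).injective h
    have h2 := hcl _ _ (congrArg (fun q => (q.1 : ℤ)) h1)
    have h3 := hcl _ _ (congrArg (fun q => (q.2 : ℤ)) h1)
    rw [← w.norm_embedding_eq, map_sub]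
    refine (Complex.norm_le_abs_re_add_abs_im _).trans ?_
    rw [Complex.sub_re, Complex.sub_im]; linarith
lemma fp_pow (p : FinitePlace K) (j : ℕ) (o : 𝓞 K) (h : o ∈ p.maximalIdeal.asIdeal ^ j) : p (o : K) * (p.maximalIdeal.asIdeal.absNorm : ℝ) ^ j ≤ 1 := by
  by_cases ho : o = 0
  · simp [ho]
  rw [← FinitePlace.apply_mul_absNorm_pow_eq_one p ho]
  have h1 : 1 < (p.maximalIdeal.asIdeal.absNorm : ℝ) := by exact_mod_cast HeightOneSpectrum.one_lt_absNorm p.maximalIdeal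
  refine mul_le_mul_of_nonneg_left (pow_le_pow_right₀ h1.le ?_) (apply_nonneg p _)
  refine FiniteMultiplicity.le_multiplicity_of_pow_dvd ?_ (Ideal.dvd_iff_le.2 ((Ideal.span_singleton_le_iff_mem _).2 h))
  exact FiniteMultiplicity.of_prime_left p.maximalIdeal.prime (by simpa using ho)
lemma cellB (p : FinitePlace K) {X : Type} (u : X → K) {D : ℤ} (hD0 : D ≠ 0) (hD : ∀ x, IsIntegral ℤ (D * u x)) {τ : ℝ} (hτ : 0 < τ) (hτ1 : τ ≤ 1) :
    ∃ k : ℕ, ∃ F : X → Fin k, (k : ℝ) ≤ (p.maximalIdeal.asIdeal.absNorm : ℝ) / p (D : K) / τ ∧ ∀ x y, F x = F y → p (u x - u y) ≤ τ := by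
  set q : ℝ := (p.maximalIdeal.asIdeal.absNorm : ℝ) with hq
  have h1 : 1 < q := by rw [hq]; exact_mod_cast HeightOneSpectrum.one_lt_absNorm p.maximalIdeal
  have hpD : 0 < p (D : K) := FinitePlace.pos_iff.2 (by exact_mod_cast hD0)
  have hpD1 : p (D : K) ≤ 1 := fp_le_one p (by simpa using isIntegral_algebraMap (R := ℤ) (A := K) (x := D))
  obtain ⟨m, hm1, hm2⟩ := exists_nat_pow_near (x := (p (D : K) * τ)⁻¹) ((one_le_inv₀ (by positivity)).2 (mul_le_one₀ hpD1 hτ.le hτ1)) h1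
  set P := p.maximalIdeal.asIdeal ^ (m + 1) with hP
  have hP0 : P ≠ ⊥ := pow_ne_zero _ p.maximalIdeal.ne_bot
  have : Finite (𝓞 K ⧸ P) := Ideal.finiteQuotientOfFreeOfNeBot P hP0
  refine ⟨Nat.card (𝓞 K ⧸ P), fun x => Finite.equivFin _ (Ideal.Quotient.mk P ⟨_, hD x⟩), ?_, fun x y h => ?_⟩
  · have h2 : (Nat.card (𝓞 K ⧸ P) : ℝ) = q ^ (m + 1) := by
      rw [hq, ← Nat.cast_pow, ← map_pow]; rfl
    rw [h2, pow_succ]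
    calc _ ≤ (p (D : K) * τ)⁻¹ * q := by gcongr
      _ = _ := by field_simp
  · have h2 := fp_pow p _ _ (Ideal.Quotient.eq.1 ((Finite.equivFin _).injective h))
    have h3 : ((⟨_, hD x⟩ - ⟨_, hD y⟩ : 𝓞 K) : K) = D * (u x - u y) := by rw [mul_sub]; rfl
    rw [h3, map_mul] at h2
    have h4 : p (D : K) * p (u x - u y) ≤ p (D : K) * τ := by
      rw [← hq, ← le_div_iff₀ (by positivity), one_div] at h2
      exact h2.trans ((inv_le_comm₀ (by positivity) (by positivity)).2 hm2.le)
    exact le_of_mul_le_mul_left h4 hpD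
end Lau
end
end
section
open Filter Finset NumberField Height
noncomputable section
namespace Lau
variable {K : Type} [Field K] [NumberField K] {S : Finset (FinitePlace K)}
lemma fmA [IsTotallyComplex K] {n : ℕ} (L : Sg K S → (Fin n → K) →ₗ[K] (Fin n → K)) : ∃ C : ℝ, 0 < C ∧ ∀ τ : Sg K S → Fin n → ℝ, (∀ s i, 0 < τ s i) →
    (∀ p i, τ (Sum.inr p) i ≤ 1) → C < ∏ s, ∏ i, τ s i ^ me K S s →
    ∃ z : Fin n → K, z ≠ 0 ∧ (∀ i, IsIntegral ℤ (z i)) ∧ ∀ s i, nv K S s (L s z i) ≤ τ s i := by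
  classical
  let b := Pi.basis (fun _ : Fin n => integralBasis K)
  have hbi : ∀ x j, IsIntegral ℤ (b x j) := fun x j => by
    rw [Pi.basis_apply, Pi.single_apply]
    split_ifs
    · rw [integralBasis_apply]; exact RingOfIntegers.isIntegral_coe _
    · exact isIntegral_zero
  obtain ⟨D, hD0, hD⟩ := exists_integral_multiples ℤ ℚ (univ.image fun q : Sg K S × Fin n × _ => L q.1 (b q.2.2) q.2.1)
  have hD' : ∀ s i x, IsIntegral ℤ ((D : K) * L s (b x) i) := fun s i x => by
    rw [← zsmul_eq_mul]; exact hD _ (mem_image_of_mem _ (mem_univ (s, i, x)))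
  let C0 : ℝ := 1 + ∑ q : Sg K S × Fin n × _, nv K S q.1 (L q.1 (b q.2.2) q.2.1)
  have hC1 : 1 ≤ C0 := le_add_of_nonneg_right (sum_nonneg fun _ _ => (nv K S _).nonneg _)
  have hC0 : ∀ s i, ∑ x, nv K S s (L s (b x) i) ≤ C0 := fun s i => by
    have h : ∑ x, nv K S s (L s (b x) i) = ∑ q ∈ univ.map ⟨fun x => (s, i, x), fun x y h => by simpa using h⟩, nv K S q.1 (L q.1 (b q.2.2) q.2.1) := by
      rw [sum_map]; rfl
    rw [h]
    exact (sum_le_sum_of_subset_of_nonneg (subset_univ _) fun _ _ _ => (nv K S _).nonneg _).trans (by simp only [C0]; linarith)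
  let A : Sg K S → ℝ := Sum.elim (fun _ => (8 * C0) ^ 2) (fun p => (p.1.maximalIdeal.asIdeal.absNorm : ℝ) / p.1 (D : K))
  let m : Sg K S → ℕ := Sum.elim (fun _ => 2) (fun _ => 0)
  have hA : ∀ s, 0 < A s := by
    rintro (w | p)
    · exact pow_pos (by linarith) 2
    · have h1 : 1 < (p.1.maximalIdeal.asIdeal.absNorm : ℝ) := by exact_mod_cast HeightOneSpectrum.one_lt_absNorm p.1.maximalIdeal
      exact div_pos (by linarith) (FinitePlace.pos_iff.2 (by exact_mod_cast hD0))
  refine ⟨∏ s, ∏ i : Fin n, A s, prod_pos fun s _ => prod_pos fun i _ => hA s, fun τ hτ hτ1 hC => ?_⟩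
  obtain ⟨M, hM⟩ := exists_nat_gt (1 + ∑ s, ∑ i, τ s i)
  have hτM : ∀ s i, τ s i ≤ M := fun s i => by
    have h1 := single_le_sum (f := fun i => τ s i) (fun i _ => (hτ s i).le) (mem_univ i)
    have h2 := single_le_sum (f := fun s => ∑ i, τ s i) (fun s _ => sum_nonneg fun i _ => (hτ s i).le) (mem_univ s)
    linarith
  have hM0 : 0 < (M : ℝ) := lt_of_le_of_lt (add_nonneg zero_le_one (sum_nonneg fun s _ => sum_nonneg fun i _ => (hτ s i).le)) hM
  let Ez : (_ → Fin M) → Fin n → K := fun a => ∑ x, (a x : ℕ) • b x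
  have hEL : ∀ s i a, L s (Ez a) i = ∑ x, (a x : ℕ) • L s (b x) i := fun s i a => by
    simp only [Ez, map_sum, map_nsmul, Finset.sum_apply, Pi.smul_apply]
  have hcell : ∀ s i, ∃ k : ℕ, ∃ F : (_ → Fin M) → Fin k, (k : ℝ) ≤ A s * M ^ m s / τ s i ^ me K S s ∧
      ∀ x y, F x = F y → nv K S s (L s (Ez x) i - L s (Ez y) i) ≤ τ s i := by
    rintro (w | p) i
    · obtain ⟨k, F, h1, h2⟩ := cellA w (fun a => L (Sum.inl w) (Ez a) i) (B := C0 * M) (hτ (Sum.inl w) i) (by nlinarith [hτM (Sum.inl w) i]) (fun a => by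
        rw [hEL]
        refine ((w.1.sum_le _ _).trans (sum_le_sum (g := fun x => M * nv K S (Sum.inl w) (L (Sum.inl w) (b x) i)) fun x _ => ?_)).trans ?_
        · rw [nsmul_eq_mul, map_mul]
          refine mul_le_mul_of_nonneg_right ?_ (w.1.nonneg _)
          have : w.1 ((a x : ℕ) : K) = ((a x : ℕ) : ℝ) := by
            rw [← InfinitePlace.coe_apply, ← w.norm_embedding_eq, map_natCast, Complex.norm_natCast]
          rw [this]; exact_mod_cast (a x).2.le
        · rw [← mul_sum, mul_comm]; gcongr; exact hC0 _ i)
      refine ⟨k, F, h1.trans (le_of_eq ?_), h2⟩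
      simp only [A, m, me, Sum.elim_inl, Real.rpow_ofNat]; ring
    · obtain ⟨k, F, h1, h2⟩ := cellB p.1 (fun a => L (Sum.inr p) (Ez a) i) hD0 (fun a => by
        rw [hEL, mul_sum]
        refine IsIntegral.sum _ fun x _ => ?_
        rw [mul_smul_comm]; exact (hD' _ i x).nsmul _) (hτ (Sum.inr p) i) (hτ1 p i)
      refine ⟨k, F, h1.trans (le_of_eq ?_), h2⟩
      simp only [A, m, me, Sum.elim_inr, Real.rpow_one, pow_zero, mul_one]
  choose k F hk hF using hcell
  have hm : ∑ s, m s = Module.finrank ℚ K := by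
    rw [Fintype.sum_sum_type, IsTotallyComplex.finrank]; simp [m, InfinitePlace.card_eq_nrRealPlaces_add_nrComplexPlaces, mul_comm]
  have hcard : Fintype.card ((s : Sg K S) → (i : Fin n) → Fin (k s i)) < Fintype.card ((Σ _ : Fin n, Module.Free.ChooseBasisIndex ℤ (𝓞 K)) → Fin M) := by
    have hd : Fintype.card (Σ _ : Fin n, Module.Free.ChooseBasisIndex ℤ (𝓞 K)) = n * ∑ s, m s := by
      rw [Fintype.card_sigma, hm, Module.finrank_eq_card_basis (integralBasis K)]; simp
    rw [Fintype.card_fun, Fintype.card_fin, hd]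
    simp only [Fintype.card_pi, Fintype.card_fin]
    rw [← Nat.cast_lt (α := ℝ)]
    push_cast
    refine (prod_le_prod (fun _ _ => prod_nonneg fun _ _ => Nat.cast_nonneg _) fun s _ => prod_le_prod (fun _ _ => Nat.cast_nonneg _) fun i _ => hk s i).trans_lt ?_
    simp only [prod_div_distrib, prod_mul_distrib]
    rw [div_lt_iff₀ (prod_pos fun s _ => prod_pos fun i _ => Real.rpow_pos_of_pos (hτ s i) _)]
    have h3 : ∏ s, ∏ i : Fin n, (M : ℝ) ^ m s = M ^ (n * ∑ s, m s) := by
      simp only [prod_const, card_univ, Fintype.card_fin]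
      rw [prod_pow, prod_pow_eq_pow_sum, ← pow_mul, mul_comm]
    rw [h3, mul_comm]
    exact mul_lt_mul_of_pos_left hC (by positivity)
  obtain ⟨x, y, hxy, he⟩ := Fintype.exists_ne_map_eq_of_card_lt (fun a s i => F s i a) hcard
  refine ⟨Ez x - Ez y, fun h => hxy ?_, fun i => ?_, fun s i => ?_⟩
  · have h1 : b.equivFun.symm (fun q => ((x q : ℕ) : ℚ)) = b.equivFun.symm (fun q => ((y q : ℕ) : ℚ)) := by
      rw [Module.Basis.equivFun_symm_apply, Module.Basis.equivFun_symm_apply]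
      simpa only [Nat.cast_smul_eq_nsmul] using sub_eq_zero.1 h
    funext q
    have := congrFun (b.equivFun.symm.injective h1) q
    exact Fin.ext (by exact_mod_cast this)
  · have : ∀ a, IsIntegral ℤ (Ez a i) := fun a => by
      simp only [Ez, Finset.sum_apply, Pi.smul_apply]
      exact IsIntegral.sum _ fun q _ => (hbi q i).nsmul _
    exact (this x).sub (this y)
  · rw [map_sub]; exact hF s i x y (congrFun (congrFun he s) i)
end Lau
end
end
section
open Filter Finset NumberField Height
noncomputable section
namespace Lau
variable {K : Type} [Field K] [NumberField K] {S : Finset (FinitePlace K)}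
lemma nv_prod [IsTotallyComplex K] {c : K} (hc : c ≠ 0) (h1 : ∀ p, p ∉ S → p c = 1) : ∏ s, nv K S s c ^ me K S s = 1 := by
  obtain ⟨F, hF, -, h⟩ := places S (0 : K) hc
  have h2 : ∑ s, me K S s * Real.log (nv K S s c) = 0 := by
    rw [← h, sum_Sg, ← sum_subset hF (fun p _ hp => by rw [h1 p hp, Real.log_one]), ← sum_coe_sort S]
    simp [me, nv]; rfl
  rw [← Real.exp_zero, ← h2, Real.exp_sum]
  exact prod_congr rfl fun s _ => by rw [mul_comm, ← Real.rpow_def_of_pos ((nv K S s).pos hc)]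
lemma fmK [IsTotallyComplex K] {N : K} (hN0 : N ≠ 0) (hN : ∀ p, p ∉ S → p N = 1) (hN' : ∀ p ∈ S, p N < 1) {n : ℕ}
    (L : Sg K S → (Fin n → K) →ₗ[K] (Fin n → K)) : ∃ C : ℝ, 0 < C ∧ ∀ τ : Sg K S → Fin n → ℝ, (∀ s i, 0 < τ s i) →
    C < ∏ s, ∏ i, τ s i ^ me K S s →
    ∃ z : Fin n → K, z ≠ 0 ∧ (∀ i, ∀ p, p ∉ S → p (z i) ≤ 1) ∧ ∀ s i, nv K S s (L s z i) ≤ τ s i := by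
  obtain ⟨C, hC, H⟩ := fmA L
  refine ⟨C, hC, fun τ hτ h => ?_⟩
  have hk : ∀ᶠ k : ℕ in atTop, ∀ p : S, ∀ i, p.1 N ^ k * τ (Sum.inr p) i ≤ 1 := by
    refine eventually_all.2 fun p => eventually_all.2 fun i => ?_
    have h1 := (tendsto_pow_atTop_nhds_zero_of_lt_one (apply_nonneg p.1 N) (hN' p.1 p.2)).mul_const (τ (Sum.inr p) i)
    rw [zero_mul] at h1
    exact h1.eventually_le_const zero_lt_one
  obtain ⟨k, hk⟩ := hk.exists
  have hNk : N ^ k ≠ 0 := pow_ne_zero _ hN0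
  have hp : ∀ s, 0 < nv K S s (N ^ k) := fun s => (nv K S s).pos hNk
  obtain ⟨x, hx0, hx1, hx2⟩ := H (fun s i => nv K S s (N ^ k) * τ s i) (fun s i => mul_pos (hp s) (hτ s i))
    (fun p i => by rw [map_pow]; exact hk p i) (by
      have : ∀ s, ∏ i, (nv K S s (N ^ k) * τ s i) ^ me K S s = (nv K S s (N ^ k) ^ me K S s) ^ n * ∏ i, τ s i ^ me K S s := fun s => by
        rw [prod_congr rfl fun i _ => Real.mul_rpow (hp s).le (hτ s i).le, prod_mul_distrib]; simp
      rw [prod_congr rfl fun s _ => this s, prod_mul_distrib, prod_pow, nv_prod hNk (fun p hp => by rw [map_pow, hN p hp, one_pow]), one_pow, one_mul]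
      exact h)
  refine ⟨(N ^ k)⁻¹ • x, smul_ne_zero (inv_ne_zero hNk) hx0, fun i p hpS => ?_, fun s i => ?_⟩
  · rw [Pi.smul_apply, smul_eq_mul, map_mul, map_inv₀, map_pow, hN p hpS, one_pow, inv_one, one_mul]
    exact fp_le_one p (hx1 i)
  · rw [map_smul, Pi.smul_apply, smul_eq_mul, map_mul, map_inv₀]
    exact (inv_mul_le_iff₀ (hp s)).2 (hx2 s i)
lemma fmS [IsTotallyComplex K] {N : K} (hN0 : N ≠ 0) (hN : ∀ p, p ∉ S → p N = 1) (hN' : ∀ p ∈ S, p N < 1) {n : ℕ} (hn : 0 < n)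
    (L : Sg K S → (Fin n → K) ≃ₗ[K] (Fin n → K)) : ∃ C : ℝ, ∀ w : Sg K S → Fin n → ℝ, ∃ z : Fin n → K, z ≠ 0 ∧
      (∀ i, ∀ p, p ∉ S → p (z i) ≤ 1) ∧ ∏ s, ∑ i, Real.exp (w s i) * vS K S s (L s z i) ≤ C * Real.exp ((∑ s, ∑ i, w s i) / n) := by
  obtain ⟨C, hC, H⟩ := fmK hN0 hN hN' (fun s => (L s).toLinearMap)
  have hq : 0 < Fintype.card (Sg K S) := Fintype.card_pos_iff.2 ⟨Sum.inl (Classical.arbitrary _)⟩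
  set q := Fintype.card (Sg K S) with hqd
  have hn' : (1 : ℝ) ≤ n := by exact_mod_cast hn
  have hq' : (1 : ℝ) ≤ q := by exact_mod_cast hq
  have hd := dg_ge K
  refine ⟨(n : ℝ) ^ q * Real.exp (q * C), fun w => ?_⟩
  set W := ∑ s, ∑ i, w s i with hW
  set a := C + W / (n * q) with ha
  have hqa : n * q * a = n * q * C + W := by rw [ha]; field_simp
  obtain ⟨z, h0, h1, h2⟩ := H (fun s i => Real.exp ((a - w s i) / (me K S s / (2 * dg K)))) (fun s i => Real.exp_pos _) (by
    have : ∀ s i, Real.exp ((a - w s i) / (me K S s / (2 * dg K))) ^ me K S s = Real.exp (2 * dg K * (a - w s i)) := fun s i => by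
      have := (me_ge s).1
      rw [← Real.exp_mul]; congr 1; field_simp
    simp only [this, ← Real.exp_sum, ← mul_sum, sum_sub_distrib, sum_const, card_univ, Fintype.card_fin, nsmul_eq_mul]
    rw [← hW, ← hqd]
    have h3 : 2 * dg K * (n * (q * a) - W) = (2 * dg K * n * q) * C := by linear_combination (2 * dg K) * hqa
    have h4 : 1 ≤ 2 * dg K * n * q := by
      have := one_le_mul_of_one_le_of_one_le (one_le_mul_of_one_le_of_one_le (by linarith : 1 ≤ 2 * dg K) hn') hq'
      exact this
    rw [h3]
    have := Real.add_one_le_exp (2 * dg K * n * q * C)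
    nlinarith)
  refine ⟨z, h0, h1, ?_⟩
  have h5 : ∀ s, ∑ i, Real.exp (w s i) * vS K S s (L s z i) ≤ n * Real.exp a := fun s => by
    refine (sum_le_sum (g := fun _ => Real.exp a) fun i _ => ?_).trans (by simp)
    have h6 := Real.rpow_le_rpow ((nv K S s).nonneg _) (h2 s i) (ex_pos s).le
    rw [← Real.exp_mul, div_mul_cancel₀ _ (ex_pos s).ne'] at h6
    rw [vS_def]
    calc _ ≤ Real.exp (w s i) * Real.exp (a - w s i) := by gcongr; exact h6
      _ = _ := by rw [← Real.exp_add]; ring_nf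
  refine (prod_le_prod (fun s _ => sum_nonneg fun i _ => mul_nonneg (Real.exp_nonneg _) ((vS K S s).nonneg _)) fun s _ => h5 s).trans (le_of_eq ?_)
  rw [prod_const, card_univ, ← hqd, mul_pow, ← Real.exp_nat_mul, mul_assoc, ← Real.exp_add]
  congr 2
  field_simp
  linear_combination hqa
end Lau
end
end
section
open Filter Finset NumberField Height
noncomputable section
namespace Lau
variable {K : Type} [Field K] [NumberField K] {S : Finset (FinitePlace K)}
variable (K) in
lemma slX : ∃ c : ℝ, ∀ (α β : Type) [Fintype α] [Fintype β] (a : Matrix α β (𝓞 K)) (A : ℝ), a ≠ 0 → 0 < Fintype.card α → Fintype.card α < Fintype.card β →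
    (∀ k l, house ((algebraMap (𝓞 K) K) (a k l)) ≤ A) → ∃ ξ : β → 𝓞 K, ξ ≠ 0 ∧ a.mulVec ξ = 0 ∧
    ∀ l, house (ξ l).1 ≤ c * ((c * Fintype.card β * A) ^ ((Fintype.card α : ℝ) / (Fintype.card β - Fintype.card α))) := by
  classical
  exact ⟨_, fun α β _ _ a A h1 h2 h3 h4 => house.exists_ne_zero_int_vec_house_le K a h1 h2 h3 rfl h4 rfl⟩
lemma house_le {x : K} {A : ℝ} (hA : 0 ≤ A) (h : ∀ w : InfinitePlace K, w x ≤ A) : house x ≤ A := by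
  unfold house
  rw [pi_norm_le_iff_of_nonneg hA]
  intro φ
  exact h (InfinitePlace.mk φ)
lemma slS : ∃ C : ℝ, 1 ≤ C ∧ ∀ (α β : Type) [Fintype α] [Fintype β] (A : α → β → K) (B : ℝ), 1 ≤ B → (∀ a b, IsIntegral ℤ (A a b)) →
    (∀ s a b, vS K S s (A a b) ≤ B) → 0 < Fintype.card β → 2 * Fintype.card α ≤ Fintype.card β →
    ∃ p : β → K, p ≠ 0 ∧ (∀ b, IsIntegral ℤ (p b)) ∧ (∀ a, ∑ b, A a b * p b = 0) ∧ ∀ s b, vS K S s (p b) ≤ C * Fintype.card β * B := by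
  obtain ⟨c, hc⟩ := slX K
  set c' := max |c| 1
  have hc1 : 1 ≤ c' := le_max_right _ _
  have hcc : |c| ≤ c' := le_max_left _ _
  refine ⟨c' ^ 2, one_le_pow₀ hc1, fun α β _ _ A B hB hA hv hβ hαβ => ?_⟩
  set q : ℝ := (Fintype.card β : ℝ) with hq
  have hq1 : 1 ≤ q := by rw [hq]; exact_mod_cast hβ
  have hbig : 1 ≤ c' ^ 2 * q * B := one_le_mul_of_one_le_of_one_le (one_le_mul_of_one_le_of_one_le (one_le_pow₀ hc1) hq1) hB
  let a : Matrix α β (𝓞 K) := fun i j => ⟨A i j, hA i j⟩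
  by_cases ha : a = 0
  · refine ⟨fun _ => 1, fun h => ?_, fun _ => isIntegral_one, fun i => sum_eq_zero fun j _ => ?_, fun s b => by rw [map_one]; exact hbig⟩
    · obtain ⟨b⟩ := Fintype.card_pos_iff.1 hβ
      exact one_ne_zero (congrFun h b)
    · have : A i j = ((a i j : 𝓞 K) : K) := rfl
      rw [this, ha]; simp
  have hα : 0 < Fintype.card α := by
    rw [Fintype.card_pos_iff]; by_contra h
    rw [not_nonempty_iff] at h
    exact ha (funext fun i => h.elim i)
  have hd := dg_ge K
  have hvw : ∀ (w : InfinitePlace K) x, w x = vS K S (Sum.inl w) x ^ dg K := fun w x => by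
    rw [vS_def, ← Real.rpow_mul ((nv K S _).nonneg _)]
    have : me K S (Sum.inl w) / (2 * dg K) * dg K = 1 := by simp only [me, Sum.elim_inl]; field_simp
    rw [this, Real.rpow_one]; rfl
  have hBd : 1 ≤ B ^ dg K := Real.one_le_rpow hB (by linarith)
  obtain ⟨ξ, h0, h1, h2⟩ := hc α β a (B ^ dg K) ha hα (by omega) (fun k l => house_le (by linarith) fun w => by
    rw [hvw]; exact Real.rpow_le_rpow ((vS K S _).nonneg _) (hv _ k l) (by linarith))
  refine ⟨fun b => ξ b, fun h => h0 (funext fun b => RingOfIntegers.ext (congrFun h b)), fun b => RingOfIntegers.isIntegral_coe _, fun i => ?_, ?_⟩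
  · have := congrArg (algebraMap (𝓞 K) K) (congrFun h1 i)
    rw [Pi.zero_apply, map_zero, Matrix.mulVec, dotProduct, map_sum] at this
    rw [← this]; exact sum_congr rfl fun b _ => (map_mul (algebraMap (𝓞 K) K) (a i b) (ξ b)).symm
  rintro (w | p) b
  · have hpq : 2 * (Fintype.card α : ℝ) ≤ q := by rw [hq]; exact_mod_cast hαβ
    have hp0 : (0 : ℝ) < Fintype.card α := by exact_mod_cast hα
    have hexp : (Fintype.card α : ℝ) / (q - Fintype.card α) ≤ 1 := by rw [div_le_one (by linarith)]; linarith
    have hexp0 : 0 ≤ (Fintype.card α : ℝ) / (q - Fintype.card α) := div_nonneg hp0.le (by linarith)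
    have h3 : |(c * q * B ^ dg K) ^ ((Fintype.card α : ℝ) / (q - Fintype.card α))| ≤ c' * q * B ^ dg K := by
      refine (Real.abs_rpow_le_abs_rpow _ _).trans ?_
      rw [abs_mul, abs_mul, abs_of_nonneg (by linarith : 0 ≤ q), abs_of_nonneg (by linarith : 0 ≤ B ^ dg K)]
      refine (Real.rpow_le_rpow (y := c' * q * B ^ dg K) (by positivity) (by gcongr) hexp0).trans ?_
      exact (Real.rpow_le_rpow_of_exponent_le (one_le_mul_of_one_le_of_one_le (one_le_mul_of_one_le_of_one_le hc1 hq1) hBd) hexp).trans_eq (Real.rpow_one _)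
    have h4 : vS K S (Sum.inl w) (ξ b) ^ dg K ≤ (c' ^ 2 * q * B) ^ dg K := by
      rw [← hvw, ← w.norm_embedding_eq]
      refine (norm_embedding_le_house _ _).trans ((h2 b).trans ?_)
      calc _ ≤ |c * (c * q * B ^ dg K) ^ ((Fintype.card α : ℝ) / (q - Fintype.card α))| := le_abs_self _
        _ ≤ c' * (c' * q * B ^ dg K) := by
          rw [abs_mul]
          exact mul_le_mul hcc h3 (abs_nonneg _) (by linarith)
        _ = c' ^ 2 * q * B ^ dg K := by ring
        _ ≤ (c' ^ 2 * q) ^ dg K * B ^ dg K := by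
          refine mul_le_mul_of_nonneg_right ?_ (by linarith)
          conv_lhs => rw [← Real.rpow_one (c' ^ 2 * q)]
          exact Real.rpow_le_rpow_of_exponent_le (one_le_mul_of_one_le_of_one_le (one_le_pow₀ hc1) hq1) hd
        _ = _ := by rw [← Real.mul_rpow (by positivity) (by linarith)]
    exact (Real.rpow_le_rpow_iff ((vS K S _).nonneg _) (by linarith) (by linarith)).1 h4
  · refine le_trans ?_ hbig
    rw [vS_def]
    exact Real.rpow_le_one ((nv K S _).nonneg _) (fp_le_one p.1 (RingOfIntegers.isIntegral_coe _)) (ex_pos _).le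
end Lau
end
end
section
open Filter Finset NumberField Height
noncomputable section
namespace Lau
variable {K : Type} [Field K] [NumberField K]
def RS (S : Finset (FinitePlace K)) : Subring K where
  carrier := {a | ∀ p, p ∉ S → p a ≤ 1}
  mul_mem' ha hb p hp := by rw [map_mul]; exact mul_le_one₀ (ha p hp) (apply_nonneg p _) (hb p hp)
  one_mem' p _ := (map_one p).le
  add_mem' ha hb p hp := (FinitePlace.add_le p _ _).trans (max_le (ha p hp) (hb p hp))
  zero_mem' p _ := by rw [map_zero]; exact zero_le_one
  neg_mem' {a} ha p hp := by
    have : p (-a) = p a := p.1.map_neg a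
    rw [this]; exact ha p hp
def mkSD [IsTotallyComplex K] {S : Finset (FinitePlace K)} {N : K} (hN0 : N ≠ 0) (hN : ∀ p, p ∉ S → p N = 1) (hN' : ∀ p ∈ S, p N < 1) : SD K where
  σ := Sg K S
  s0 := Sum.inl (Classical.arbitrary _)
  v := vS K S
  O := (integralClosure ℤ K).toSubring
  R := RS S
  le := fun x hx p _ => fp_le_one p hx
  frac a := by
    obtain ⟨D, hD, h⟩ := exists_integral_multiples ℤ ℚ ({a} : Finset K)
    refine ⟨(D : K), ?_, by exact_mod_cast hD, ?_⟩
    · exact (by simpa using isIntegral_algebraMap (R := ℤ) (A := K) (x := D) : IsIntegral ℤ (D : K))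
    · rw [← zsmul_eq_mul]; exact h a (mem_singleton_self a)
  prod_ge a ha h0 := by
    have h := rothC (S := S) (Polynomial.C a) (Polynomial.C_ne_zero.2 h0) (fun i => by
      rw [Polynomial.coeff_C]; split_ifs
      · exact ha
      · intro p _; rw [map_zero]; exact zero_le_one) 0 0 (by simp)
    rw [Polynomial.support_C h0] at h
    simp only [Nat.cast_zero, zero_mul, sum_singleton, Polynomial.coeff_C_zero] at h
    rw [← Real.log_prod fun s _ => ((vS K S s).pos h0).ne'] at h
    exact (Real.log_nonneg_iff (prod_pos fun s _ => (vS K S s).pos h0)).1 h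
  ht a := 1 / (2 * dg K) * logHeight₁ a
  ht_nonneg a := mul_nonneg (by have := dg_ge K; positivity) (zero_le_logHeight₁ a)
  ht_add a b := by
    have hd := dg_ge K
    have h1 := logHeight₁_add_le a b
    rw [totalWeight_eq_finrank] at h1
    have h2 : (0 : ℝ) ≤ Real.log 2 := Real.log_nonneg one_le_two
    have h3 : 1 / (2 * dg K) * logHeight₁ (a + b) ≤ 1 / (2 * dg K) * (dg K * Real.log 2 + logHeight₁ a + logHeight₁ b) := by gcongr; exact h1
    have h4 : 1 / (2 * dg K) * (dg K * Real.log 2 + logHeight₁ a + logHeight₁ b) = Real.log 2 / 2 + 1 / (2 * dg K) * logHeight₁ a + 1 / (2 * dg K) * logHeight₁ b := by field_simp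
    linarith
  ht_mul a b := by
    have hd := dg_ge K
    rw [← mul_add]; gcongr; exact logHeight₁_mul_le a b
  ht_abs s a h0 := by
    have hd := dg_ge K
    have key : ∀ b : K, Real.log (vS K S s b) ≤ 1 / (2 * dg K) * logHeight₁ b := fun b => by
      have h1 : me K S s * Real.log (nv K S s b) ≤ logHeight₁ b :=
        (mul_le_mul_of_nonneg_left (le_max_right 0 _) (by linarith [(me_ge s).1])).trans (posLog_le_ht s b)
      rw [log_vS, div_mul_eq_mul_div, div_eq_inv_mul, ← one_div]
      gcongr
    refine abs_le'.2 ⟨key a, ?_⟩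
    rw [← Real.log_inv, ← map_inv₀, ← logHeight₁_inv]
    exact key _
  roth1 g hg hR ξ e h := rothC g hg hR ξ e h
  fm n hn L := fmS hN0 hN hN' hn L
  sl := by
    obtain ⟨C, h1, h⟩ := slS (K := K) (S := S)
    refine ⟨C, h1, fun α β _ _ A B hB hA hv hb hab => ?_⟩
    obtain ⟨p, a1, a2, a3, a4⟩ := h α β A B hB hA hv hb hab
    exact ⟨p, a1, fun b q _ => fp_le_one q (a2 b), a3, a4⟩
theorem exSD [IsTotallyComplex K] (G : Finset K) (hG : ∀ u ∈ G, u ≠ 0) : ∃ D : SD K, (∀ u ∈ G, D.U u) ∧ ∀ B : ℝ, {a : K | D.U a ∧ ∀ s, D.v s a ≤ B}.Finite := by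
  classical
  obtain ⟨y, hy0, hy⟩ := exists_integral_multiples ℤ ℚ (G ∪ G.image (·⁻¹))
  have hN0 : (y : K) ≠ 0 := by exact_mod_cast hy0
  have hf : {p : FinitePlace K | p (y : K) ≠ 1}.Finite := FinitePlace.hasFiniteMulSupport hN0
  have hN : ∀ p, p ∉ hf.toFinset → p (y : K) = 1 := fun p hp => by
    by_contra h; exact hp ((Set.Finite.mem_toFinset hf).2 h)
  have hy1 : ∀ p : FinitePlace K, p (y : K) ≤ 1 := fun p => fp_le_one p (by simpa using isIntegral_algebraMap (R := ℤ) (A := K) (x := y))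
  have hN' : ∀ p ∈ hf.toFinset, p (y : K) < 1 := fun p hp => lt_of_le_of_ne (hy1 p) ((Set.Finite.mem_toFinset hf).1 hp)
  have hR : ∀ u ∈ G ∪ G.image (·⁻¹), u ∈ RS hf.toFinset := fun u hu p hp => by
    have := fp_le_one p (hy u hu)
    rwa [zsmul_eq_mul, map_mul, hN p hp, one_mul] at this
  refine ⟨mkSD hN0 hN hN', fun u hu => ⟨hG u hu, hR u (mem_union_left _ hu), hR _ (mem_union_right _ (mem_image_of_mem _ hu))⟩, fun B => ?_⟩
  refine (NumberField.finite_setOfPred_logHeight₁_le (K := K) (∑ s : Sg K hf.toFinset, 2 * dg K * Real.posLog B)).subset fun a ha => ?_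
  refine (ht_le (S := hf.toFinset) ha.1.2.1).trans (sum_le_sum fun s _ => ?_)
  have hd := dg_ge K
  have hm := (me_ge s).1
  have h1 : Real.posLog (vS K _ s a) ≤ Real.posLog B := Real.posLog_le_posLog ((vS K _ s).nonneg _) (ha.2 s)
  have h2 : me K _ s * Real.posLog (nv K _ s a) = 2 * dg K * Real.posLog (vS K _ s a) := by
    rw [Real.posLog, Real.posLog, log_vS, mul_max_of_nonneg _ _ (by linarith), mul_max_of_nonneg _ _ (by linarith)]
    congr 1
    · simp
    · field_simp
  rw [h2]; gcongr
end Lau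
end
end
section
open Filter Finset NumberField Height
noncomputable section
namespace Lau
lemma SD.U.mul {K : Type} [Field K] {D : SD K} {a b : K} (ha : D.U a) (hb : D.U b) : D.U (a * b) :=
  ⟨mul_ne_zero ha.1 hb.1, D.R.mul_mem ha.2.1 hb.2.1, by rw [mul_inv]; exact D.R.mul_mem ha.2.2 hb.2.2⟩
abbrev Qb := AlgebraicClosure ℚ
lemma totC (E : IntermediateField ℚ Qb) [NumberField E] (i : E) (hi : i ^ 2 = -1) : IsTotallyComplex E := by
  refine ⟨fun w => ?_⟩
  rw [← InfinitePlace.not_isReal_iff_isComplex, InfinitePlace.isReal_iff]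
  intro h
  have h1 := congrArg (w.embedding) hi
  rw [map_pow, map_neg, map_one] at h1
  have h2 := ComplexEmbedding.isReal_iff.1 h
  have h3 := RingHom.congr_fun h2 i
  rw [ComplexEmbedding.conjugate_coe_eq] at h3
  obtain ⟨r, hr⟩ := Complex.conj_eq_iff_real.1 h3
  rw [hr] at h1
  have h4 : r ^ 2 = -1 := by exact_mod_cast h1
  nlinarith
theorem unitQ {T : Type} (𝒰 : Ultrafilter T) (G : Finset Qbˣ) {n : ℕ} (a : Fin n → Qb) (ha : ∀ i, a i ≠ 0) (x : T → Fin n → Qbˣ)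
    (hx : ∀ t i, x t i ∈ Subgroup.closure (G : Set Qbˣ)) (hn : 0 < n) (h : ∀ᶠ t in 𝒰, ∑ i, a i * x t i = 0) :
    ∃ i j, i ≠ j ∧ ∃ r : Qb, ∀ᶠ t in 𝒰, (x t i : Qb) = r * x t j := by
  classical
  obtain ⟨I, hI⟩ := IsAlgClosed.exists_pow_nat_eq (-1 : Qb) (n := 2) two_pos
  let s : Finset Qb := insert I (univ.image a ∪ G.image (fun u : Qbˣ => (u : Qb)))
  let E := IntermediateField.adjoin ℚ (s : Set Qb)
  have : FiniteDimensional ℚ E := IntermediateField.finiteDimensional_adjoin fun y _ => ((AlgebraicClosure.isAlgebraic ℚ).isAlgebraic y).isIntegral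
  have : NumberField E := ⟨⟩
  have hs : ∀ y ∈ s, y ∈ E := fun y hy => IntermediateField.subset_adjoin ℚ _ hy
  have : IsTotallyComplex E := totC E ⟨I, hs I (by simp [s])⟩ (Subtype.ext hI)
  let ι : {u // u ∈ G} → E := fun u => ⟨(u.1 : Qb), hs _ (mem_insert_of_mem (mem_union_right _ (mem_image_of_mem (fun u : Qbˣ => (u : Qb)) u.2)))⟩
  obtain ⟨D, hD, hN⟩ := exSD (K := E) (G.attach.image ι) (fun u hu => by
    obtain ⟨v, -, rfl⟩ := mem_image.1 hu
    exact fun h => v.1.ne_zero (congrArg Subtype.val h))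
  have hU : ∀ u ∈ Subgroup.closure (G : Set Qbˣ), ∃ k : E, (k : Qb) = u ∧ D.U k := fun u hu => by
    induction hu using Subgroup.closure_induction with
    | mem u hu => exact ⟨_, rfl, hD _ (mem_image_of_mem _ (mem_attach G ⟨u, hu⟩))⟩
    | one => exact ⟨1, rfl, one_ne_zero, D.R.one_mem, by rw [inv_one]; exact D.R.one_mem⟩
    | mul u v _ _ h1 h2 =>
      obtain ⟨k, h1, h1'⟩ := h1
      obtain ⟨l, h2, h2'⟩ := h2
      exact ⟨k * l, by push_cast; rw [h1, h2], h1'.mul h2'⟩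
    | inv u _ h1 =>
      obtain ⟨k, h1, h1'⟩ := h1
      exact ⟨k⁻¹, by push_cast; rw [h1], inv_ne_zero h1'.1, h1'.2.2, by rw [inv_inv]; exact h1'.2.1⟩
  choose y hy1 hy2 using fun t i => hU _ (hx t i)
  obtain ⟨i, j, hij, r, hr⟩ := unitW hN n (fun i => (⟨a i, hs _ (mem_insert_of_mem (mem_union_left _ (mem_image_of_mem _ (mem_univ i))))⟩ : E))
    (fun i h => ha i (congrArg Subtype.val h)) y hy2 hn (h.mono fun t ht => Subtype.ext (by
      push_cast; simpa only [hy1] using ht))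
  exact ⟨i, j, hij, r, hr.mono fun t ht => by rw [← hy1, ← hy1, ht]; rfl⟩
variable {N : ℕ}
def chi (c : Fin N → ℤ) : (Fin N → Qbˣ) →* Qbˣ where
  toFun x := ∏ i, x i ^ c i
  map_one' := by simp
  map_mul' x y := by simp [mul_zpow, prod_mul_distrib]
lemma chi_add (c d : Fin N → ℤ) (x : Fin N → Qbˣ) : chi (c + d) x = chi c x * chi d x := by
  simp [chi, zpow_add, prod_mul_distrib]
lemma chi_smul (k : ℤ) (c : Fin N → ℤ) (x : Fin N → Qbˣ) : chi (k • c) x = chi c x ^ k := by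
  simp [chi, mul_comm k, zpow_mul, prod_zpow]
lemma chi_zero (x : Fin N → Qbˣ) : chi (0 : Fin N → ℤ) x = 1 := by simp [chi]
lemma lau1 {Ω : Subgroup (Fin N → Qbˣ)} (hΩ : Group.FG Ω) {Sig : Set (Fin N → Qbˣ)} (hSig : Sig ⊆ Ω) (𝒰 : Ultrafilter Sig) :
    ∃ (C : Set (Fin N → ℤ)) (s : Fin N → Qbˣ), (∀ᶠ x : Sig in 𝒰, ∀ c ∈ C, chi c x.1 = chi c s) ∧
    ∀ f : MvPolynomial (Fin N) Qb, (∀ x ∈ Sig, MvPolynomial.eval (fun i => (x i : Qb)) f = 0) →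
      ∀ y : Fin N → Qbˣ, (∀ c ∈ C, chi c y = chi c s) → MvPolynomial.eval (fun i => (y i : Qb)) f = 0 := by
  classical
  let C : Submodule ℤ (Fin N → ℤ) :=
    { carrier := {c | ∃ r : Qbˣ, ∀ᶠ x : Sig in 𝒰, chi c x.1 = r}
      zero_mem' := ⟨1, Eventually.of_forall fun x => chi_zero _⟩
      add_mem' := by
        rintro c d ⟨r, hr⟩ ⟨r', hr'⟩
        exact ⟨r * r', by filter_upwards [hr, hr'] with x h h'; rw [chi_add, h, h']⟩
      smul_mem' := by
        rintro k c ⟨r, hr⟩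
        exact ⟨r ^ k, hr.mono fun x h => by rw [chi_smul, h]⟩ }
  obtain ⟨g, hg⟩ := (IsNoetherian.noetherian C : C.FG)
  have hgC : ∀ c : g, c.1 ∈ C := fun c => hg ▸ Submodule.subset_span c.2
  choose r hr using hgC
  have hev : ∀ᶠ x : Sig in 𝒰, ∀ c : g, chi c.1 x.1 = r c := eventually_all.2 hr
  obtain ⟨s, hs⟩ := hev.exists
  have hspan : ∀ x : Fin N → Qbˣ, (∀ c : g, chi c.1 x = r c) → ∀ c ∈ C, chi c x = chi c s.1 := fun x hx c hc => by
    rw [← hg] at hc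
    induction hc using Submodule.span_induction with
    | mem c hc => rw [hx ⟨c, hc⟩, hs ⟨c, hc⟩]
    | zero => rw [chi_zero, chi_zero]
    | add c d _ _ h1 h2 => rw [chi_add, chi_add, h1, h2]
    | smul k c _ h1 => rw [chi_smul, chi_smul, h1]
  have hev' : ∀ᶠ x : Sig in 𝒰, ∀ c ∈ C, chi c x.1 = chi c s.1 := hev.mono fun x hx => hspan x hx
  refine ⟨C, s, hev', fun f hf y hy => ?_⟩
  let e : (Fin N →₀ ℕ) → Fin N → ℤ := fun m i => m i
  let π := C.mkQ
  let ρ : (Fin N → ℤ) ⧸ C → Fin N → ℤ := Quotient.out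
  have hρ : ∀ k, π (ρ k) = k := fun k => Quotient.out_eq k
  let A : (Fin N → ℤ) ⧸ C → Qb := fun k => ∑ m ∈ f.support with π (e m) = k, f.coeff m * (chi (e m - ρ k) s.1 : Qbˣ)
  let J := f.support.image fun m => π (e m)
  have key : ∀ x : Fin N → Qbˣ, (∀ c ∈ C, chi c x = chi c s.1) → MvPolynomial.eval (fun i => (x i : Qb)) f = ∑ k ∈ J, A k * (chi (ρ k) x : Qbˣ) := fun x hx => by
    rw [MvPolynomial.eval_eq', ← sum_fiberwise_of_maps_to (t := J) (g := fun m => π (e m)) fun m hm => mem_image_of_mem _ hm]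
    refine sum_congr rfl fun k _ => ?_
    rw [sum_mul]
    refine sum_congr rfl fun m hm => ?_
    have h1 : e m - ρ k ∈ C := by
      rw [← Submodule.Quotient.mk_eq_zero]
      change π (e m - ρ k) = 0
      rw [map_sub, hρ, (mem_filter.1 hm).2, sub_self]
    rw [← hx _ h1, mul_assoc, ← Units.val_mul, ← chi_add, sub_add_cancel]
    simp [chi, e]
  rw [key y hy]
  set E := J.filter fun k => A k ≠ 0 with hE
  have hEJ : ∀ x : Fin N → Qbˣ, ∑ k ∈ J, A k * (chi (ρ k) x : Qbˣ) = ∑ k ∈ E, A k * (chi (ρ k) x : Qbˣ) := fun x => by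
    rw [hE, sum_filter_of_ne]; intro k _ h h0; exact h (by rw [h0, zero_mul])
  rcases E.eq_empty_or_nonempty with h0 | hne
  · rw [hEJ, h0, sum_empty]
  exfalso
  obtain ⟨gΩ, hgΩ⟩ := ((Group.fg_iff_subgroup_fg Ω).1 hΩ : Ω.FG)
  let G : Finset Qbˣ := gΩ.biUnion fun u => univ.image u
  have hG : ∀ x ∈ Ω, ∀ i, x i ∈ Subgroup.closure (G : Set Qbˣ) := fun x hx i => by
    rw [← hgΩ] at hx
    induction hx using Subgroup.closure_induction with
    | mem u hu => exact Subgroup.subset_closure (mem_biUnion.2 ⟨u, hu, mem_image_of_mem _ (mem_univ i)⟩)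
    | one => exact Subgroup.one_mem _
    | mul u v _ _ h1 h2 => exact Subgroup.mul_mem _ h1 h2
    | inv u _ h1 => exact Subgroup.inv_mem _ h1
  have hchi : ∀ (x : Sig) c, chi c x.1 ∈ Subgroup.closure (G : Set Qbˣ) := fun x c =>
    Subgroup.prod_mem (t := univ) (Subgroup.closure (G : Set Qbˣ)) (f := fun i => x.1 i ^ c i) fun l _ => Subgroup.zpow_mem _ (hG x.1 (hSig x.2) l) _
  let eE := E.equivFin
  obtain ⟨i, j, hij, r, hr⟩ := unitQ 𝒰 G (n := E.card) (fun i => A (eE.symm i)) (fun i => (mem_filter.1 (eE.symm i).2).2)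
    (fun x i => chi (ρ (eE.symm i)) x.1) (fun x i => hchi x _) hne.card_pos (by
      filter_upwards [hev'] with x hx
      have h1 := hf x.1 x.2
      rw [key x.1 hx, hEJ, ← sum_coe_sort, ← Equiv.sum_comp eE.symm] at h1
      exact h1)
  apply hij
  apply eE.symm.injective
  apply Subtype.ext
  rw [← hρ (eE.symm i).1, ← hρ (eE.symm j).1, ← sub_eq_zero, ← map_sub]
  refine (Submodule.Quotient.mk_eq_zero C).2 ?_
  have hsub : ∀ x, chi (ρ (eE.symm i) - ρ (eE.symm j)) x * chi (ρ (eE.symm j)) x = chi (ρ (eE.symm i)) x := fun x => by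
    rw [← chi_add, sub_add_cancel]
  have hr' : ∀ᶠ x : Sig in 𝒰, ((chi (ρ (eE.symm i) - ρ (eE.symm j)) x.1 : Qbˣ) : Qb) = r := hr.mono fun x hx => by
    rw [← hsub, Units.val_mul] at hx
    exact mul_right_cancel₀ (Units.ne_zero _) hx
  obtain ⟨x0, hx0⟩ := hr'.exists
  exact ⟨_, hr'.mono fun x hx => Units.ext (hx.trans hx0.symm)⟩
theorem lau2 {Ω : Subgroup (Fin N → Qbˣ)} (hΩ : Group.FG Ω) {Sig : Set (Fin N → Qbˣ)} (hSig : Sig ⊆ Ω) :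
    ∃ (b : ℕ) (s : Fin b → (Fin N → Qbˣ)) (T : Fin b → Subgroup (Fin N → Qbˣ)),
      (∀ j, ∃ C : Set (Fin N → ℤ), ∀ t : Fin N → Qbˣ, t ∈ T j ↔ ∀ c ∈ C, (∏ i, t i ^ c i) = 1) ∧
      (Sig ⊆ ⋃ j, {y | ∃ x ∈ T j, y = s j * x}) ∧
      (∀ f : MvPolynomial (Fin N) Qb, (∀ x ∈ Sig, MvPolynomial.eval (fun i => (x i : Qb)) f = 0) →
        ∀ j, ∀ y : Fin N → Qbˣ, (∃ x ∈ T j, y = s j * x) → MvPolynomial.eval (fun i => (y i : Qb)) f = 0) := by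
  choose C s h1 h2 using fun 𝒰 : Ultrafilter Sig => lau1 hΩ hSig 𝒰
  obtain ⟨t, ht⟩ := isCompact_univ.elim_nhds_subcover (fun 𝒰 : Ultrafilter Sig => {u : Ultrafilter Sig | {x : Sig | ∀ c ∈ C 𝒰, chi c x.1 = chi c (s 𝒰)} ∈ u})
    fun 𝒰 _ => (ultrafilter_isOpen_basic _).mem_nhds (h1 𝒰)
  let e := t.equivFin
  let T : Ultrafilter Sig → Subgroup (Fin N → Qbˣ) := fun 𝒰 => ⨅ c ∈ C 𝒰, (chi c).ker
  have hT : ∀ 𝒰 t, t ∈ T 𝒰 ↔ ∀ c ∈ C 𝒰, chi c t = 1 := fun 𝒰 t => by simp [T, Subgroup.mem_iInf, MonoidHom.mem_ker]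
  refine ⟨t.card, fun j => s (e.symm j), fun j => T (e.symm j), fun j => ⟨C (e.symm j), fun t => hT _ t⟩, fun x hx => ?_, fun f hf j y hy => ?_⟩
  · obtain ⟨𝒰, h𝒰, hu⟩ := Set.mem_iUnion₂.1 (ht.2 (Set.mem_univ (pure ⟨x, hx⟩ : Ultrafilter Sig)))
    refine Set.mem_iUnion.2 ⟨e ⟨𝒰, h𝒰⟩, (s 𝒰)⁻¹ * x, ?_, ?_⟩
    · simp only [Equiv.symm_apply_apply]; rw [hT]
      intro c hc
      have h3 : chi c x = chi c (s 𝒰) := Ultrafilter.mem_pure.1 hu c hc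
      rw [map_mul, map_inv, h3, inv_mul_cancel]
    · simp only [Equiv.symm_apply_apply]; rw [mul_inv_cancel_left]
  · obtain ⟨x, hx, rfl⟩ := hy
    exact h2 _ f hf _ fun c hc => by rw [map_mul, (hT _ x).1 hx c hc, mul_one]
end Lau
end
end

/-- Laurent's theorem: the Zariski closure in the torus `(𝔾_m)^N` of any subset `Σ` of a
finitely generated subgroup `Ω ⊆ (ℚ̄ˣ)^N` is a finite union of translates `s_j·T_j` of
algebraic subgroups `T_j` (each cut out by monomial equations `∏ t_i^{c_i} = 1`):
`Σ` is covered by the cosets, and every polynomial vanishing on `Σ` vanishes on each coset. -/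
theorem stmt_7 (N : ℕ) (hN : 1 ≤ N)
    (Ω : Subgroup (Fin N → (AlgebraicClosure ℚ)ˣ)) (hΩ : Group.FG ↥Ω)
    (Sig : Set (Fin N → (AlgebraicClosure ℚ)ˣ)) (hSig : Sig ⊆ ↑Ω) :
    ∃ (b : ℕ) (s : Fin b → (Fin N → (AlgebraicClosure ℚ)ˣ))
      (T : Fin b → Subgroup (Fin N → (AlgebraicClosure ℚ)ˣ)),
      (∀ j, ∃ C : Set (Fin N → ℤ),
        ∀ t : Fin N → (AlgebraicClosure ℚ)ˣ,
          t ∈ T j ↔ ∀ c ∈ C, (∏ i, t i ^ c i) = 1) ∧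
      (Sig ⊆ ⋃ j, {y | ∃ x ∈ T j, y = s j * x}) ∧
      (∀ f : MvPolynomial (Fin N) (AlgebraicClosure ℚ),
        (∀ x ∈ Sig, MvPolynomial.eval (fun i => (x i : AlgebraicClosure ℚ)) f = 0) →
        ∀ j, ∀ y : Fin N → (AlgebraicClosure ℚ)ˣ, (∃ x ∈ T j, y = s j * x) →
          MvPolynomial.eval (fun i => (y i : AlgebraicClosure ℚ)) f = 0) := by
  exact Lau.lau2 hΩ hSig
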